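/- arXiv:1103.6065 — 6 statements merged into one kernel-verified Lean document; each statement's English description precedes it below -/
import Mathlib

section
/- For every real Banach space X there exist a real Banach space U of universal disposition for separable spaces and a linear isometric embedding of X into U. -/
universe u

/-- A real Banach space `U` is of universal disposition for separable spaces if for every
pair of separable real Banach spaces `A` and `B`, every linear isometric embedding
`u : A → U` and every linear isometric embedding `j : A → B`, there is a linear isometric
embedding `u' : B → U` with `u' ∘ j = u`. -/
def UnivDispSeparable (U : Type*) [NormedAddCommGroup U] [NormedSpace ℝ U] : Prop :=
  ∀ (A B : Type) [NormedAddCommGroup A] [NormedSpace ℝ A] [CompleteSpace A]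
    [TopologicalSpace.SeparableSpace A]
    [NormedAddCommGroup B] [NormedSpace ℝ B] [CompleteSpace B]
    [TopologicalSpace.SeparableSpace B]
    (u : A →ₗᵢ[ℝ] U) (j : A →ₗᵢ[ℝ] B),
    ∃ u' : B →ₗᵢ[ℝ] U, ∀ a : A, u' (j a) = u a

/-- A bundled real Banach space. -/
structure BanachSpaceR : Type (u + 1) where
  carrier : Type u
  [norm : NormedAddCommGroup carrier]
  [space : NormedSpace ℝ carrier]
  [complete : CompleteSpace carrier]

attribute [instance] BanachSpaceR.norm BanachSpaceR.space BanachSpaceR.complete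

/-- A linear functional dominated by a seminorm pulled back along a linear map factors through
a linear functional dominated by the seminorm. -/
theorem Seminorm.exists_dominated_factorization {V W : Type*} [AddCommGroup V] [Module ℝ V]
    [AddCommGroup W] [Module ℝ W] (q : Seminorm ℝ V) (M : W →ₗ[ℝ] V) (g : W →ₗ[ℝ] ℝ)
    (h : ∀ w, |g w| ≤ q (M w)) :
    ∃ F : V →ₗ[ℝ] ℝ, (∀ v, |F v| ≤ q v) ∧ ∀ w, F (M w) = g w := by
  have hker : LinearMap.ker M ≤ LinearMap.ker g := by
    intro w hw
    have := h w
    rw [LinearMap.mem_ker.1 hw, map_zero] at this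
    exact abs_nonpos_iff.1 this
  let g' : LinearMap.range M →ₗ[ℝ] ℝ :=
    (LinearMap.ker M).liftQ g hker ∘ₗ M.quotKerEquivRange.symm.toLinearMap
  have hg'M (w : W) : g' (M.rangeRestrict w) = g w := by
    have : M.quotKerEquivRange.symm (M.rangeRestrict w) = (LinearMap.ker M).mkQ w :=
      M.quotKerEquivRange_symm_apply_image w _
    simp [g', this]
  obtain ⟨F, hF, hle⟩ := Module.Dual.exists_extension_of_le_seminorm (𝕜 := ℝ) (LinearMap.range M) g'
    (p := q) (by
      rintro ⟨_, w, rfl⟩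
      have := hg'M w
      rw [Real.norm_eq_abs]
      exact (congrArg abs this).trans_le (h w))
  refine ⟨F, fun v => hle v, fun w => ?_⟩
  rw [← hg'M w]
  exact hF (M.rangeRestrict w)

/-- A linear map that preserves norms relative to a linear map of dense range extends to a
linear isometry. -/
theorem exists_linearIsometry_of_denseRange {W B U : Type*} [AddCommGroup W] [Module ℝ W]
    [NormedAddCommGroup B] [NormedSpace ℝ B] [NormedAddCommGroup U] [NormedSpace ℝ U]
    [CompleteSpace U] (M : W →ₗ[ℝ] B) (L : W →ₗ[ℝ] U) (hM : DenseRange M)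
    (h : ∀ w, ‖L w‖ = ‖M w‖) : ∃ T : B →ₗᵢ[ℝ] U, ∀ w, T (M w) = L w := by
  have hT (w : W) : L.extendOfNorm M (M w) = L w :=
    LinearMap.extendOfNorm_eq hM ⟨1, fun w => by rw [h w, one_mul]⟩ w
  refine ⟨⟨(L.extendOfNorm M).toLinearMap, fun b => ?_⟩, hT⟩
  refine hM.induction_on (p := fun b => ‖L.extendOfNorm M b‖ = ‖b‖) b
    (isClosed_eq (by fun_prop) (by fun_prop)) fun w => ?_
  rw [hT, h]

/-- Formal elements obtained from `X` by iterated adjunction of sequences. The term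
`adjoin q t n` is the `n`-th element adjoined to the sequence `t`, the seminorm `q` prescribing
the norms of linear combinations of old and new elements. -/
inductive ExtTerm (X : Type u) : Type u
  | base (x : X) : ExtTerm X
  | adjoin (q : Seminorm ℝ (ℕ ⊕ ℕ →₀ ℝ)) (t : ℕ → ExtTerm X) (n : ℕ) : ExtTerm X

namespace ExtTerm

open Finsupp (linearCombination)

variable {X : Type u}

/-- The sequence `t` together with the elements adjoined to it. -/
def gens (q : Seminorm ℝ (ℕ ⊕ ℕ →₀ ℝ)) (t : ℕ → ExtTerm X) : ℕ ⊕ ℕ → ExtTerm X :=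
  Sum.elim t (adjoin q t)

/-- On the old elements `t`, the seminorm `q` agrees with the seminorm induced by the set `A` of
functionals. -/
def Compatible (q : Seminorm ℝ (ℕ ⊕ ℕ →₀ ℝ)) (t : ℕ → ExtTerm X) (A : Set (ExtTerm X → ℝ)) :
    Prop :=
  ∀ c : ℕ →₀ ℝ, IsLUB ((fun f => |linearCombination ℝ (f ∘ t) c|) '' A) (q (c.mapDomain Sum.inl))

/-- The values `a` on old elements and `b` on new elements satisfy the constraint imposed by `q`
when `P` holds, and `b` vanishes otherwise. -/
def Valid (P : Prop) (q : Seminorm ℝ (ℕ ⊕ ℕ →₀ ℝ)) (a b : ℕ → ℝ) : Prop :=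
  (P → ∀ x, |linearCombination ℝ (Sum.elim a b) x| ≤ q x) ∧ (¬ P → b = 0)

section Hereditary

variable [NormedAddCommGroup X] [NormedSpace ℝ X]

variable (X) in
/-- Real functions on terms that restrict on `X` to a functional of norm at most one. -/
def baseFunctionals : Set (ExtTerm X → ℝ) :=
  {f | ∃ φ : StrongDual ℝ X, ‖φ‖ ≤ 1 ∧ ∀ x, f (base x) = φ x}

/-- Functions satisfying all the constraints imposed by a term and by the terms it is built
from. -/
def admissible : ExtTerm X → Set (ExtTerm X → ℝ)
  | base _ => baseFunctionals X
  | adjoin q t _ => {f | (∀ m, f ∈ admissible (t m)) ∧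
      Valid (Compatible q t {f | ∀ m, f ∈ admissible (t m)}) q (f ∘ t) (f ∘ adjoin q t)}

/-- The norm prescribed by `q` is compatible with the norm already determined on `t`. -/
def Good (q : Seminorm ℝ (ℕ ⊕ ℕ →₀ ℝ)) (t : ℕ → ExtTerm X) : Prop :=
  Compatible q t {f | ∀ m, f ∈ admissible (t m)}

theorem mem_admissible_adjoin {q : Seminorm ℝ (ℕ ⊕ ℕ →₀ ℝ)} {t : ℕ → ExtTerm X} {n : ℕ}
    {f : ExtTerm X → ℝ} : f ∈ admissible (adjoin q t n) ↔
      (∀ m, f ∈ admissible (t m)) ∧ Valid (Good q t) q (f ∘ t) (f ∘ adjoin q t) := by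
  rw [admissible]; rfl

theorem mem_admissible_base {x : X} {f : ExtTerm X → ℝ} :
    f ∈ admissible (base x) ↔ f ∈ baseFunctionals X := by
  rw [admissible]

theorem exists_valid {P : Prop} {q : Seminorm ℝ (ℕ ⊕ ℕ →₀ ℝ)} {a : ℕ → ℝ}
    (h : P → ∀ c : ℕ →₀ ℝ, |linearCombination ℝ a c| ≤ q (c.mapDomain Sum.inl)) :
    ∃ b, Valid P q a b := by
  by_cases hP : P
  · obtain ⟨F, hF, hFa⟩ := q.exists_dominated_factorization
      (Finsupp.lmapDomain ℝ ℝ Sum.inl) (linearCombination ℝ a) (h hP)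
    refine ⟨fun n => F (Finsupp.single (Sum.inr n) 1), fun _ x => ?_, fun h' => absurd hP h'⟩
    convert hF x using 2
    refine LinearMap.congr_fun (Finsupp.lhom_ext' fun i => LinearMap.ext_ring ?_) x
    rcases i with i | i
    · simpa using (hFa (Finsupp.single i 1)).symm
    · simp
  · exact ⟨0, fun h' => absurd h' hP, fun _ => rfl⟩

open Classical in
/-- The values of `h` on newly adjoined elements, replaced by some valid ones if necessary. -/
noncomputable def corrected (h : ExtTerm X → ℝ) : ExtTerm X → ℝ
  | base x => h (base x)
  | adjoin q t n =>
    if Valid (Good q t) q (fun m => corrected h (t m)) (h ∘ adjoin q t) then h (adjoin q t n)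
    else Classical.epsilon (Valid (Good q t) q (fun m => corrected h (t m))) n

theorem corrected_mem_admissible {h : ExtTerm X → ℝ} (hh : h ∈ baseFunctionals X)
    (s : ExtTerm X) : corrected h ∈ admissible s := by
  induction s with
  | base x =>
    obtain ⟨φ, hφ, hx⟩ := hh
    exact mem_admissible_base.2 ⟨φ, hφ, fun x => by rw [corrected, hx]⟩
  | adjoin q t n ih =>
    refine mem_admissible_adjoin.2 ⟨ih, ?_⟩
    by_cases hv : Valid (Good q t) q (corrected h ∘ t) (h ∘ adjoin q t)
    · convert hv using 1
      ext k
      rw [Function.comp_apply, corrected]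
      exact if_pos hv
    · have hv' : corrected h ∘ adjoin q t =
          Classical.epsilon (Valid (Good q t) q (corrected h ∘ t)) := by
        ext k
        rw [Function.comp_apply, corrected]
        exact if_neg hv
      rw [hv']
      exact Classical.epsilon_spec (exists_valid fun hg c => (hg c).1 ⟨_, ih, rfl⟩)

theorem corrected_eq {h : ExtTerm X → ℝ} {s : ExtTerm X} (hs : h ∈ admissible s) :
    corrected h s = h s := by
  induction s with
  | base x => rw [corrected]
  | adjoin q t n ih =>
    obtain ⟨ht, hv⟩ := mem_admissible_adjoin.1 hs
    have ht' : (fun m => corrected h (t m)) = h ∘ t := funext fun m => ih m (ht m)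
    rw [corrected, ht', if_pos hv]

theorem mem_baseFunctionals {f : ExtTerm X → ℝ} {s : ExtTerm X} (hf : f ∈ admissible s) :
    f ∈ baseFunctionals X := by
  induction s with
  | base x => exact mem_admissible_base.1 hf
  | adjoin q t n ih => exact ih 0 ((mem_admissible_adjoin.1 hf).1 0)

end Hereditary

/-- The rank of a term in the hierarchy of successive adjunctions. -/
noncomputable def rank : ExtTerm X → Ordinal.{0}
  | base _ => 0
  | adjoin _ t _ => ⨆ n, Order.succ (rank (t n))

theorem rank_lt_rank_adjoin (q : Seminorm ℝ (ℕ ⊕ ℕ →₀ ℝ)) (t : ℕ → ExtTerm X) (m n : ℕ) :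
    rank (t m) < rank (adjoin q t n) := by
  rw [rank, ← Order.succ_le_iff]
  exact Ordinal.le_iSup (fun n => Order.succ (rank (t n))) m

variable [NormedAddCommGroup X] [NormedSpace ℝ X]

/-- Admissibility for a term depends only on the values at terms of at most the same rank. -/
theorem admissible_congr {f h : ExtTerm X → ℝ} {ρ : Ordinal.{0}}
    (hρ : ∀ s, rank s < ρ → h s = f s) (h0 : h ∈ baseFunctionals X)
    (hf : ∀ s, f ∈ admissible s) (s : ExtTerm X) (hs : rank s < ρ) : h ∈ admissible s := by
  induction s with
  | base x => exact mem_admissible_base.2 h0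
  | adjoin q t n ih =>
    have ht (m : ℕ) : rank (t m) < ρ := (rank_lt_rank_adjoin q t m n).trans hs
    refine mem_admissible_adjoin.2 ⟨fun m => ih m (ht m), ?_⟩
    have h1 : h ∘ t = f ∘ t := funext fun m => hρ _ (ht m)
    have h2 : h ∘ adjoin q t = f ∘ adjoin q t :=
      funext fun k => hρ _ (by rw [rank] at hs ⊢; exact hs)
    rw [h1, h2]
    exact (mem_admissible_adjoin.1 (hf (adjoin q t n))).2

variable (X) in
/-- The functions that are admissible for every term. -/
def dualBall : Set (ExtTerm X → ℝ) := {f | ∀ s, f ∈ admissible s}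

theorem exists_abs_le (s : ExtTerm X) : ∃ C, ∀ f ∈ dualBall X, |f s| ≤ C := by
  cases s with
  | base x =>
    refine ⟨‖x‖, fun f hf => ?_⟩
    obtain ⟨φ, hφ, h⟩ := mem_admissible_base.1 (hf (base x))
    rw [h]
    exact φ.le_of_opNorm_le hφ x |>.trans (one_mul _).le
  | adjoin q t n =>
    refine ⟨q (Finsupp.single (Sum.inr n) 1), fun f hf => ?_⟩
    obtain ⟨h1, h2⟩ := (mem_admissible_adjoin.1 (hf (adjoin q t n))).2
    by_cases hg : Good q t
    · simpa using h1 hg (Finsupp.single (Sum.inr n) 1)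
    · have := congrFun (h2 hg) n
      rw [Function.comp_apply, Pi.zero_apply] at this
      rw [this, abs_zero]
      exact apply_nonneg _ _

open scoped BoundedContinuousFunction

/-- Evaluation at a term, as a bounded function on the dual ball. -/
noncomputable def eval (s : ExtTerm X) : dualBall X →ᵇ ℝ :=
  BoundedContinuousFunction.ofNormedAddCommGroup (fun f => f.1 s)
    ((continuous_apply s).comp continuous_subtype_val) (exists_abs_le s).choose
    fun f => (exists_abs_le s).choose_spec f.1 f.2

theorem eval_apply (s : ExtTerm X) (f : dualBall X) : eval s f = f.1 s := rfl

theorem linearCombination_eval_apply {ι : Type*} (τ : ι → ExtTerm X) (c : ι →₀ ℝ)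
    (f : dualBall X) :
    linearCombination ℝ (eval ∘ τ) c f = linearCombination ℝ (f.1 ∘ τ) c := by
  have := LinearMap.congr_fun (Finsupp.linearCombination_linear_comp ℝ (v := eval ∘ τ)
    (BoundedContinuousFunction.evalCLM ℝ f).toLinearMap) c
  exact this.symm

instance : Nonempty (dualBall X) :=
  ⟨corrected 0, corrected_mem_admissible ⟨0, by simp, fun _ => rfl⟩⟩

theorem exists_mem_dualBall_base {φ : StrongDual ℝ X} (hφ : ‖φ‖ ≤ 1) :
    ∃ f ∈ dualBall X, ∀ x, f (base x) = φ x := by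
  let h : ExtTerm X → ℝ
    | base x => φ x
    | adjoin _ _ _ => 0
  have hh : h ∈ baseFunctionals X := ⟨φ, hφ, fun _ => rfl⟩
  exact ⟨_, corrected_mem_admissible hh, fun x => corrected_eq (mem_admissible_base.2 hh)⟩

/-- The canonical isometric embedding of `X`. -/
noncomputable def evalBase : X →ₗᵢ[ℝ] (dualBall X →ᵇ ℝ) where
  toFun x := eval (base x)
  map_add' x y := by
    ext f
    obtain ⟨φ, -, h⟩ := mem_admissible_base.1 (f.2 (base x))
    simp [eval_apply, h]
  map_smul' r x := by
    ext f
    obtain ⟨φ, -, h⟩ := mem_admissible_base.1 (f.2 (base x))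
    simp [eval_apply, h]
  norm_map' x := by
    change ‖eval (base x)‖ = ‖x‖
    apply le_antisymm
    · refine BoundedContinuousFunction.norm_le_of_nonempty.2 fun f => ?_
      obtain ⟨φ, hφ, h⟩ := mem_admissible_base.1 (f.2 (base x))
      rw [eval_apply, h]
      exact φ.le_of_opNorm_le hφ x |>.trans (one_mul _).le
    · obtain ⟨φ, hφ, hx⟩ := exists_dual_vector'' ℝ x
      obtain ⟨f, hf, h⟩ := exists_mem_dualBall_base hφ
      have := (eval (base x)).norm_coe_le_norm ⟨f, hf⟩
      rw [eval_apply] at this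
      simpa [h, hx] using this

/-- A seminorm that prescribes the correct norms on old elements is compatible. -/
theorem good_of_norm_eq {q : Seminorm ℝ (ℕ ⊕ ℕ →₀ ℝ)} {t : ℕ → ExtTerm X}
    (h : ∀ c : ℕ →₀ ℝ, ‖linearCombination ℝ (eval ∘ t) c‖ = q (c.mapDomain Sum.inl)) :
    Good q t := by
  intro c
  rw [← h c]
  constructor
  · rintro _ ⟨f, hf, rfl⟩
    have hf' : corrected f ∈ dualBall X := corrected_mem_admissible (mem_baseFunctionals (hf 0))
    have := (linearCombination ℝ (eval ∘ t) c).norm_coe_le_norm ⟨_, hf'⟩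
    rw [linearCombination_eval_apply] at this
    have hft : corrected f ∘ t = f ∘ t := funext fun m => corrected_eq (hf m)
    rwa [hft] at this
  · intro b hb
    refine BoundedContinuousFunction.norm_le_of_nonempty.2 fun f => ?_
    rw [linearCombination_eval_apply]
    exact hb ⟨f.1, fun m => f.2 (t m), rfl⟩

theorem norm_linearCombination_gens_le {q : Seminorm ℝ (ℕ ⊕ ℕ →₀ ℝ)} {t : ℕ → ExtTerm X}
    (h : Good q t) (x : ℕ ⊕ ℕ →₀ ℝ) : ‖linearCombination ℝ (eval ∘ gens q t) x‖ ≤ q x := by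
  refine BoundedContinuousFunction.norm_le_of_nonempty.2 fun f => ?_
  rw [linearCombination_eval_apply, gens, Sum.comp_elim]
  exact (mem_admissible_adjoin.1 (f.2 (adjoin q t 0))).2.1 h x

/-- The dual ball contains every functional of norm at most one. -/
theorem comp_eval_mem_dualBall {F : (dualBall X →ᵇ ℝ) →ₗ[ℝ] ℝ} (hF : ∀ v, |F v| ≤ ‖v‖) :
    (fun s => F (eval s)) ∈ dualBall X := by
  intro s
  induction s with
  | base x =>
    refine mem_admissible_base.2
      ⟨(F ∘ₗ (evalBase (X := X)).toLinearMap).mkContinuous 1 fun x => ?_,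
        LinearMap.mkContinuous_norm_le _ zero_le_one _, fun x => rfl⟩
    rw [one_mul, ← evalBase.norm_map x]
    exact hF _
  | adjoin q t n ih =>
    refine mem_admissible_adjoin.2 ⟨ih, fun hg x => ?_, fun hg => ?_⟩
    · have : Sum.elim ((fun s => F (eval s)) ∘ t) ((fun s => F (eval s)) ∘ adjoin q t) =
          F ∘ (eval ∘ gens q t) := by
        rw [gens, ← Sum.comp_elim]; rfl
      rw [this]
      have h2 := LinearMap.congr_fun
        (Finsupp.linearCombination_linear_comp ℝ (v := eval ∘ gens q t) F) x
      rw [h2]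
      exact (hF _).trans (norm_linearCombination_gens_le hg x)
    · have h0 : ∀ k, eval (adjoin q t k) = 0 := fun k => by
        ext f
        exact congrFun ((mem_admissible_adjoin.1 (f.2 (adjoin q t k))).2.2 hg) k
      ext k
      simp [h0]

theorem norm_linearCombination_gens {q : Seminorm ℝ (ℕ ⊕ ℕ →₀ ℝ)} {t : ℕ → ExtTerm X}
    (h : ∀ c : ℕ →₀ ℝ, ‖linearCombination ℝ (eval ∘ t) c‖ = q (c.mapDomain Sum.inl))
    (x : ℕ ⊕ ℕ →₀ ℝ) : ‖linearCombination ℝ (eval ∘ gens q t) x‖ = q x := by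
  have hgood := good_of_norm_eq h
  apply le_antisymm (norm_linearCombination_gens_le hgood x)
  obtain ⟨g, hg, hgx⟩ := q.exists_dominated_factorization (LinearMap.toSpanSingleton ℝ _ x)
    (LinearMap.toSpanSingleton ℝ ℝ (q x)) (fun r => by
      simp [map_smul_eq_mul, abs_mul, abs_of_nonneg (apply_nonneg q x)])
  replace hgx : g x = q x := by simpa using hgx 1
  obtain ⟨F, hF, hFt⟩ := (normSeminorm ℝ (dualBall X →ᵇ ℝ)).exists_dominated_factorization
    (linearCombination ℝ (eval ∘ t)) (g ∘ₗ Finsupp.lmapDomain ℝ ℝ Sum.inl)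
    (fun c => (hg _).trans_eq (h c).symm)
  let f : ExtTerm X → ℝ := fun s => F (eval s)
  have hf : f ∈ dualBall X := comp_eval_mem_dualBall hF
  let ρ := rank (adjoin q t 0)
  let f' : ExtTerm X → ℝ := fun s => if rank s < ρ then f s else
    match s with
    | base _ => 0
    | adjoin _ _ n => g (Finsupp.single (Sum.inr n) 1)
  have hf' (s : ExtTerm X) (hs : rank s < ρ) : f' s = f s := if_pos hs
  have ht (m : ℕ) : rank (t m) < ρ := rank_lt_rank_adjoin q t m 0
  have hf'0 : f' ∈ baseFunctionals X := by
    obtain ⟨φ, hφ, hx⟩ := mem_admissible_base.1 (hf (base 0))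
    refine ⟨φ, hφ, fun x => (hf' _ ?_).trans (hx x)⟩
    rw [rank]
    exact zero_le.trans_lt (ht 0)
  have hgens : Sum.elim (f' ∘ t) (f' ∘ adjoin q t) = fun i => g (Finsupp.single i 1) := by
    ext (m | n)
    · have := hFt (Finsupp.single m 1)
      simpa [hf' _ (ht m), f] using this
    · have : ¬ rank (adjoin q t n) < ρ := by simp [ρ, rank]
      simp [f', this]
  have hlin (x) : linearCombination ℝ (Sum.elim (f' ∘ t) (f' ∘ adjoin q t)) x = g x := by
    rw [hgens]
    refine LinearMap.congr_fun (Finsupp.lhom_ext' fun i => LinearMap.ext_ring ?_) x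
    simp
  have hmem (n : ℕ) : f' ∈ admissible (adjoin q t n) :=
    mem_admissible_adjoin.2 ⟨fun m => admissible_congr hf' hf'0 hf _ (ht m),
      fun _ x => by rw [hlin]; exact hg x, fun hb => absurd hgood hb⟩
  have heq : corrected f' ∘ gens q t = Sum.elim (f' ∘ t) (f' ∘ adjoin q t) := by
    ext (m | n)
    · exact corrected_eq ((mem_admissible_adjoin.1 (hmem 0)).1 m)
    · exact corrected_eq (hmem n)
  have := (linearCombination ℝ (eval ∘ gens q t) x).norm_coe_le_norm
    ⟨_, corrected_mem_admissible hf'0⟩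
  rw [linearCombination_eval_apply, heq, hlin, hgx] at this
  exact (le_abs_self _).trans this

theorem mem_range_eval_of_mem_closure {t : ℕ → ExtTerm X} {v : dualBall X →ᵇ ℝ}
    (hv : v ∈ closure (Set.range (linearCombination ℝ (eval ∘ t)))) : v ∈ Set.range eval := by
  let M : (ℕ ⊕ ℕ →₀ ℝ) →ₗ[ℝ] (dualBall X →ᵇ ℝ) :=
    linearCombination ℝ (Sum.elim (eval ∘ t) fun _ => v)
  let q : Seminorm ℝ (ℕ ⊕ ℕ →₀ ℝ) := (normSeminorm ℝ (dualBall X →ᵇ ℝ)).comp M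
  have hM (c : ℕ →₀ ℝ) : M (c.mapDomain Sum.inl) = linearCombination ℝ (eval ∘ t) c :=
    Finsupp.linearCombination_mapDomain _ _ _
  have hq (c : ℕ →₀ ℝ) : ‖linearCombination ℝ (eval ∘ t) c‖ = q (c.mapDomain Sum.inl) := by
    rw [← hM]; rfl
  refine ⟨adjoin q t 0, eq_of_forall_dist_le fun ε hε => ?_⟩
  obtain ⟨_, ⟨c, rfl⟩, hc⟩ := Metric.mem_closure_iff.1 hv (ε / 2) (half_pos hε)
  have key := norm_linearCombination_gens hq (c.mapDomain Sum.inl - Finsupp.single (Sum.inr 0) 1)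
  have hqM (x) : q x = ‖M x‖ := rfl
  rw [hqM, map_sub, map_sub, hM, Finsupp.linearCombination_mapDomain, gens, Sum.comp_elim,
    Sum.elim_comp_inl] at key
  simp only [M, Finsupp.linearCombination_single, Sum.elim_inr, one_smul, Function.comp_apply]
    at key
  rw [← dist_eq_norm, ← dist_eq_norm, dist_comm, dist_comm _ v] at key
  calc dist (eval (adjoin q t 0)) v
      ≤ dist (eval (adjoin q t 0)) (linearCombination ℝ (eval ∘ t) c)
        + dist v (linearCombination ℝ (eval ∘ t) c) := dist_triangle_right _ _ _
    _ ≤ ε := by rw [key]; linarith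

variable (X) in
/-- The space of all evaluations. -/
noncomputable def evaluations : Submodule ℝ (dualBall X →ᵇ ℝ) where
  carrier := Set.range eval
  zero_mem' := mem_range_eval_of_mem_closure (t := fun _ => base 0)
    (subset_closure ⟨0, map_zero _⟩)
  add_mem' := by
    rintro _ _ ⟨a, rfl⟩ ⟨b, rfl⟩
    refine mem_range_eval_of_mem_closure (t := fun n => if n = 0 then a else b)
      (subset_closure ⟨Finsupp.single 0 1 + Finsupp.single 1 1, ?_⟩)
    simp
  smul_mem' := by
    rintro r _ ⟨a, rfl⟩
    refine mem_range_eval_of_mem_closure (t := fun _ => a)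
      (subset_closure ⟨Finsupp.single 0 r, ?_⟩)
    simp

theorem isClosed_evaluations : IsClosed (evaluations X : Set (dualBall X →ᵇ ℝ)) := by
  refine isClosed_of_closure_subset fun v hv => ?_
  obtain ⟨x, hx, hxv⟩ := mem_closure_iff_seq_limit.1 hv
  choose t ht using hx
  refine mem_range_eval_of_mem_closure (t := t) (mem_closure_of_tendsto hxv ?_)
  refine Filter.Eventually.of_forall fun n => ⟨Finsupp.single n 1, ?_⟩
  simp [ht]

theorem univDispSeparable_evaluations : UnivDispSeparable (evaluations X) := by
  intro A B _ _ _ _ _ _ _ _ u j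
  have : CompleteSpace (evaluations X) := isClosed_evaluations.completeSpace_coe
  let a := TopologicalSpace.denseSeq A
  let b := TopologicalSpace.denseSeq B
  choose t ht using fun n => (u (a n)).2
  let M : (ℕ ⊕ ℕ →₀ ℝ) →ₗ[ℝ] B := linearCombination ℝ (Sum.elim (j ∘ a) b)
  let q : Seminorm ℝ (ℕ ⊕ ℕ →₀ ℝ) := (normSeminorm ℝ B).comp M
  have hq (c : ℕ →₀ ℝ) : ‖linearCombination ℝ (eval ∘ t) c‖ = q (c.mapDomain Sum.inl) := by
    have h1 : linearCombination ℝ (eval ∘ t) c = u (linearCombination ℝ a c) := by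
      have : eval ∘ t = ((evaluations X).subtype ∘ₗ u.toLinearMap) ∘ a := funext ht
      rw [this]
      exact LinearMap.congr_fun (Finsupp.linearCombination_linear_comp ℝ (v := a) _) c
    have h2 : M (c.mapDomain Sum.inl) = j (linearCombination ℝ a c) := by
      rw [Finsupp.linearCombination_mapDomain]
      exact LinearMap.congr_fun (Finsupp.linearCombination_linear_comp ℝ (v := a) j.toLinearMap) c
    change _ = ‖M _‖
    rw [h1, h2, j.norm_map]
    exact u.norm_map _
  let e : ℕ ⊕ ℕ → evaluations X := fun i => ⟨eval (gens q t i), _, rfl⟩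
  let L : (ℕ ⊕ ℕ →₀ ℝ) →ₗ[ℝ] evaluations X := linearCombination ℝ e
  have hL (x) : ‖L x‖ = ‖M x‖ := by
    have h1 := LinearMap.congr_fun
      (Finsupp.linearCombination_linear_comp ℝ (v := e) (evaluations X).subtype) x
    exact (congrArg norm h1).symm.trans (norm_linearCombination_gens hq x)
  have hM : DenseRange M := by
    refine (TopologicalSpace.denseRange_denseSeq B).mono ?_
    rintro _ ⟨n, rfl⟩
    exact ⟨Finsupp.single (Sum.inr n) 1, by simp [M, b]⟩
  obtain ⟨T, hT⟩ := exists_linearIsometry_of_denseRange (U := evaluations X) M L hM hL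
  refine ⟨T, fun x => ?_⟩
  refine (TopologicalSpace.denseRange_denseSeq A).induction_on (p := fun x => T (j x) = u x) x
    (isClosed_eq (by fun_prop) (by fun_prop)) fun n => ?_
  have := hT (Finsupp.single (Sum.inl n) 1)
  simp only [M, L, Finsupp.linearCombination_single, one_smul, Sum.elim_inl,
    Function.comp_apply] at this
  exact this.trans (Subtype.ext (ht n))

end ExtTerm

/-- For every real Banach space `X` there exist a real Banach space `U` of universal
disposition for separable spaces and a linear isometric embedding of `X` into `U`. -/
theorem exists_univDispSeparable_extension (X : Type u)
    [NormedAddCommGroup X] [NormedSpace ℝ X] [CompleteSpace X] :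
    ∃ U : BanachSpaceR.{u}, UnivDispSeparable U.carrier ∧
      Nonempty (X →ₗᵢ[ℝ] U.carrier) := by
  have : CompleteSpace (ExtTerm.evaluations X) :=
    ExtTerm.isClosed_evaluations.completeSpace_coe
  exact ⟨⟨ExtTerm.evaluations X⟩, ExtTerm.univDispSeparable_evaluations,
    ⟨⟨ExtTerm.evalBase.toLinearMap.codRestrict _ fun x => ⟨ExtTerm.base x, rfl⟩,
      ExtTerm.evalBase.norm_map⟩⟩⟩
end

section
/- For every real Banach space X there exist a real Banach space U of universal disposition for finite-dimensional spaces and a linear isometric embedding of X into U. -/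
universe u

/-- A real Banach space `U` is of universal disposition for finite-dimensional spaces if for
every pair of finite-dimensional real normed spaces `A` and `B`, every linear isometric
embedding `u : A → U` and every linear isometric embedding `j : A → B`, there is a linear
isometric embedding `u' : B → U` with `u' ∘ j = u`. -/
def UnivDispFinDim (U : Type*) [NormedAddCommGroup U] [NormedSpace ℝ U] : Prop :=
  ∀ (A B : Type) [NormedAddCommGroup A] [NormedSpace ℝ A] [FiniteDimensional ℝ A]
    [NormedAddCommGroup B] [NormedSpace ℝ B] [FiniteDimensional ℝ B]
    (u : A →ₗᵢ[ℝ] U) (j : A →ₗᵢ[ℝ] B),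
    ∃ u' : B →ₗᵢ[ℝ] U, ∀ a : A, u' (j a) = u a

open Filter Topology
open scoped ENNReal

namespace UnivDisp

/-- `u` distorts norms by a factor of at most `K`, in both directions. -/
def AlmostIso {A X : Type*} [NormedAddCommGroup A] [NormedSpace ℝ A]
    [NormedAddCommGroup X] [NormedSpace ℝ X] (K : ℝ) (u : A →ₗ[ℝ] X) : Prop :=
  ∀ a, ‖u a‖ ≤ K * ‖a‖ ∧ ‖a‖ ≤ K * ‖u a‖

section

variable {A B X : Type*} [NormedAddCommGroup A] [NormedSpace ℝ A]
  [NormedAddCommGroup B] [NormedSpace ℝ B] [NormedAddCommGroup X] [NormedSpace ℝ X]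

theorem AlmostIso.injective {K : ℝ} {u : A →ₗ[ℝ] X} (h : AlmostIso K u) :
    Function.Injective u := by
  rw [injective_iff_map_eq_zero]
  intro a ha
  have := (h a).2
  rw [ha, norm_zero, mul_zero] at this
  exact norm_le_zero_iff.1 this

/-- Hahn–Banach extension of a functional along an injective linear map. -/
theorem exists_functional_comp_eq {u : A →ₗ[ℝ] X} (hu : Function.Injective u) (f : A →ₗ[ℝ] ℝ)
    {c : ℝ} (hc : 0 ≤ c) (h : ∀ a, ‖f a‖ ≤ c * ‖u a‖) :
    ∃ φ : X →L[ℝ] ℝ, ‖φ‖ ≤ c ∧ ∀ a, φ (u a) = f a := by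
  let e := LinearEquiv.ofInjective u hu
  have he : ∀ x, u (e.symm x) = x := fun x => by
    conv_rhs => rw [← e.apply_symm_apply x]
    rfl
  let g : LinearMap.range u →L[ℝ] ℝ := (f ∘ₗ e.symm.toLinearMap).mkContinuous c fun x => by
    have := h (e.symm x)
    rw [he] at this
    exact this
  obtain ⟨φ, h1, h2⟩ := exists_extension_norm_eq (LinearMap.range u) g
  refine ⟨φ, h2.le.trans (LinearMap.mkContinuous_norm_le _ hc _), fun a => ?_⟩
  have : φ (u a) = f (e.symm (e a)) := h1 (e a)
  rwa [e.symm_apply_apply] at this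

/-- Bundle a uniformly bounded family of linear maps into a linear map to the `ℓ^∞`-sum. -/
noncomputable def toLp {ι : Type*} {E : ι → Type*} [∀ i, NormedAddCommGroup (E i)]
    [∀ i, NormedSpace ℝ (E i)] (T : ∀ i, X →ₗ[ℝ] E i) (K : ℝ)
    (h : ∀ i x, ‖T i x‖ ≤ K * ‖x‖) : X →ₗ[ℝ] lp E ∞ where
  toFun x := ⟨fun i => T i x, memℓp_infty ⟨K * ‖x‖, by rintro _ ⟨i, rfl⟩; exact h i x⟩⟩
  map_add' x y := by ext i; exact map_add (T i) x y
  map_smul' c x := by ext i; exact map_smul (T i) c x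

@[simp]
theorem toLp_apply {ι : Type*} {E : ι → Type*} [∀ i, NormedAddCommGroup (E i)]
    [∀ i, NormedSpace ℝ (E i)] (T : ∀ i, X →ₗ[ℝ] E i) (K : ℝ)
    (h : ∀ i x, ‖T i x‖ ≤ K * ‖x‖) (x : X) (i : ι) : toLp T K h x i = T i x := rfl

theorem norm_toLp_le {ι : Type*} {E : ι → Type*} [∀ i, NormedAddCommGroup (E i)]
    [∀ i, NormedSpace ℝ (E i)] (T : ∀ i, X →ₗ[ℝ] E i) {K : ℝ} (hK : 0 ≤ K)
    (h : ∀ i x, ‖T i x‖ ≤ K * ‖x‖) (x : X) : ‖toLp T K h x‖ ≤ K * ‖x‖ :=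
  lp.norm_le_of_forall_le (by positivity) fun i => h i x

theorem exists_surjective_dual [FiniteDimensional ℝ B] :
    ∃ e : (ℕ → ℝ) → (B →L[ℝ] ℝ), Function.Surjective e := by
  let b := Module.finBasis ℝ B
  refine ⟨fun s => LinearMap.toContinuousLinearMap (b.constr ℝ fun i => s i), fun g => ?_⟩
  refine ⟨fun n => if h : n < Module.finrank ℝ B then g (b ⟨n, h⟩) else 0, ?_⟩
  apply ContinuousLinearMap.coe_injective
  refine b.ext fun i => ?_
  simp

variable (X) in
/-- The index set of `Step X`: functionals in the dual unit ball, each repeated often enough to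
leave room for all possible extensions to a finite-dimensional superspace. -/
abbrev StepIndex : Type _ := {φ : X →L[ℝ] ℝ // ‖φ‖ ≤ 1} × (ℕ → ℝ)

variable (X) in
/-- A superspace of `X` in which almost isometric embeddings of finite-dimensional spaces
into `X` extend. -/
abbrev Step : Type _ := lp (fun _ : StepIndex X => ℝ) ∞

theorem norm_functional_le (φ : {φ : X →L[ℝ] ℝ // ‖φ‖ ≤ 1}) (x : X) : ‖φ.1 x‖ ≤ 1 * ‖x‖ :=
  φ.1.le_of_opNorm_le φ.2 x

variable (X) in
/-- The canonical embedding of `X` into `Step X`. -/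
noncomputable def stepEmb : X →ₗᵢ[ℝ] Step X where
  toLinearMap := toLp (fun γ : StepIndex X => (γ.1.1 : X →ₗ[ℝ] ℝ)) 1
    fun γ x => norm_functional_le γ.1 x
  norm_map' x := by
    apply le_antisymm
    · simpa using norm_toLp_le (fun γ : StepIndex X => (γ.1.1 : X →ₗ[ℝ] ℝ)) zero_le_one
        (fun γ x => norm_functional_le γ.1 x) x
    · obtain ⟨g, hg, hgx⟩ := exists_dual_vector'' ℝ x
      refine le_trans ?_ (lp.norm_apply_le_norm ENNReal.top_ne_zero _ (⟨g, hg⟩, 0))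
      simp [hgx]

theorem stepEmb_apply (x : X) (γ : StepIndex X) : stepEmb X x γ = γ.1.1 x := rfl

/-- Almost isometric embeddings into `X` extend to `Step X` without increasing the distortion. -/
theorem exists_step_extension [FiniteDimensional ℝ B] (j : A →ₗᵢ[ℝ] B) (u : A →ₗ[ℝ] X) {K : ℝ}
    (hK : 1 ≤ K) (hu : AlmostIso K u) :
    ∃ v : B →ₗ[ℝ] Step X, (∀ a, v (j a) = stepEmb X (u a)) ∧ AlmostIso K v := by
  have hK0 : 0 < K := by linarith
  obtain ⟨e, he⟩ := exists_surjective_dual (B := B)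
  have key : ∀ γ : StepIndex X, ∃ g : B →L[ℝ] ℝ, ‖g‖ ≤ K ∧ (∀ a, g (j a) = γ.1.1 (u a)) ∧
      ((‖e γ.2‖ ≤ K ∧ ∀ a, e γ.2 (j a) = γ.1.1 (u a)) → g = e γ.2) := by
    intro γ
    by_cases h : ‖e γ.2‖ ≤ K ∧ ∀ a, e γ.2 (j a) = γ.1.1 (u a)
    · exact ⟨e γ.2, h.1, h.2, fun _ => rfl⟩
    · obtain ⟨g, h1, h2⟩ := exists_functional_comp_eq (u := j.toLinearMap) j.injective
        ((γ.1.1 : X →ₗ[ℝ] ℝ) ∘ₗ u) hK0.le fun a => by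
          have := norm_functional_le γ.1 (u a)
          simpa using this.trans (by simpa using (hu a).1)
      exact ⟨g, h1, h2, fun h' => absurd h' h⟩
  choose g hg hgj hge using key
  have hgb : ∀ γ b, ‖(g γ : B →ₗ[ℝ] ℝ) b‖ ≤ K * ‖b‖ := fun γ b => (g γ).le_of_opNorm_le (hg γ) b
  refine ⟨toLp (fun γ => (g γ : B →ₗ[ℝ] ℝ)) K hgb, fun a => ?_, fun b =>
    ⟨norm_toLp_le _ hK0.le hgb b, ?_⟩⟩
  · ext γ
    simpa [stepEmb_apply] using hgj γ a
  · obtain ⟨f, hf, hfb⟩ := exists_dual_vector'' ℝ b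
    have hf' : ∀ a, ‖f (j a)‖ ≤ ‖a‖ := fun a => by
      simpa using f.le_of_opNorm_le hf (j a)
    obtain ⟨φ, h1, h2⟩ := exists_functional_comp_eq hu.injective
      (K⁻¹ • ((f : B →ₗ[ℝ] ℝ) ∘ₗ j.toLinearMap)) zero_le_one fun a => by
        have := (hf' a).trans (hu a).2
        rw [one_mul]
        simp only [LinearMap.smul_apply, LinearMap.comp_apply, norm_smul, norm_inv]
        rw [Real.norm_of_nonneg hK0.le, inv_mul_le_iff₀ hK0]
        exact this
    obtain ⟨s, hs⟩ := he (K⁻¹ • f)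
    have hgs := hge (⟨φ, h1⟩, s) (by
      refine ⟨?_, fun a => ?_⟩
      · simp only [hs, norm_smul, norm_inv, Real.norm_of_nonneg hK0.le]
        rw [inv_mul_le_iff₀ hK0]
        nlinarith
      · simp only [hs, h2]
        rfl)
    have := lp.norm_apply_le_norm ENNReal.top_ne_zero
      (toLp (fun γ => (g γ : B →ₗ[ℝ] ℝ)) K hgb b) (⟨φ, h1⟩, s)
    rw [toLp_apply, hgs] at this
    simp only [hs, ContinuousLinearMap.coe_coe, _root_.smul_apply, hfb, norm_smul,
      norm_inv, Real.norm_of_nonneg hK0.le] at this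
    rw [inv_mul_le_iff₀ hK0] at this
    simpa using this

end

section

variable (E : ℕ → Type u) [∀ n, NormedAddCommGroup (E n)] [∀ n, NormedSpace ℝ (E n)]

/-- Bounded sequences that vanish along the ultrafilter. -/
def nullSeq : Submodule ℝ (lp E ∞) where
  carrier := {f | Tendsto (fun n => ‖f n‖) (hyperfilter ℕ) (𝓝 0)}
  zero_mem' := by simp
  add_mem' {f g} hf hg := by
    refine squeeze_zero (fun n => norm_nonneg _) (fun n => ?_) (by simpa using hf.add hg)
    simpa using norm_add_le (f n) (g n)
  smul_mem' c f hf := by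
    have : Tendsto (fun n => ‖c‖ * ‖f n‖) (hyperfilter ℕ) (𝓝 0) := by
      simpa using hf.const_mul ‖c‖
    simpa [norm_smul] using this

/-- The Banach space ultraproduct of a sequence of normed spaces. -/
abbrev UProd : Type u := lp E ∞ ⧸ nullSeq E

variable {E}

theorem mem_nullSeq {f : lp E ∞} :
    f ∈ nullSeq E ↔ Tendsto (fun n => ‖f n‖) (hyperfilter ℕ) (𝓝 0) := Iff.rfl

theorem mem_nullSeq_of_eventually {f : lp E ∞}
    (h : ∀ ε > 0, ∀ᶠ n in hyperfilter ℕ, ‖f n‖ ≤ ε) : f ∈ nullSeq E := by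
  rw [mem_nullSeq, Metric.tendsto_nhds]
  intro ε hε
  filter_upwards [h (ε / 2) (by positivity)] with n hn
  simp only [dist_zero_right, norm_norm]
  linarith

instance isClosed_nullSeq : IsClosed (nullSeq E : Set (lp E ∞)) := by
  refine isClosed_of_closure_subset fun f hf => mem_nullSeq_of_eventually fun ε hε => ?_
  obtain ⟨g, hg, hfg⟩ := Metric.mem_closure_iff.1 hf (ε / 2) (by positivity)
  have hg' : ∀ᶠ n in hyperfilter ℕ, ‖g n‖ < ε / 2 :=
    (mem_nullSeq.1 hg).eventually_lt_const (by positivity)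
  filter_upwards [hg'] with n hn
  have h1 := lp.norm_apply_le_norm ENNReal.top_ne_zero (f - g) n
  have h2 : ‖f n‖ ≤ ‖(f - g) n‖ + ‖g n‖ := by
    simpa using norm_add_le (f n - g n) (g n)
  rw [dist_eq_norm] at hfg
  linarith

theorem norm_mk_le_of_eventually {f : lp E ∞} {c : ℝ} (hc : 0 ≤ c)
    (h : ∀ᶠ n in hyperfilter ℕ, ‖f n‖ ≤ c) : ‖(nullSeq E).mkQ f‖ ≤ c := by
  classical
  have hle : ∀ n, ‖if ‖f n‖ ≤ c then f n else 0‖ ≤ c := fun n => by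
    split_ifs with hn
    · exact hn
    · simpa using hc
  let g : lp E ∞ := ⟨fun n => if ‖f n‖ ≤ c then f n else 0,
    memℓp_infty ⟨c, by rintro _ ⟨n, rfl⟩; exact hle n⟩⟩
  have hg : (nullSeq E).mkQ f = (nullSeq E).mkQ g := by
    refine (Submodule.Quotient.eq _).2 (mem_nullSeq_of_eventually fun ε hε => ?_)
    filter_upwards [h] with n hn
    have : (f - g) n = 0 := by
      change f n - (if ‖f n‖ ≤ c then f n else 0) = 0
      rw [if_pos hn, sub_self]
    rw [this, norm_zero]
    exact hε.le
  rw [hg]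
  exact (Submodule.Quotient.norm_mk_le _ g).trans (lp.norm_le_of_forall_le hc hle)

theorem eventually_norm_lt_of_norm_mk_lt {f : lp E ∞} {c : ℝ}
    (h : ‖(nullSeq E).mkQ f‖ < c) : ∀ᶠ n in hyperfilter ℕ, ‖f n‖ < c := by
  obtain ⟨g, hgf, hg⟩ := Submodule.Quotient.norm_mk_lt ((nullSeq E).mkQ f) (sub_pos.2 h)
  have hg' : ‖g‖ < c := by linarith
  have hn := (mem_nullSeq.1 ((Submodule.Quotient.eq _).1 hgf.symm)).eventually_lt_const
    (sub_pos.2 hg')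
  filter_upwards [hn] with n hn
  have h1 := lp.norm_apply_le_norm ENNReal.top_ne_zero g n
  have h2 : ‖f n‖ ≤ ‖(f - g) n‖ + ‖g n‖ := by
    simpa using norm_add_le (f n - g n) (g n)
  linarith

theorem tendsto_norm_mk (f : lp E ∞) :
    Tendsto (fun n => ‖f n‖) (hyperfilter ℕ) (𝓝 ‖(nullSeq E).mkQ f‖) := by
  rw [tendsto_order]
  refine ⟨fun c hc => ?_, fun c hc => eventually_norm_lt_of_norm_mk_lt hc⟩
  rcases lt_or_ge c 0 with h0 | h0
  · exact Eventually.of_forall fun n => h0.trans_le (norm_nonneg _)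
  by_contra hcon
  rw [← Ultrafilter.eventually_not] at hcon
  exact absurd (norm_mk_le_of_eventually h0 (hcon.mono fun n hn => not_lt.1 hn)) (not_le.2 hc)

theorem norm_mk_eq_of_eventually {f : lp E ∞} {c : ℝ}
    (h : ∀ᶠ n in hyperfilter ℕ, ‖f n‖ = c) : ‖(nullSeq E).mkQ f‖ = c :=
  tendsto_nhds_unique (tendsto_norm_mk f) (tendsto_const_nhds.congr' (h.mono fun _ hn => hn.symm))

theorem mk_eq_mk_of_tendsto {f g : lp E ∞}
    (h : Tendsto (fun n => ‖f n - g n‖) (hyperfilter ℕ) (𝓝 0)) :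
    (nullSeq E).mkQ f = (nullSeq E).mkQ g :=
  (Submodule.Quotient.eq _).2 (mem_nullSeq.2 h)

end

section

variable {E : ℕ → Type u} [∀ n, NormedAddCommGroup (E n)] [∀ n, NormedSpace ℝ (E n)]
  (i : ∀ n, E n →ₗᵢ[ℝ] E (n + 1))

/-- The transition maps of a chain of isometric embeddings, extended by zero: `transition i k n`
is the composite embedding when `k ≤ n` and zero otherwise. -/
noncomputable def transition (k : ℕ) : ∀ n, E k →ₗ[ℝ] E n
  | 0 => LinearMap.proj 0 ∘ₗ LinearMap.single ℝ E k
  | n + 1 => if n + 1 ≤ k then LinearMap.proj (n + 1) ∘ₗ LinearMap.single ℝ E k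
      else (i n).toLinearMap ∘ₗ transition k n

theorem transition_of_le {k n : ℕ} (h : n ≤ k) (x : E k) :
    transition i k n x = Pi.single (M := E) k x n := by
  cases n with
  | zero => rfl
  | succ n => rw [transition, if_pos h]; rfl

theorem transition_self (k : ℕ) (x : E k) : transition i k k x = x := by
  rw [transition_of_le i le_rfl, Pi.single_eq_same]

theorem transition_of_lt {k n : ℕ} (h : n < k) (x : E k) : transition i k n x = 0 := by
  rw [transition_of_le i h.le, Pi.single_eq_of_ne h.ne]

theorem transition_succ {k n : ℕ} (h : k ≤ n) (x : E k) :
    transition i k (n + 1) x = i n (transition i k n x) := by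
  rw [transition, if_neg (by omega)]
  rfl

theorem norm_transition {k n : ℕ} (h : k ≤ n) (x : E k) : ‖transition i k n x‖ = ‖x‖ := by
  induction n, h using Nat.le_induction with
  | base => rw [transition_self]
  | succ n h ih => rw [transition_succ i h, LinearIsometry.norm_map, ih]

theorem norm_transition_le (k n : ℕ) (x : E k) : ‖transition i k n x‖ ≤ 1 * ‖x‖ := by
  rw [one_mul]
  rcases lt_or_ge n k with h | h
  · rw [transition_of_lt i h, norm_zero]
    exact norm_nonneg x
  · exact (norm_transition i h x).le

theorem transition_comp {k n : ℕ} (h : k + 1 ≤ n) (x : E k) :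
    transition i (k + 1) n (i k x) = transition i k n x := by
  induction n, h using Nat.le_induction with
  | base => rw [transition_self, transition_succ i le_rfl, transition_self]
  | succ n h ih => rw [transition_succ i h, transition_succ i (by omega), ih]

/-- The embedding of a member of a chain into the ultraproduct of the chain. -/
noncomputable def chainEmb (k : ℕ) : E k →ₗᵢ[ℝ] UProd E where
  toLinearMap := (nullSeq E).mkQ ∘ₗ toLp (transition i k) 1 (norm_transition_le i k)
  norm_map' x := by
    refine norm_mk_eq_of_eventually (Nat.hyperfilter_le_atTop ?_)
    filter_upwards [eventually_ge_atTop k] with n hn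
    exact norm_transition i hn x

theorem chainEmb_succ (k : ℕ) (x : E k) : chainEmb i (k + 1) (i k x) = chainEmb i k x := by
  refine mk_eq_mk_of_tendsto (Tendsto.mono_left ?_ Nat.hyperfilter_le_atTop)
  refine tendsto_const_nhds.congr' ?_
  filter_upwards [eventually_ge_atTop (k + 1)] with n hn
  simp [transition_comp i hn x]

theorem chainEmb_range_mono :
    Monotone fun k => LinearMap.range (chainEmb i k).toLinearMap := by
  refine monotone_nat_of_le_succ fun k => ?_
  rintro _ ⟨x, rfl⟩
  exact ⟨i k x, chainEmb_succ i k x⟩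

/-- The completed direct limit of a chain of isometric embeddings, realised inside the
ultraproduct of the chain. -/
noncomputable abbrev ChainLimit : Submodule ℝ (UProd E) :=
  (⨆ k, LinearMap.range (chainEmb i k).toLinearMap).topologicalClosure

/-- The embedding of a member of a chain into the completed direct limit. -/
noncomputable def limitEmb (k : ℕ) : E k →ₗᵢ[ℝ] ChainLimit i where
  toLinearMap := (chainEmb i k).toLinearMap.codRestrict _ fun x =>
    Submodule.le_topologicalClosure _
      ((le_iSup (fun k => LinearMap.range (chainEmb i k).toLinearMap) k) ⟨x, rfl⟩)
  norm_map' x := (chainEmb i k).norm_map x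

theorem limitEmb_succ (k : ℕ) (x : E k) : limitEmb i (k + 1) (i k x) = limitEmb i k x :=
  Subtype.ext (chainEmb_succ i k x)

theorem exists_limitEmb_of_le {k l : ℕ} (h : k ≤ l) (x : E k) :
    ∃ y, limitEmb i l y = limitEmb i k x := by
  induction l, h using Nat.le_induction with
  | base => exact ⟨x, rfl⟩
  | succ l h ih =>
    obtain ⟨y, hy⟩ := ih
    exact ⟨i l y, (limitEmb_succ i l y).trans hy⟩

theorem exists_limitEmb_norm_sub_le (g : ChainLimit i) {ε : ℝ} (hε : 0 < ε) :
    ∃ k, ∃ x : E k, ‖limitEmb i k x - g‖ ≤ ε := by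
  obtain ⟨y, hy, hgy⟩ := Metric.mem_closure_iff.1
    (show (g : UProd E) ∈ closure _ from g.2) ε hε
  obtain ⟨k, x, rfl⟩ := (Submodule.mem_iSup_of_directed _
    (chainEmb_range_mono i).directed_le).1 hy
  refine ⟨k, x, ?_⟩
  rw [dist_comm, dist_eq_norm] at hgy
  exact hgy.le

theorem exists_common_limitEmb_norm_sub_le {ι : Type*} [Finite ι] (g : ι → ChainLimit i) {ε : ℝ}
    (hε : 0 < ε) : ∃ k, ∃ x : ι → E k, ∀ m, ‖limitEmb i k (x m) - g m‖ ≤ ε := by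
  choose k x hx using fun m => exists_limitEmb_norm_sub_le i (g m) hε
  obtain ⟨l, hl⟩ := (Set.finite_range k).bddAbove
  choose y hy using fun m => exists_limitEmb_of_le i (hl ⟨m, rfl⟩) (x m)
  exact ⟨l, y, fun m => by rw [hy]; exact hx m⟩

end

/-- Every operator from a finite-dimensional space into `G` is a limit of operators that extend
to superspaces without increasing the distortion. -/
def ApproxExtension (G : Type*) [NormedAddCommGroup G] [NormedSpace ℝ G] : Prop :=
  ∀ (A B : Type) [NormedAddCommGroup A] [NormedSpace ℝ A] [FiniteDimensional ℝ A]
    [NormedAddCommGroup B] [NormedSpace ℝ B] [FiniteDimensional ℝ B]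
    (j : A →ₗᵢ[ℝ] B) (w : A →L[ℝ] G) (ε : ℝ), 0 < ε →
    ∃ v : A →L[ℝ] G, ‖v - w‖ ≤ ε ∧ ∀ K, 1 ≤ K → AlmostIso K (v : A →ₗ[ℝ] G) →
      ∃ v' : B →ₗ[ℝ] G, (∀ a, v' (j a) = v a) ∧ AlmostIso K v'

section

variable (X : Type u) [NormedAddCommGroup X] [NormedSpace ℝ X] [CompleteSpace X]

/-- The chain obtained from `X` by iterating `Step`. -/
noncomputable def stepChain : ℕ → BanachSpaceR.{u}
  | 0 => ⟨X⟩
  | n + 1 => ⟨Step (stepChain n).carrier⟩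

/-- The embeddings of the chain `stepChain`. -/
noncomputable def stepChainEmb (n : ℕ) :
    (stepChain X n).carrier →ₗᵢ[ℝ] (stepChain X (n + 1)).carrier :=
  stepEmb (stepChain X n).carrier

theorem approxExtension_stepChain : ApproxExtension (ChainLimit (stepChainEmb X)) := by
  intro A B _ _ _ _ _ _ j w ε hε
  let b := Module.finBasis ℝ A
  obtain ⟨C, hC, hb⟩ := b.exists_opNorm_le (F := ChainLimit (stepChainEmb X))
  obtain ⟨k, x, hx⟩ := exists_common_limitEmb_norm_sub_le (stepChainEmb X) (fun m => w (b m))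
    (show 0 < ε / C by positivity)
  let v₀ : A →ₗ[ℝ] (stepChain X k).carrier := b.constr ℝ x
  refine ⟨LinearMap.toContinuousLinearMap ((limitEmb (stepChainEmb X) k).toLinearMap ∘ₗ v₀),
    ?_, fun K hK hv => ?_⟩
  · refine (hb (M := ε / C) (by positivity) fun m => ?_).trans_eq (by field_simp)
    simpa [v₀] using hx m
  · have hv₀ : AlmostIso K v₀ := fun a => by
      have h : ‖limitEmb (stepChainEmb X) k (v₀ a)‖ ≤ K * ‖a‖ ∧
        ‖a‖ ≤ K * ‖limitEmb (stepChainEmb X) k (v₀ a)‖ := hv a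
      rwa [LinearIsometry.norm_map] at h
    obtain ⟨v', h1, h2⟩ := exists_step_extension j v₀ hK hv₀
    let J : Step (stepChain X k).carrier →ₗᵢ[ℝ] ChainLimit (stepChainEmb X) :=
      limitEmb (stepChainEmb X) (k + 1)
    refine ⟨J.toLinearMap ∘ₗ v', fun a => ?_, fun b => ?_⟩
    swap
    · have h := h2 b
      rw [← J.norm_map (v' b)] at h
      exact h
    change J (v' (j a)) = limitEmb (stepChainEmb X) k (v₀ a)
    rw [h1]
    exact limitEmb_succ (stepChainEmb X) k (v₀ a)

end

section

variable {A B G : Type*} [NormedAddCommGroup A] [NormedSpace ℝ A]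
  [NormedAddCommGroup B] [NormedSpace ℝ B] [NormedAddCommGroup G] [NormedSpace ℝ G]

theorem isClosed_setOf_almostIso (u : A →ₗ[ℝ] G) : IsClosed {K | AlmostIso K u} := by
  simp only [AlmostIso, Set.ofPred_forall]
  exact isClosed_iInter fun a =>
    (isClosed_le (f := fun _ : ℝ => ‖u a‖) (by fun_prop) (by fun_prop)).inter
      (isClosed_le (f := fun _ : ℝ => ‖a‖) (by fun_prop) (by fun_prop))

theorem AlmostIso.mono {K L : ℝ} {u : A →ₗ[ℝ] G} (h : AlmostIso K u) (hKL : K ≤ L) :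
    AlmostIso L u := fun a =>
  ⟨(h a).1.trans (by gcongr), (h a).2.trans (by gcongr)⟩

/-- If extensions exist for every admissible distortion, then one extension serves for all. -/
theorem exists_uniform_extension {v : A →ₗ[ℝ] G} {j : A →ₗᵢ[ℝ] B}
    (h : ∀ K, 1 ≤ K → AlmostIso K v → ∃ v' : B →ₗ[ℝ] G, (∀ a, v' (j a) = v a) ∧ AlmostIso K v') :
    ∃ v' : B →ₗ[ℝ] G, (∀ b, ‖v' b‖ ≤ 2 * ‖b‖) ∧ ∀ K, 1 ≤ K → K ≤ 2 → AlmostIso K v →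
      (∀ a, v' (j a) = v a) ∧ AlmostIso K v' := by
  by_cases h2 : AlmostIso 2 v
  · let S : Set ℝ := {K | 1 ≤ K} ∩ {K | AlmostIso K v}
    have h12 : (1 : ℝ) ≤ 2 := one_le_two
    have hbdd : BddBelow S := ⟨1, fun K hK => hK.1⟩
    have hmem : sInf S ∈ S := (isClosed_Ici.inter (isClosed_setOf_almostIso v)).csInf_mem
      ⟨2, h12, h2⟩ hbdd
    obtain ⟨v', h1, h3⟩ := h _ hmem.1 hmem.2
    exact ⟨v', fun b => ((h3.mono (csInf_le hbdd ⟨h12, h2⟩)) b).1, fun K hK _ hKv =>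
      ⟨h1, h3.mono (csInf_le hbdd ⟨hK, hKv⟩)⟩⟩
  · exact ⟨0, fun b => by simp, fun K _ hK hv => absurd (hv.mono hK) h2⟩

/-- A bounded sequence of operators on a finite-dimensional space which is pointwise
asymptotically isometric along an ultrafilter is uniformly so. -/
theorem eventually_almostIso [FiniteDimensional ℝ A] {l : Ultrafilter ℕ} {v : ℕ → A →L[ℝ] G}
    {M : ℝ} (hM : ∀ n, ‖v n‖ ≤ M)
    (hv : ∀ a, Tendsto (fun n => ‖v n a‖) l (𝓝 ‖a‖)) {K : ℝ} (hK : 1 < K) :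
    ∀ᶠ n in l, AlmostIso K (v n : A →ₗ[ℝ] G) := by
  by_contra hcon
  rw [← Ultrafilter.eventually_not] at hcon
  have hex : ∀ n, ∃ a : A, ¬ AlmostIso K (v n : A →ₗ[ℝ] G) →
      ‖a‖ = 1 ∧ ¬ (‖v n a‖ ≤ K ∧ 1 ≤ K * ‖v n a‖) := by
    intro n
    by_cases hn : AlmostIso K (v n : A →ₗ[ℝ] G)
    · exact ⟨0, fun h => absurd hn h⟩
    · obtain ⟨a, ha⟩ := not_forall.1 hn
      have ha0 : a ≠ 0 := by
        rintro rfl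
        simp at ha
      have hpos : 0 < ‖a‖ := norm_pos_iff.2 ha0
      refine ⟨‖a‖⁻¹ • a, fun _ => ⟨by simp [norm_smul, hpos.ne'], fun h => ha ?_⟩⟩
      rw [map_smul, norm_smul, norm_inv, norm_norm, inv_mul_le_iff₀ hpos, mul_left_comm,
        le_inv_mul_iff₀ hpos, mul_one] at h
      exact ⟨h.1.trans_eq (mul_comm _ _), h.2⟩
  choose a ha using hex
  have hproper : ProperSpace A := FiniteDimensional.proper ℝ A
  have hsphere : ∀ᶠ n in l, a n ∈ Metric.sphere (0 : A) 1 :=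
    hcon.mono fun n hn => by simpa using (ha n hn).1
  obtain ⟨x, hx, hax⟩ := (isCompact_sphere (0 : A) 1).ultrafilter_le_nhds (l.map a)
    (le_principal_iff.2 hsphere)
  have hax : Tendsto a l (𝓝 x) := hax
  have hx1 : ‖x‖ = 1 := by simpa using hx
  have hdiff : Tendsto (fun n => v n (a n - x)) l (𝓝 0) := by
    have h0 : Tendsto (fun n => M * ‖a n - x‖) l (𝓝 0) := by
      simpa using (tendsto_iff_norm_sub_tendsto_zero.1 hax).const_mul M
    exact squeeze_zero_norm (fun n => (v n).le_of_opNorm_le (hM n) _) h0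
  have hlim : Tendsto (fun n => ‖v n (a n)‖) l (𝓝 1) := by
    have h0 : Tendsto (fun n => ‖v n (a n)‖ - ‖v n x‖) l (𝓝 0) := by
      refine squeeze_zero_norm (fun n => ?_) (by simpa using hdiff.norm)
      simpa only [map_sub] using! abs_norm_sub_norm_le (v n (a n)) (v n x)
    simpa [hx1] using h0.add (hv x)
  have hlimK : Tendsto (fun n => K * ‖v n (a n)‖) l (𝓝 K) := by simpa using hlim.const_mul K
  obtain ⟨n, hn, h1, h2⟩ := (hcon.and ((hlim.eventually_lt_const hK).and
    (hlimK.eventually_const_lt hK))).exists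
  exact (ha n hn).2 ⟨h1.le, h2.le⟩

theorem exists_lift [FiniteDimensional ℝ A] {G : Type u} [NormedAddCommGroup G] [NormedSpace ℝ G]
    (u : A →ₗ[ℝ] UProd fun _ : ℕ => G) :
    ∃ (w : ℕ → A →L[ℝ] G) (M : ℝ), (∀ n, ‖w n‖ ≤ M) ∧ ∀ (f : lp (fun _ : ℕ => G) ∞) (a : A),
      Tendsto (fun n => ‖f n - w n a‖) (hyperfilter ℕ) (𝓝 0) → (nullSeq _).mkQ f = u a := by
  let b := Module.finBasis ℝ A
  choose g hg using fun m => (nullSeq fun _ : ℕ => G).mkQ_surjective (u (b m))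
  let L : A →ₗ[ℝ] lp (fun _ : ℕ => G) ∞ := b.constr ℝ g
  have hL : (nullSeq _).mkQ ∘ₗ L = u := b.ext fun m => by simpa [L] using hg m
  let e (n : ℕ) : lp (fun _ : ℕ => G) ∞ →ₗ[ℝ] G :=
    { toFun := fun f => f n
      map_add' := fun _ _ => rfl
      map_smul' := fun _ _ => rfl }
  refine ⟨fun n => LinearMap.toContinuousLinearMap (e n ∘ₗ L),
    ‖LinearMap.toContinuousLinearMap L‖, fun n => ?_, fun f a h => ?_⟩
  · refine ContinuousLinearMap.opNorm_le_bound _ (norm_nonneg _) fun a => ?_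
    exact (lp.norm_apply_le_norm ENNReal.top_ne_zero (L a) n).trans
      ((LinearMap.toContinuousLinearMap L).le_opNorm a)
  · rw [← hL]
    exact mk_eq_mk_of_tendsto h

end

theorem univDispFinDim_uProd {G : Type u} [NormedAddCommGroup G] [NormedSpace ℝ G]
    (hG : ApproxExtension G) : UnivDispFinDim (UProd fun _ : ℕ => G) := by
  intro A B _ _ _ _ _ _ u j
  obtain ⟨w, M, hwM, hw⟩ := exists_lift u.toLinearMap
  choose v hvw hv using fun n : ℕ => hG A B j (w n) (1 / (n + 1 : ℝ)) (by positivity)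
  have hvM : ∀ n, ‖v n‖ ≤ 1 + M := fun n => by
    have h1 : ‖v n‖ ≤ ‖v n - w n‖ + ‖w n‖ := by simpa using norm_add_le (v n - w n) (w n)
    have h2 : (1 : ℝ) / (n + 1) ≤ 1 := by
      rw [div_le_one (by positivity)]
      have : (0 : ℝ) ≤ n := n.cast_nonneg
      linarith
    linarith [hvw n, hwM n]
  have hvw' : ∀ a, Tendsto (fun n => ‖v n a - w n a‖) (hyperfilter ℕ) (𝓝 0) := fun a => by
    refine Tendsto.mono_left ?_ Nat.hyperfilter_le_atTop
    refine squeeze_zero (fun n => norm_nonneg _)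
      (fun n => (v n - w n).le_of_opNorm_le (hvw n) a) ?_
    simpa using tendsto_one_div_add_atTop_nhds_zero_nat.mul_const ‖a‖
  have hvnorm : ∀ a, Tendsto (fun n => ‖v n a‖) (hyperfilter ℕ) (𝓝 ‖a‖) := fun a => by
    let f := toLp (fun n => (v n : A →ₗ[ℝ] G)) (1 + M) fun n a => (v n).le_of_opNorm_le (hvM n) a
    have hf : (nullSeq _).mkQ (f a) = u a := hw (f a) a (hvw' a)
    have := tendsto_norm_mk (f a)
    rw [hf, u.norm_map] at this
    exact this
  have hiso : ∀ K, 1 < K → ∀ᶠ n in hyperfilter ℕ, AlmostIso K (v n : A →ₗ[ℝ] G) :=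
    fun K hK => eventually_almostIso hvM hvnorm hK
  choose v' hbd hv' using fun n => exists_uniform_extension (hv n)
  let T := (nullSeq _).mkQ ∘ₗ toLp v' 2 hbd
  have hT : ∀ b, Tendsto (fun n => ‖v' n b‖) (hyperfilter ℕ) (𝓝 ‖T b‖) := fun b =>
    tendsto_norm_mk (toLp v' 2 hbd b)
  have hTK : ∀ b K, 1 < K → K ≤ 2 → ‖T b‖ ≤ K * ‖b‖ ∧ ‖b‖ ≤ K * ‖T b‖ := fun b K hK hK2 => by
    have h := (hiso K hK).mono fun n hn => (hv' n K hK.le hK2 hn).2 b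
    exact ⟨le_of_tendsto (hT b) (h.mono fun n hn => hn.1),
      ge_of_tendsto ((hT b).const_mul K) (h.mono fun n hn => hn.2)⟩
  refine ⟨⟨T, fun b => ?_⟩, fun a => ?_⟩
  · have hmul (c : ℝ) : Tendsto (fun K : ℝ => K * c) (𝓝[>] 1) (𝓝 c) := by
      have : Tendsto (fun K : ℝ => K * c) (𝓝 1) (𝓝 (1 * c)) := tendsto_id.mul_const c
      rw [one_mul] at this
      exact this.mono_left nhdsWithin_le_nhds
    have hev : ∀ᶠ K : ℝ in 𝓝[>] 1, ‖T b‖ ≤ K * ‖b‖ ∧ ‖b‖ ≤ K * ‖T b‖ := by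
      filter_upwards [Ioc_mem_nhdsGT (one_lt_two : (1 : ℝ) < 2)] with K hK
      exact hTK b K hK.1 hK.2
    exact le_antisymm (ge_of_tendsto (hmul _) (hev.mono fun K h => h.1))
      (ge_of_tendsto (hmul _) (hev.mono fun K h => h.2))
  · refine hw (toLp v' 2 hbd (j a)) a ((hvw' a).congr' ?_)
    filter_upwards [hiso 2 one_lt_two] with n hn
    rw [toLp_apply, (hv' n 2 one_le_two le_rfl hn).1]
    rfl

/-- The diagonal embedding into an ultrapower. -/
noncomputable def diagEmb (G : Type u) [NormedAddCommGroup G] [NormedSpace ℝ G] :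
    G →ₗᵢ[ℝ] UProd fun _ : ℕ => G where
  toLinearMap := (nullSeq _).mkQ ∘ₗ toLp (fun _ => LinearMap.id) 1 (by simp)
  norm_map' x := norm_mk_eq_of_eventually (Eventually.of_forall fun _ => rfl)

end UnivDisp

open UnivDisp

/-- For every real Banach space `X` there exist a real Banach space `U` of universal
disposition for finite-dimensional spaces and a linear isometric embedding of `X` into `U`. -/
theorem exists_univDispFinDim_extension (X : Type u)
    [NormedAddCommGroup X] [NormedSpace ℝ X] [CompleteSpace X] :
    ∃ U : BanachSpaceR.{u}, UnivDispFinDim U.carrier ∧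
      Nonempty (X →ₗᵢ[ℝ] U.carrier) := by
  exact ⟨⟨UProd fun _ : ℕ => ChainLimit (stepChainEmb X)⟩,
    univDispFinDim_uProd (approxExtension_stepChain X),
    ⟨(diagEmb _).comp (limitEmb (stepChainEmb X) 0)⟩⟩
end

section
/- Let E be a real Banach space and λ ≥ 1 a constant such that for every separable real Banach space X, every real Banach space Y, and every pair of linear isometric embeddings u : Y → X and v : Y → E, there exists a bounded linear operator V : X → E with V ∘ u = v and ‖V‖ ≤ λ. Then E is λ-separably injective. -/
/-- A real Banach space `E` is `λ`-separably injective if for every separable real Banach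
space `X`, every closed subspace `Y ⊆ X` and every bounded linear operator `t : Y → E`,
there is a bounded linear extension `T : X → E` with `‖T‖ ≤ λ‖t‖`. -/
def SeparablyInjective (lam : ℝ) (E : Type*) [NormedAddCommGroup E] [NormedSpace ℝ E] :
    Prop :=
  ∀ (X : Type) [NormedAddCommGroup X] [NormedSpace ℝ X] [CompleteSpace X]
    [TopologicalSpace.SeparableSpace X]
    (Y : Submodule ℝ X), IsClosed (Y : Set X) →
    ∀ t : Y →L[ℝ] E, ∃ T : X →L[ℝ] E, (∀ y : Y, T y = t y) ∧ ‖T‖ ≤ lam * ‖t‖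

open UniformSpace in
/-- The extension of a linear isometry into a Banach space to the completion of its domain. -/
noncomputable def LinearIsometry.fromCompletion {S E : Type*} [SeminormedAddCommGroup S]
    [NormedSpace ℝ S] [NormedAddCommGroup E] [NormedSpace ℝ E] [CompleteSpace E]
    (s : S →ₗᵢ[ℝ] E) : Completion S →ₗᵢ[ℝ] E where
  toLinearMap := (s.toContinuousLinearMap.fromCompletion : Completion S →L[ℝ] E).toLinearMap
  norm_map' x := by
    induction x using Completion.induction_on with
    | hp => exact isClosed_eq (ContinuousLinearMap.continuous _).norm continuous_norm
    | ih a => simp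

open UniformSpace in
theorem LinearIsometry.fromCompletion_coe {S E : Type*} [SeminormedAddCommGroup S]
    [NormedSpace ℝ S] [NormedAddCommGroup E] [NormedSpace ℝ E] [CompleteSpace E]
    (s : S →ₗᵢ[ℝ] E) (a : S) : s.fromCompletion (a : Completion S) = s a :=
  s.toContinuousLinearMap.fromCompletion_apply_coe a

open UniformSpace in
/-- If pairs of isometric embeddings of Banach spaces have fillers of norm at most `lam`, then so
do pairs of isometric embeddings of seminormed spaces. -/
theorem exists_filler_of_seminormed
    {E : Type*} [NormedAddCommGroup E] [NormedSpace ℝ E] [CompleteSpace E] {lam : ℝ}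
    (h : ∀ (X : Type) [NormedAddCommGroup X] [NormedSpace ℝ X] [CompleteSpace X]
      [TopologicalSpace.SeparableSpace X]
      (Y : Type) [NormedAddCommGroup Y] [NormedSpace ℝ Y] [CompleteSpace Y]
      (u : Y →ₗᵢ[ℝ] X) (v : Y →ₗᵢ[ℝ] E),
      ∃ V : X →L[ℝ] E, (∀ y : Y, V (u y) = v y) ∧ ‖V‖ ≤ lam)
    (P : Type) [SeminormedAddCommGroup P] [NormedSpace ℝ P] [TopologicalSpace.SeparableSpace P]
    (S : Type) [SeminormedAddCommGroup S] [NormedSpace ℝ S] (u : S →ₗᵢ[ℝ] P) (v : S →ₗᵢ[ℝ] E) :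
    ∃ V : P →ₗ[ℝ] E, (∀ y : S, V (u y) = v y) ∧ ∀ x, ‖V x‖ ≤ lam * ‖x‖ := by
  obtain ⟨V, hV, hVn⟩ := h (Completion P) (Completion S)
    (Completion.toComplₗᵢ.comp u).fromCompletion v.fromCompletion
  refine ⟨V.toLinearMap ∘ₗ Completion.toComplₗᵢ.toLinearMap, fun y => ?_, fun x => ?_⟩
  · simpa [LinearIsometry.fromCompletion_coe] using hV (y : Completion S)
  · simpa using V.le_of_opNorm_le hVn (x : Completion P)

/-- The pushout seminorm: a contraction on a subspace becomes an isometry for a weaker seminorm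
on the whole space, realized as the norm pulled back along a linear contraction. -/
theorem exists_contraction_norm_eq {X E : Type*} [NormedAddCommGroup X] [NormedSpace ℝ X]
    [NormedAddCommGroup E] [NormedSpace ℝ E] (Y : Submodule ℝ X) (t : Y →L[ℝ] E)
    (ht : ‖t‖ ≤ 1) :
    ∃ (G : Submodule ℝ (WithLp 1 (X × E))) (j : X →ₗ[ℝ] WithLp 1 (X × E) ⧸ G),
      (∀ x, ‖j x‖ ≤ ‖x‖) ∧ ∀ y : Y, ‖j y‖ = ‖t y‖ := by
  let e : (X × E) ≃ₗ[ℝ] WithLp 1 (X × E) := (WithLp.linearEquiv 1 ℝ (X × E)).symm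
  let G : Submodule ℝ (WithLp 1 (X × E)) :=
    LinearMap.range (e.toLinearMap ∘ₗ (Y.subtype.prod (-t.toLinearMap)))
  have norm_e (x : X) (z : E) : ‖e (x, z)‖ = ‖x‖ + ‖z‖ := WithLp.prod_norm_eq_of_L1 _
  refine ⟨G, G.mkQ ∘ₗ e.toLinearMap ∘ₗ LinearMap.inl ℝ X E, fun x => ?_, fun y => ?_⟩
  · refine (Submodule.Quotient.norm_mk_le G _).trans_eq ?_
    simpa using norm_e x 0
  · refine le_antisymm ?_ (QuotientAddGroup.le_norm_iff.2 fun m hm => ?_)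
    · have hy : G.mkQ (e (y, 0)) = G.mkQ (e (0, t y)) := by
        refine (Submodule.Quotient.eq G).2 ⟨y, ?_⟩
        simp [← map_sub]
      change ‖G.mkQ (e (y, 0))‖ ≤ _
      rw [hy]
      refine (Submodule.Quotient.norm_mk_le G _).trans_eq ?_
      simpa using norm_e 0 (t y)
    · obtain ⟨z, hz⟩ := (Submodule.Quotient.eq G).1 hm
      have hm' : m = e (y + z, -t z) := by
        rw [eq_comm, sub_eq_iff_eq_add] at hz
        rw [hz]
        change e (z, -t z) + e (y, 0) = _
        simp [← map_add, add_comm]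
      rw [hm', norm_e, norm_neg]
      calc ‖t y‖ = ‖t (y + z) - t z‖ := by simp
        _ ≤ ‖t (y + z)‖ + ‖t z‖ := norm_sub_le _ _
        _ ≤ ‖y + z‖ + ‖t z‖ := by
          gcongr
          simpa using t.le_of_opNorm_le ht (y + z)

/-- Seminormed version of the filler property, where the seminorm on `X` is pulled back along a
linear map `j` with values in a space that may live in another universe. -/
theorem exists_filler_of_induced
    {E : Type*} [NormedAddCommGroup E] [NormedSpace ℝ E] [CompleteSpace E] {lam : ℝ}
    (h : ∀ (X : Type) [NormedAddCommGroup X] [NormedSpace ℝ X] [CompleteSpace X]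
      [TopologicalSpace.SeparableSpace X]
      (Y : Type) [NormedAddCommGroup Y] [NormedSpace ℝ Y] [CompleteSpace Y]
      (u : Y →ₗᵢ[ℝ] X) (v : Y →ₗᵢ[ℝ] E),
      ∃ V : X →L[ℝ] E, (∀ y : Y, V (u y) = v y) ∧ ‖V‖ ≤ lam)
    {X S : Type} {Z : Type*} [AddCommGroup X] [Module ℝ X] [AddCommGroup S] [Module ℝ S]
    [SeminormedAddCommGroup Z] [NormedSpace ℝ Z] (j : X →ₗ[ℝ] Z)
    (hj : TopologicalSpace.IsSeparable (Set.range j))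
    (i : S →ₗ[ℝ] X) (t : S →ₗ[ℝ] E) (ht : ∀ y, ‖t y‖ = ‖j (i y)‖) :
    ∃ V : X →ₗ[ℝ] E, (∀ y, V (i y) = t y) ∧ ∀ x, ‖V x‖ ≤ lam * ‖j x‖ := by
  let : SeminormedAddCommGroup X := SeminormedAddCommGroup.induced X Z j
  let : NormedSpace ℝ X := NormedSpace.induced ℝ X Z j
  let : SeminormedAddCommGroup S := SeminormedAddCommGroup.induced S Z (j ∘ₗ i)
  let : NormedSpace ℝ S := NormedSpace.induced ℝ S Z (j ∘ₗ i)
  have hind : Topology.IsInducing j := ⟨rfl⟩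
  have : TopologicalSpace.SeparableSpace X := by
    have := hj.separableSpace
    have := UniformSpace.secondCountable_of_separable (Set.range j)
    have := (hind.codRestrict (s := Set.range j) Set.mem_range_self).secondCountableTopology
    infer_instance
  exact exists_filler_of_seminormed h X S ⟨i, fun _ => rfl⟩ ⟨t, ht⟩

/-- Under the extension property for isometries, contractions extend with norm at most `lam`. -/
theorem exists_extension_of_contraction
    {E : Type*} [NormedAddCommGroup E] [NormedSpace ℝ E] [CompleteSpace E] {lam : ℝ}
    (hlam : 0 ≤ lam)
    (h : ∀ (X : Type) [NormedAddCommGroup X] [NormedSpace ℝ X] [CompleteSpace X]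
      [TopologicalSpace.SeparableSpace X]
      (Y : Type) [NormedAddCommGroup Y] [NormedSpace ℝ Y] [CompleteSpace Y]
      (u : Y →ₗᵢ[ℝ] X) (v : Y →ₗᵢ[ℝ] E),
      ∃ V : X →L[ℝ] E, (∀ y : Y, V (u y) = v y) ∧ ‖V‖ ≤ lam)
    {X : Type} [NormedAddCommGroup X] [NormedSpace ℝ X] [TopologicalSpace.SeparableSpace X]
    (Y : Submodule ℝ X) (t : Y →L[ℝ] E) (ht : ‖t‖ ≤ 1) :
    ∃ T : X →L[ℝ] E, (∀ y : Y, T y = t y) ∧ ‖T‖ ≤ lam := by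
  obtain ⟨G, j, hj, hjY⟩ := exists_contraction_norm_eq Y t ht
  have hc : Continuous j := (j.mkContinuous 1 (by simpa using hj)).continuous
  obtain ⟨V, hV, hVn⟩ := exists_filler_of_induced h j (TopologicalSpace.isSeparable_range hc)
    Y.subtype t.toLinearMap fun y => (hjY y).symm
  have hbound (x : X) : ‖V x‖ ≤ lam * ‖x‖ :=
    (hVn x).trans (mul_le_mul_of_nonneg_left (hj x) hlam)
  exact ⟨V.mkContinuous lam hbound, hV, V.mkContinuous_norm_le hlam _⟩

/-- If every pair of isometric embeddings `u : Y → X` (`X` separable) and `v : Y → E`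
admits a filler `V : X → E` with `V ∘ u = v` and `‖V‖ ≤ λ`, then `E` is `λ`-separably
injective. -/
theorem separablyInjective_of_extension_property
    (E : Type*) [NormedAddCommGroup E] [NormedSpace ℝ E] [CompleteSpace E]
    (lam : ℝ) (hlam : 1 ≤ lam)
    (h : ∀ (X : Type) [NormedAddCommGroup X] [NormedSpace ℝ X] [CompleteSpace X]
      [TopologicalSpace.SeparableSpace X]
      (Y : Type) [NormedAddCommGroup Y] [NormedSpace ℝ Y] [CompleteSpace Y]
      (u : Y →ₗᵢ[ℝ] X) (v : Y →ₗᵢ[ℝ] E),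
      ∃ V : X →L[ℝ] E, (∀ y : Y, V (u y) = v y) ∧ ‖V‖ ≤ lam) :
    SeparablyInjective lam E := by
  intro X _ _ _ _ Y _ t
  have hlam0 : 0 ≤ lam := zero_le_one.trans hlam
  rcases (ContinuousLinearMap.opNorm_nonneg t).eq_or_lt' with ht | ht
  · refine ⟨0, fun y => ?_, by simp [ht]⟩
    have := t.le_opNorm y
    rw [ht, zero_mul, norm_le_zero_iff] at this
    simp [this]
  · obtain ⟨T, hT, hTn⟩ := exists_extension_of_contraction hlam0 h Y (‖t‖⁻¹ • t) <|
      ContinuousLinearMap.opNorm_le_bound _ zero_le_one fun y => by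
        rw [smul_apply, norm_smul, norm_inv, Real.norm_of_nonneg ht.le,
          inv_mul_le_iff₀ ht, one_mul]
        exact t.le_opNorm y
    refine ⟨‖t‖ • T, fun y => by simp [hT, ht.ne'], ?_⟩
    rw [norm_smul, Real.norm_of_nonneg ht.le, mul_comm]
    gcongr
end

section
/- Let E be a real Banach space of universal disposition for separable spaces whose density character is at most ℵ₁ (i.e., E has a dense subset of cardinality at most ℵ₁). Then E is separably automorphic: for every separable closed subspace Y ⊆ E, every isomorphic embedding φ : Y → E (injective bounded linear operator, bounded below) extends to a bicontinuous linear automorphism Φ : E → E with Φ(y) = φ(y) for all y ∈ Y. -/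
open Cardinal

open TopologicalSpace

/-- In a complete lattice, a predicate stable under countable directed suprema can be made to
meet `ℵ₁` many cofinal requirements along a single directed family above a given element. -/
theorem exists_directedOn_of_mk_le_aleph_one {X : Type*} [CompleteLattice X] {P : X → Prop}
    (hP : ∀ S : Set X, S.Countable → S.Nonempty → DirectedOn (· ≤ ·) S → (∀ x ∈ S, P x) →
      P (sSup S))
    {ι : Type*} (hι : #ι ≤ Cardinal.aleph 1) (R : ι → X → Prop)
    (hR : ∀ i x, P x → ∃ y, x ≤ y ∧ P y ∧ R i y) {x₀ : X} (h₀ : P x₀) :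
    ∃ S : Set X, x₀ ∈ S ∧ DirectedOn (· ≤ ·) S ∧ (∀ x ∈ S, P x) ∧ ∀ i, ∃ x ∈ S, R i x := by
  obtain ⟨r, _, hr⟩ := Cardinal.exists_ord_eq ι
  have hcount (i : ι) : {j | r j i}.Countable := by
    have h := (Cardinal.card_typein_lt i hr).trans_le hι
    rw [← Cardinal.succ_aleph0, Order.lt_succ_iff, Ordinal.card_typein] at h
    exact Cardinal.le_aleph0_iff_set_countable.1 h
  choose! ext hle hPext hRext using hR
  let f : ι → X := (IsWellFounded.wf (r := r)).fix fun i g =>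
    ext i (sSup (insert x₀ {x | ∃ (j : ι) (h : r j i), g j h = x}))
  let S : ι → Set X := fun i => insert x₀ (f '' {j | r j i})
  have hf (i : ι) : f i = ext i (sSup (S i)) := by
    have : {x | ∃ (j : ι) (_ : r j i), f j = x} = f '' {j | r j i} := by
      ext; simp
    simp only [S, ← this]
    exact (IsWellFounded.wf (r := r)).fix_eq _ i
  have key (i : ι) : P (sSup (S i)) ∧ ∀ j, r j i → f j ≤ f i := by
    induction i using (IsWellFounded.wf (r := r)).induction with
    | _ i ih =>
    have hPf (j) (hj : r j i) : P (f j) := by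
      rw [hf]; exact hPext _ _ (ih j hj).1
    have hx₀ (j) (hj : r j i) : x₀ ≤ f j := by
      rw [hf]
      exact (le_sSup (Set.mem_insert _ _)).trans (hle _ _ (ih j hj).1)
    have hS : P (sSup (S i)) := by
      refine hP _ (((hcount i).image f).insert x₀) ⟨x₀, Set.mem_insert _ _⟩ ?_ ?_
      · refine IsChain.directedOn (IsChain.insert (s := f '' {j | r j i}) ?_ ?_)
        · rintro _ ⟨j, hj, rfl⟩ _ ⟨k, hk, rfl⟩ -
          rcases trichotomous_of r j k with h | rfl | h
          · exact Or.inl ((ih k hk).2 j h)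
          · exact Or.inl le_rfl
          · exact Or.inr ((ih j hj).2 k h)
        · rintro _ ⟨j, hj, rfl⟩ -
          exact Or.inl (hx₀ j hj)
      · rintro _ (rfl | ⟨j, hj, rfl⟩)
        exacts [h₀, hPf j hj]
    refine ⟨hS, fun j hj => ?_⟩
    rw [hf i]
    have hmem : f j ∈ S i := Set.mem_insert_of_mem _ (Set.mem_image_of_mem f hj)
    exact (le_sSup hmem).trans (hle _ _ hS)
  have hx₀ (i) : x₀ ≤ f i := by
    rw [hf]
    exact (le_sSup (Set.mem_insert _ _)).trans (hle _ _ (key i).1)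
  have hPf (i) : P (f i) := by
    rw [hf]; exact hPext _ _ (key i).1
  refine ⟨insert x₀ (Set.range f), Set.mem_insert _ _, ?_, ?_,
    fun i => ⟨f i, Set.mem_insert_of_mem _ ⟨i, rfl⟩, ?_⟩⟩
  · refine IsChain.directedOn (IsChain.insert (s := Set.range f) ?_ ?_)
    · rintro _ ⟨j, rfl⟩ _ ⟨k, rfl⟩ -
      rcases trichotomous_of r j k with h | rfl | h
      · exact Or.inl ((key k).2 j h)
      · exact Or.inl le_rfl
      · exact Or.inr ((key j).2 k h)
    · rintro _ ⟨j, rfl⟩ -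
      exact Or.inl (hx₀ j)
  · rintro _ (rfl | ⟨j, rfl⟩)
    exacts [h₀, hPf j]
  · rw [hf]; exact hRext _ _ (key i).1

/-- A separable normed space has an isomorphic copy in `Type`, normed by any prescribed
equivalent norm. -/
theorem exists_continuousLinearEquiv_norm_eq {W : Type*} [NormedAddCommGroup W] [NormedSpace ℝ W]
    [SeparableSpace W] (p : Seminorm ℝ W) {C : ℝ}
    (h₁ : ∀ w, ‖w‖ ≤ C * p w) (h₂ : ∀ w, p w ≤ C * ‖w‖) :
    ∃ (B : Type) (_ : NormedAddCommGroup B) (_ : NormedSpace ℝ B) (e : W ≃L[ℝ] B),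
      ∀ w, ‖e w‖ = p w := by
  obtain ⟨B, _, _, ⟨e⟩⟩ : ∃ (B : Type) (_ : AddCommGroup B) (_ : Module ℝ B),
      Nonempty (W ≃ₗ[ℝ] B) := by
    have : Small.{0} W := small_of_injective (kuratowskiEmbedding.isometry W).injective
    exact ⟨Shrink.{0} W, inferInstance, inferInstance, ⟨(Shrink.linearEquiv ℝ W).symm⟩⟩
  let : Norm B := ⟨fun b => p (e.symm b)⟩
  have hnorm (b : B) : ‖b‖ = p (e.symm b) := rfl
  have core : NormedSpace.Core ℝ B :=
    { norm_nonneg := fun b => apply_nonneg p _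
      norm_smul := fun c b => by simp only [hnorm, map_smul, map_smul_eq_mul]
      norm_triangle := fun a b => by simpa only [hnorm, map_add] using map_add_le_add p _ _
      norm_eq_zero_iff := fun b => by
        refine ⟨fun h => ?_, fun h => by simp [hnorm, h]⟩
        have := h₁ (e.symm b)
        rw [← hnorm, h, mul_zero] at this
        simpa using norm_le_zero_iff.1 this }
  let := NormedAddCommGroup.ofCore core
  let := NormedSpace.ofCore core
  refine ⟨B, inferInstance, inferInstance, e.toContinuousLinearEquivOfBounds C C ?_ ?_, ?_⟩
  · intro w
    have : ‖e w‖ = p w := by rw [hnorm, e.symm_apply_apply]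
    rw [this]; exact h₂ w
  · exact fun b => h₁ _
  · intro w
    change ‖e w‖ = p w
    rw [hnorm, e.symm_apply_apply]

section PartialIso

variable {E F : Type*} [NormedAddCommGroup E] [NormedSpace ℝ E]
  [NormedAddCommGroup F] [NormedSpace ℝ F]

/-- `G` is the graph of an isomorphism between two separable subspaces which, together with its
inverse, is bounded by `C`. -/
structure IsSeparablePartialIso (C : ℝ) (G : Submodule ℝ (E × F)) : Prop where
  isSeparable : IsSeparable (G : Set (E × F))
  norm_fst_le : ∀ g ∈ G, ‖g.1‖ ≤ C * ‖g.2‖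
  norm_snd_le : ∀ g ∈ G, ‖g.2‖ ≤ C * ‖g.1‖

namespace IsSeparablePartialIso

variable {C : ℝ} {G : Submodule ℝ (E × F)}

theorem topologicalClosure (hG : IsSeparablePartialIso C G) :
    IsSeparablePartialIso C G.topologicalClosure where
  isSeparable := hG.isSeparable.closure
  norm_fst_le := fun _ hg => closure_minimal (t := {g : E × F | ‖g.1‖ ≤ C * ‖g.2‖})
    hG.norm_fst_le (isClosed_le (by fun_prop) (by fun_prop)) hg
  norm_snd_le := fun _ hg => closure_minimal (t := {g : E × F | ‖g.2‖ ≤ C * ‖g.1‖})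
    hG.norm_snd_le (isClosed_le (by fun_prop) (by fun_prop)) hg

theorem swap (hG : IsSeparablePartialIso C G) :
    IsSeparablePartialIso C (G.map (LinearEquiv.prodComm ℝ E F).toLinearMap) where
  isSeparable := by
    rw [Submodule.map_coe]
    exact hG.isSeparable.image continuous_swap
  norm_fst_le := by
    rintro _ ⟨g, hg, rfl⟩
    exact hG.norm_snd_le g hg
  norm_snd_le := by
    rintro _ ⟨g, hg, rfl⟩
    exact hG.norm_fst_le g hg

theorem sSup {S : Set (Submodule ℝ (E × F))} (hc : S.Countable) (hne : S.Nonempty)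
    (hd : DirectedOn (· ≤ ·) S) (hS : ∀ G ∈ S, IsSeparablePartialIso C G) :
    IsSeparablePartialIso C (SupSet.sSup S) where
  isSeparable := by
    have := hc.to_subtype
    have h : ((SupSet.sSup S : Submodule ℝ (E × F)) : Set (E × F)) = ⋃ G : S, (G : Set (E × F)) := by
      ext
      simp [Submodule.mem_sSup_of_directed hne hd]
    rw [h, isSeparable_iUnion]
    exact fun G => (hS G G.2).isSeparable
  norm_fst_le := fun g hg => by
    obtain ⟨G, hGS, hg⟩ := (Submodule.mem_sSup_of_directed hne hd).1 hg
    exact (hS G hGS).norm_fst_le g hg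
  norm_snd_le := fun g hg => by
    obtain ⟨G, hGS, hg⟩ := (Submodule.mem_sSup_of_directed hne hd).1 hg
    exact (hS G hGS).norm_snd_le g hg

end IsSeparablePartialIso

/-- The largest seminorm on `E` bounded by `C * ‖·‖` and, on the graph `G`, by the norm of the
second coordinate. -/
noncomputable def graphSeminorm (C : ℝ) (hC : 0 ≤ C) (G : Submodule ℝ (E × F)) : Seminorm ℝ E :=
  have hbdd (x : E) : BddBelow (Set.range fun g : G => ‖g.1.2‖ + C * ‖x - g.1.1‖) :=
    ⟨0, by rintro _ ⟨g, rfl⟩; positivity⟩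
  Seminorm.ofSMulLE (fun x => ⨅ g : G, (‖g.1.2‖ + C * ‖x - g.1.1‖))
    (le_antisymm (ciInf_le_of_le (hbdd 0) 0 (by simp)) (le_ciInf fun g => by positivity))
    (fun x y => le_ciInf_add_ciInf fun g h => ciInf_le_of_le (hbdd _) (g + h) <| by
      have h₁ := norm_add_le g.1.2 h.1.2
      have h₂ := norm_add_le (x - g.1.1) (y - h.1.1)
      rw [sub_add_sub_comm] at h₂
      have h₃ := mul_le_mul_of_nonneg_left h₂ hC
      simp only [Submodule.coe_add, Prod.fst_add, Prod.snd_add]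
      linarith)
    (fun r x => by
      rw [Real.mul_iInf_of_nonneg (norm_nonneg r)]
      refine le_ciInf fun g => ciInf_le_of_le (hbdd _) (r • g) ?_
      simp only [Submodule.coe_smul, Prod.smul_fst, Prod.smul_snd, ← smul_sub, norm_smul]
      exact le_of_eq (by ring))

theorem graphSeminorm_le {C : ℝ} (hC : 0 ≤ C) {G : Submodule ℝ (E × F)} (x : E) {g : E × F}
    (hg : g ∈ G) : graphSeminorm C hC G x ≤ ‖g.2‖ + C * ‖x - g.1‖ :=
  ciInf_le (f := fun g : G => ‖g.1.2‖ + C * ‖x - g.1.1‖)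
    ⟨0, by rintro _ ⟨g, rfl⟩; positivity⟩ ⟨g, hg⟩

theorem le_graphSeminorm {C : ℝ} (hC : 0 ≤ C) {G : Submodule ℝ (E × F)} {x : E} {a : ℝ}
    (h : ∀ g ∈ G, a ≤ ‖g.2‖ + C * ‖x - g.1‖) : a ≤ graphSeminorm C hC G x :=
  le_ciInf fun g : G => h g g.2

variable {C : ℝ} {G : Submodule ℝ (E × F)}

/-- One-point extension of partial isomorphisms into a space of universal disposition, with the
same bounds. -/
theorem IsSeparablePartialIso.exists_mem_fst [CompleteSpace E] [CompleteSpace F]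
    (hF : UnivDispSeparable F) (hC : 1 ≤ C) (hG : IsSeparablePartialIso C G) (x : E) :
    ∃ G', G ≤ G' ∧ IsSeparablePartialIso C G' ∧ ∃ y, (x, y) ∈ G' := by
  wlog hcl : IsClosed (G : Set (E × F)) generalizing G
  · obtain ⟨G', hle, h⟩ := this hG.topologicalClosure G.isClosed_topologicalClosure
    exact ⟨G', G.le_topologicalClosure.trans hle, h⟩
  have hC0 : 0 ≤ C := zero_le_one.trans hC
  let W : Submodule ℝ E :=
    (Submodule.span ℝ (Prod.fst '' (G : Set (E × F)) ∪ {x})).topologicalClosure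
  have hsubW : Prod.fst '' (G : Set (E × F)) ∪ {x} ⊆ W :=
    Submodule.subset_span.trans (Submodule.le_topologicalClosure _)
  have hGW (g : G) : g.1.1 ∈ W := hsubW (Or.inl ⟨g, g.2, rfl⟩)
  have : CompleteSpace W := (Submodule.isClosed_topologicalClosure _).completeSpace_coe
  have : CompleteSpace G := hcl.completeSpace_coe
  have : SeparableSpace G := hG.isSeparable.separableSpace
  have : SeparableSpace W :=
    ((isSeparable_union.2 ⟨hG.isSeparable.image continuous_fst,
      (Set.finite_singleton x).isSeparable⟩).span (R := ℝ)).closure.separableSpace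
  let p := graphSeminorm C hC0 G
  have hp_le (w : E) : p w ≤ C * ‖w‖ := by
    simpa using graphSeminorm_le hC0 w G.zero_mem
  have hle_p (w : E) : ‖w‖ ≤ C * p w := by
    rw [← div_le_iff₀' (by positivity)]
    refine le_graphSeminorm hC0 fun g hg => ?_
    rw [div_le_iff₀' (by positivity)]
    have h₁ := norm_add_le g.1 (w - g.1)
    rw [add_sub_cancel] at h₁
    have h₂ := hG.norm_fst_le g hg
    nlinarith [mul_nonneg (mul_nonneg (sub_nonneg.2 hC) (add_nonneg hC0 zero_le_one))
      (norm_nonneg (w - g.1))]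
  have hp_graph (g : E × F) (hg : g ∈ G) : p g.1 = ‖g.2‖ := by
    refine le_antisymm (by simpa using graphSeminorm_le hC0 g.1 hg)
      (le_graphSeminorm hC0 fun h hh => ?_)
    have h₁ := norm_add_le h.2 (g.2 - h.2)
    rw [add_sub_cancel] at h₁
    have h₂ := hG.norm_snd_le _ (G.sub_mem hg hh)
    simp only [Prod.fst_sub, Prod.snd_sub] at h₂
    linarith
  obtain ⟨B, _, _, eB, hB⟩ := exists_continuousLinearEquiv_norm_eq (p.comp W.subtype) (C := C)
    (fun w => hle_p w) (fun w => hp_le w)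
  let q : Seminorm ℝ G := (normSeminorm ℝ F).comp (LinearMap.snd ℝ E F ∘ₗ G.subtype)
  have hq (g : G) : q g = ‖g.1.2‖ := rfl
  obtain ⟨A, _, _, eA, hA⟩ := exists_continuousLinearEquiv_norm_eq q (C := C)
    (fun g => by
      rw [hq, Submodule.coe_norm, Prod.norm_def]
      exact max_le (hG.norm_fst_le g g.2) (le_mul_of_one_le_left (norm_nonneg _) hC))
    (fun g => by
      rw [hq, Submodule.coe_norm]
      exact (_root_.norm_snd_le _).trans (le_mul_of_one_le_left (norm_nonneg _) hC))
  have : SeparableSpace A := eA.surjective.denseRange.separableSpace eA.continuous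
  have : SeparableSpace B := eB.surjective.denseRange.separableSpace eB.continuous
  have : CompleteSpace A := (completeSpace_congr (e := eA.toEquiv) eA.isUniformEmbedding).1 ‹_›
  have : CompleteSpace B := (completeSpace_congr (e := eB.toEquiv) eB.isUniformEmbedding).1 ‹_›
  let u : A →ₗᵢ[ℝ] F :=
    { toLinearMap := LinearMap.snd ℝ E F ∘ₗ G.subtype ∘ₗ eA.symm.toLinearMap
      norm_map' := fun a => by
        conv_rhs => rw [← eA.apply_symm_apply a, hA]
        rfl }
  let j : A →ₗᵢ[ℝ] B :=
    { toLinearMap := eB.toLinearMap ∘ₗ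
        (LinearMap.codRestrict W (LinearMap.fst ℝ E F ∘ₗ G.subtype) hGW) ∘ₗ eA.symm.toLinearMap
      norm_map' := fun a => by
        conv_rhs => rw [← eA.apply_symm_apply a, hA, hq, ← hp_graph _ (eA.symm a).2]
        exact hB _ }
  obtain ⟨u', hu'⟩ := hF A B u j
  let T : W →L[ℝ] E × F := W.subtypeL.prod (u'.toContinuousLinearMap.comp eB.toContinuousLinearMap)
  have hT (w : W) : ‖(T w).2‖ = p w := (u'.norm_map _).trans (hB w)
  refine ⟨LinearMap.range T.toLinearMap, fun g hg => ⟨⟨g.1, hGW ⟨g, hg⟩⟩, ?_⟩, ⟨?_, ?_, ?_⟩,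
    u' (eB ⟨x, hsubW (Or.inr rfl)⟩), ⟨x, hsubW (Or.inr rfl)⟩, rfl⟩
  · refine Prod.ext rfl ?_
    have h : eA.symm (eA ⟨g, hg⟩) = ⟨g, hg⟩ := eA.symm_apply_apply _
    have h' := hu' (eA ⟨g, hg⟩)
    change u' (eB ⟨(eA.symm (eA ⟨g, hg⟩)).1.1, _⟩) = (eA.symm (eA ⟨g, hg⟩)).1.2 at h'
    simp only [h] at h'
    exact h'
  · rw [LinearMap.coe_range]
    exact isSeparable_range T.continuous
  · rintro _ ⟨w, rfl⟩
    exact (hle_p w).trans_eq (congrArg (C * ·) (hT w).symm)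
  · rintro _ ⟨w, rfl⟩
    exact (hT w).trans_le (hp_le w)

theorem IsSeparablePartialIso.exists_mem_snd [CompleteSpace E] [CompleteSpace F]
    (hE : UnivDispSeparable E) (hC : 1 ≤ C) (hG : IsSeparablePartialIso C G) (y : F) :
    ∃ G', G ≤ G' ∧ IsSeparablePartialIso C G' ∧ ∃ x, (x, y) ∈ G' := by
  obtain ⟨G', hle, hG', x, hx⟩ := hG.swap.exists_mem_fst hE hC y
  exact ⟨_, fun g hg => Submodule.mem_map.2 ⟨g.swap, hle ⟨g, hg, rfl⟩, rfl⟩, hG'.swap, x, _, hx, rfl⟩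

/-- A bounded operator between Banach spaces with dense range that is bounded below is an
isomorphism. -/
theorem exists_continuousLinearEquiv_of_norm_le {X : Type*} [NormedAddCommGroup X] [NormedSpace ℝ X]
    [CompleteSpace X] [CompleteSpace E] (f : X →L[ℝ] E) {C : ℝ} (h : ∀ x, ‖x‖ ≤ C * ‖f x‖)
    (hd : DenseRange f) : ∃ e : X ≃L[ℝ] E, ∀ x, e x = f x := by
  have hf : AntilipschitzWith C.toNNReal f :=
    AddMonoidHomClass.antilipschitz_of_bound f fun x =>
      (h x).trans (mul_le_mul_of_nonneg_right (Real.le_coe_toNNReal C) (norm_nonneg _))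
  have hr := (hf.isClosed_range f.uniformContinuous).closure_eq
  refine ⟨.ofBijective f (LinearMap.ker_eq_bot.2 hf.injective) (LinearMap.range_eq_top.2 ?_),
    fun x => rfl⟩
  rw [← Set.range_eq_univ]
  exact hr.symm.trans hd.closure_range

end PartialIso

/-- A Banach space of universal disposition for separable spaces whose density character is
at most `ℵ₁` is separably automorphic: isomorphic embeddings of separable closed subspaces
extend to automorphisms of the whole space. -/
theorem separablyAutomorphic_of_univDispSeparable
    (E : Type*) [NormedAddCommGroup E] [NormedSpace ℝ E] [CompleteSpace E]
    (hE : UnivDispSeparable E)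
    (hdens : ∃ D : Set E, Dense D ∧ #D ≤ Cardinal.aleph 1)
    (Y : Submodule ℝ E) (hYclosed : IsClosed (Y : Set E))
    (hYsep : TopologicalSpace.SeparableSpace Y)
    (φ : Y →L[ℝ] E) (hφ_inj : Function.Injective φ)
    (hφ_below : ∃ c > (0 : ℝ), ∀ y : Y, c * ‖y‖ ≤ ‖φ y‖) :
    ∃ Φ : E ≃L[ℝ] E, ∀ y : Y, Φ y = φ y := by
  obtain ⟨c, hc, hφc⟩ := hφ_below
  obtain ⟨D, hD, hDcard⟩ := hdens
  let C : ℝ := max 1 (max ‖φ‖ c⁻¹)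
  have hC : 1 ≤ C := le_max_left _ _
  let T : Y →L[ℝ] E × E := Y.subtypeL.prod φ
  have hT : IsSeparablePartialIso C (LinearMap.range T.toLinearMap) := by
    refine ⟨?_, ?_, ?_⟩
    · rw [LinearMap.coe_range]
      exact isSeparable_range T.continuous
    · rintro _ ⟨y, rfl⟩
      have h : ‖y‖ ≤ c⁻¹ * ‖φ y‖ := (le_inv_mul_iff₀ hc).2 (hφc y)
      exact h.trans (mul_le_mul_of_nonneg_right
        ((le_max_right _ _).trans (le_max_right _ _)) (norm_nonneg _))
    · rintro _ ⟨y, rfl⟩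
      exact (φ.le_opNorm y).trans (mul_le_mul_of_nonneg_right
        ((le_max_left _ _).trans (le_max_right _ _)) (norm_nonneg _))
  obtain ⟨S, hTS, hdir, hS, hSD⟩ := exists_directedOn_of_mk_le_aleph_one
    (P := IsSeparablePartialIso (E := E) (F := E) C)
    (fun _ => IsSeparablePartialIso.sSup) hDcard
    (fun d G => (∃ y, ((d : E), y) ∈ G) ∧ ∃ x, (x, (d : E)) ∈ G)
    (fun d G hG => by
      obtain ⟨G₁, hle₁, hG₁, y, hy⟩ := hG.exists_mem_fst hE hC d
      obtain ⟨G₂, hle₂, hG₂, hx⟩ := hG₁.exists_mem_snd hE hC d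
      exact ⟨G₂, hle₁.trans hle₂, hG₂, ⟨y, hle₂ hy⟩, hx⟩) hT
  let H : Submodule ℝ (E × E) := (sSup S).topologicalClosure
  have hbound : ∀ g ∈ H, ‖g.1‖ ≤ C * ‖g.2‖ ∧ ‖g.2‖ ≤ C * ‖g.1‖ := fun g hg =>
    closure_minimal (t := {g : E × E | ‖g.1‖ ≤ C * ‖g.2‖ ∧ ‖g.2‖ ≤ C * ‖g.1‖})
      (fun g hg => by
        obtain ⟨G, hGS, hg⟩ := (Submodule.mem_sSup_of_directed ⟨_, hTS⟩ hdir).1 hg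
        exact ⟨(hS G hGS).norm_fst_le g hg, (hS G hGS).norm_snd_le g hg⟩)
      (by
        rw [Set.ofPred_and]
        exact (isClosed_le (by fun_prop) (by fun_prop)).inter
          (isClosed_le (by fun_prop) (by fun_prop))) hg
  have hle (G) (hG : G ∈ S) : G ≤ H := (le_sSup hG).trans (Submodule.le_topologicalClosure _)
  have : CompleteSpace H := (Submodule.isClosed_topologicalClosure _).completeSpace_coe
  obtain ⟨e₁, he₁⟩ := exists_continuousLinearEquiv_of_norm_le
    ((ContinuousLinearMap.fst ℝ E E).comp H.subtypeL)
    (C := C) (fun g => max_le (le_mul_of_one_le_left (norm_nonneg _) hC) (hbound g g.2).2)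
    (hD.mono fun d hd => by
      obtain ⟨G, hG, ⟨y, hy⟩, -⟩ := hSD ⟨d, hd⟩
      exact ⟨⟨_, hle G hG hy⟩, rfl⟩)
  obtain ⟨e₂, he₂⟩ := exists_continuousLinearEquiv_of_norm_le
    ((ContinuousLinearMap.snd ℝ E E).comp H.subtypeL)
    (C := C) (fun g => max_le (hbound g g.2).1 (le_mul_of_one_le_left (norm_nonneg _) hC))
    (hD.mono fun d hd => by
      obtain ⟨G, hG, -, ⟨x, hx⟩⟩ := hSD ⟨d, hd⟩
      exact ⟨⟨_, hle G hG hx⟩, rfl⟩)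
  refine ⟨e₁.symm.trans e₂, fun y => ?_⟩
  let g : H := ⟨((y : E), φ y), hle _ hTS ⟨y, rfl⟩⟩
  have h₁ : e₁.symm (y : E) = g := e₁.symm_apply_eq.2 (he₁ g).symm
  rw [ContinuousLinearEquiv.trans_apply, h₁]
  exact he₂ g
end

section
/- For every separable real Banach space X there exist a separable real Banach space G of almost universal disposition for finite-dimensional spaces and a linear isometric embedding of X into G. In particular, there exists a separable real Banach space of almost universal disposition for finite-dimensional spaces. -/
universe u

/-- A real Banach space `U` is of almost universal disposition for finite-dimensional spaces
if for all finite-dimensional real normed spaces `A`, `B`, all linear isometric embeddings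
`u : A → U` and `j : A → B` and every `ε > 0`, there is a `(1+ε)`-isometric embedding
`u' : B → U` with `u' ∘ j = u`. -/
def AlmostUnivDispFinDim (U : Type*) [NormedAddCommGroup U] [NormedSpace ℝ U] : Prop :=
  ∀ (A B : Type) [NormedAddCommGroup A] [NormedSpace ℝ A] [FiniteDimensional ℝ A]
    [NormedAddCommGroup B] [NormedSpace ℝ B] [FiniteDimensional ℝ B]
    (u : A →ₗᵢ[ℝ] U) (j : A →ₗᵢ[ℝ] B) (ε : ℝ), 0 < ε →
    ∃ u' : B →ₗ[ℝ] U,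
      (∀ b : B, (1 + ε)⁻¹ * ‖b‖ ≤ ‖u' b‖ ∧ ‖u' b‖ ≤ (1 + ε) * ‖b‖) ∧
      ∀ a : A, u' (j a) = u a

/-- The largest seminorm below `N` that is constant along `LinearMap.range L`. -/
noncomputable def Seminorm.infRange {E A : Type*} [AddCommGroup E] [Module ℝ E] [AddCommGroup A]
    [Module ℝ A] (N : Seminorm ℝ E) (L : A →ₗ[ℝ] E) : Seminorm ℝ E :=
  have bdd (x : E) : BddBelow (Set.range fun a : A => N (x - L a)) :=
    ⟨0, by rintro _ ⟨a, rfl⟩; exact apply_nonneg N _⟩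
  Seminorm.ofSMulLE (fun x => ⨅ a : A, N (x - L a))
    (le_antisymm ((ciInf_le (bdd 0) 0).trans_eq (by simp))
      (Real.iInf_nonneg fun _ => apply_nonneg N _))
    (fun x y => le_ciInf_add_ciInf fun a b => by
      refine (ciInf_le (bdd (x + y)) (a + b)).trans ?_
      rw [map_add, add_sub_add_comm]
      exact map_add_le_add N _ _)
    (fun r x => by
      rw [Real.mul_iInf_of_nonneg (norm_nonneg r)]
      refine le_ciInf fun a => (ciInf_le (bdd (r • x)) (r • a)).trans_eq ?_
      rw [map_smul, ← smul_sub, map_smul_eq_mul])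

theorem Seminorm.infRange_le {E A : Type*} [AddCommGroup E] [Module ℝ E] [AddCommGroup A]
    [Module ℝ A] (N : Seminorm ℝ E) (L : A →ₗ[ℝ] E) (x : E) (a : A) :
    N.infRange L x ≤ N (x - L a) :=
  ciInf_le (f := fun a : A => N (x - L a))
    ⟨0, by rintro _ ⟨a, rfl⟩; exact apply_nonneg N _⟩ a

theorem Seminorm.le_infRange {E A : Type*} [AddCommGroup E] [Module ℝ E] [AddCommGroup A]
    [Module ℝ A] (N : Seminorm ℝ E) (L : A →ₗ[ℝ] E) {x : E} {c : ℝ}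
    (h : ∀ a, c ≤ N (x - L a)) : c ≤ N.infRange L x :=
  le_ciInf h

/-- Every vector space with a seminorm has a Banach space completion. -/
theorem Seminorm.exists_completion {V : Type u} [AddCommGroup V] [Module ℝ V]
    (p : Seminorm ℝ V) :
    ∃ (G : BanachSpaceR.{u}) (ι : V →ₗ[ℝ] G.carrier), DenseRange ι ∧ ∀ v, ‖ι v‖ = p v := by
  let _ : SeminormedAddCommGroup V := p.toAddGroupSeminorm.toSeminormedAddCommGroup
  let _ : NormedSpace ℝ V := ⟨fun a b => (map_smul_eq_mul p a b).le⟩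
  exact ⟨⟨UniformSpace.Completion V⟩,
    (UniformSpace.Completion.toComplₗᵢ (𝕜 := ℝ) (E := V)).toLinearMap,
    UniformSpace.Completion.denseRange_coe, fun v => UniformSpace.Completion.norm_coe v⟩

/-- Along an exhausting filtration, a seminorm can be modified successively so that each of
countably many requirements is met whenever it is compatible with the seminorm already fixed
on the corresponding step of the filtration. -/
theorem Seminorm.exists_of_filtration {V : Type*} [AddCommGroup V] [Module ℝ V]
    (W : ℕ → Submodule ℝ V) (hW : Monotone W) (hV : ∀ v, ∃ n, v ∈ W n)
    (p₀ : Seminorm ℝ V) (Q : ℕ → Seminorm ℝ V → Prop) :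
    ∃ p : Seminorm ℝ V, (∀ v ∈ W 0, p v = p₀ v) ∧
      ∀ n, (∃ q, (∀ v ∈ W n, q v = p v) ∧ Q n q) →
        ∃ q, (∀ v ∈ W (n + 1), q v = p v) ∧ Q n q := by
  classical
  let step (n : ℕ) (r : Seminorm ℝ V) : Seminorm ℝ V :=
    if h : ∃ q : Seminorm ℝ V, (∀ v ∈ W n, q v = r v) ∧ Q n q then h.choose else r
  let P : ℕ → Seminorm ℝ V := fun n => Nat.rec p₀ step n
  have hP (n : ℕ) : P (n + 1) = step n (P n) := rfl
  have step_eq (n : ℕ) (r : Seminorm ℝ V) : ∀ v ∈ W n, step n r v = r v := by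
    intro v hv
    by_cases h : ∃ q : Seminorm ℝ V, (∀ v ∈ W n, q v = r v) ∧ Q n q
    · simp only [step, dif_pos h]
      exact h.choose_spec.1 v hv
    · simp only [step, dif_neg h]
  have stable {n m : ℕ} (hnm : n ≤ m) : ∀ v ∈ W n, P m v = P n v := by
    induction m, hnm using Nat.le_induction with
    | base => exact fun _ _ => rfl
    | succ m hnm ih => exact fun v hv => by rw [hP, step_eq m _ v (hW hnm hv), ih v hv]
  choose N hN using hV
  have lim_eq {n : ℕ} {v : V} (hv : v ∈ W n) : P (N v) v = P n v := by
    rcases le_total n (N v) with h | h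
    · exact stable h v hv
    · exact (stable h v (hN v)).symm
  let p : Seminorm ℝ V := Seminorm.of (fun v => P (N v) v)
    (fun x y => by
      have hx := hW (le_max_left (N x) (N y)) (hN x)
      have hy := hW (le_max_right (N x) (N y)) (hN y)
      rw [lim_eq hx, lim_eq hy, lim_eq (add_mem hx hy)]
      exact map_add_le_add _ _ _)
    (fun a x => by
      rw [lim_eq (Submodule.smul_mem _ a (hN x))]
      exact map_smul_eq_mul _ _ _)
  have p_eq {n : ℕ} {v : V} (hv : v ∈ W n) : p v = P n v := lim_eq hv
  refine ⟨p, fun v hv => p_eq hv, fun n ⟨q, hq, hQ⟩ => ⟨P (n + 1), fun v hv => (p_eq hv).symm, ?_⟩⟩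
  have h : ∃ q : Seminorm ℝ V, (∀ v ∈ W n, q v = P n v) ∧ Q n q :=
    ⟨q, fun v hv => (hq v hv).trans (p_eq hv), hQ⟩
  rw [hP]
  simp only [step, dif_pos h]
  exact h.choose_spec.2

/-- Every one-dimensional extension of the norm of `G` is approximately realized in `G` on finite
sets. -/
def ApproxOneDimExtension (G : Type*) [NormedAddCommGroup G] [NormedSpace ℝ G] : Prop :=
  ∀ q : Seminorm ℝ (G × ℝ), (∀ v, q (v, 0) = ‖v‖) → ∀ (F : Finset G) (η : ℝ), 0 < η →
    ∃ e : G, ∀ v ∈ F, |‖v + e‖ - q (v, 1)| ≤ η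

theorem Seminorm.abs_sub_le_norm {G : Type*} [NormedAddCommGroup G] [NormedSpace ℝ G]
    {q : Seminorm ℝ (G × ℝ)} (hq : ∀ v, q (v, 0) = ‖v‖) (v w : G) (t : ℝ) :
    |q (v, t) - q (w, t)| ≤ ‖v - w‖ := by
  simpa [hq] using abs_sub_map_le_sub q (v, t) (w, t)

/-- The pushout of an almost isometric embedding and a one-dimensional extension. -/
theorem exists_seminorm_pushout {G B : Type*} [NormedAddCommGroup G] [NormedSpace ℝ G]
    [NormedAddCommGroup B] [NormedSpace ℝ B] (S : Submodule ℝ B) (T : B →ₗ[ℝ] G) {k M : ℝ}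
    (hk : 0 ≤ k) (hkM : k ≤ M) (hT : ∀ s ∈ S, k * ‖s‖ ≤ ‖T s‖ ∧ ‖T s‖ ≤ M * ‖s‖) (b : B) :
    ∃ q : Seminorm ℝ (G × ℝ), (∀ v, q (v, 0) = ‖v‖) ∧
      ∀ s ∈ S, k * ‖s + b‖ ≤ q (T s, 1) ∧ q (T s, 1) ≤ M * ‖s + b‖ := by
  let N : Seminorm ℝ (G × B) := (normSeminorm ℝ G).comp (LinearMap.fst ℝ G B) +
    M.toNNReal • (normSeminorm ℝ B).comp (LinearMap.snd ℝ G B)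
  have hN (x : G) (y : B) : N (x, y) = ‖x‖ + M * ‖y‖ := by
    rw [← Real.coe_toNNReal M (hk.trans hkM)]; rfl
  let L : S →ₗ[ℝ] G × B := (T ∘ₗ S.subtype).prod (-S.subtype)
  have hL (s : S) : L s = (T s, -(s : B)) := rfl
  let q : Seminorm ℝ (G × ℝ) := (N.infRange L).comp
    (LinearMap.prodMap LinearMap.id (LinearMap.toSpanSingleton ℝ B b))
  have hq (v : G) (t : ℝ) : q (v, t) = N.infRange L (v, t • b) := rfl
  refine ⟨q, fun v => ?_, fun s hs => ?_⟩
  · rw [hq, zero_smul]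
    refine le_antisymm ((N.infRange_le L _ 0).trans_eq ?_) (N.le_infRange L fun a => ?_)
    · rw [map_zero, sub_zero, hN]; simp
    · rw [hL, Prod.mk_sub_mk, hN]
      have h1 := (hT a a.2).2
      have h2 := norm_le_norm_add_norm_sub' v (T a)
      simp only [sub_neg_eq_add, zero_add]
      linarith
  · rw [hq, one_smul]
    refine ⟨N.le_infRange L fun a => ?_, (N.infRange_le L _ ⟨s, hs⟩).trans_eq ?_⟩
    · rw [hL, Prod.mk_sub_mk, hN, ← map_sub, sub_neg_eq_add]
      have h1 := (hT (s - a) (sub_mem hs a.2)).1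
      have h2 : ‖s + b‖ ≤ ‖s - a‖ + ‖b + a‖ := by
        rw [show s + b = (s - a) + (b + a) by abel]; exact norm_add_le _ _
      have h3 := mul_le_mul_of_nonneg_left h2 hk
      have h4 := mul_le_mul_of_nonneg_right hkM (norm_nonneg (b + a))
      linarith
    · rw [hL, Prod.mk_sub_mk, hN]; simp [add_comm]

theorem ApproxOneDimExtension.exists_extend_one {G B : Type*} [NormedAddCommGroup G]
    [NormedSpace ℝ G] (hG : ApproxOneDimExtension G) [NormedAddCommGroup B] [NormedSpace ℝ B]
    [FiniteDimensional ℝ B] (S : Submodule ℝ B) (T : B →ₗ[ℝ] G) {k M : ℝ}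
    (hk : 0 ≤ k) (hkM : k ≤ M) (hM : 0 < M)
    (hT : ∀ s ∈ S, k * ‖s‖ ≤ ‖T s‖ ∧ ‖T s‖ ≤ M * ‖s‖) {b : B} (hb : b ∉ S) {κ : ℝ} (hκ : 0 < κ) :
    ∃ e : G, ∀ s ∈ S, (k - κ) * ‖s + b‖ ≤ ‖T s + e‖ ∧ ‖T s + e‖ ≤ (M + κ) * ‖s + b‖ := by
  obtain ⟨q, hq0, hq⟩ := exists_seminorm_pushout S T hk hkM hT b
  obtain ⟨d, hd, hdS⟩ : ∃ d > 0, ∀ s ∈ S, d ≤ ‖s + b‖ := by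
    have hS : IsClosed (S : Set B) := S.closed_of_finiteDimensional
    have hpos := (hS.notMem_iff_infDist_pos ⟨0, S.zero_mem⟩).1 hb
    refine ⟨_, hpos, fun s hs => ?_⟩
    have := Metric.infDist_le_dist_of_mem (x := b) (S.neg_mem hs)
    rwa [dist_eq_norm, sub_neg_eq_add, add_comm] at this
  set η : ℝ := min 1 (κ * d / 3) with hη_def
  have hη : 0 < η := lt_min one_pos (by positivity)
  set R : ℝ := ‖b‖ + (2 * M * ‖b‖ + 1) / κ with hR_def
  have hcomp : IsCompact (Metric.closedBall (0 : B) R ∩ S) :=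
    (isCompact_closedBall _ _).inter_right S.closed_of_finiteDimensional
  obtain ⟨t, htS, htfin, hcover⟩ := hcomp.finite_cover_balls (div_pos hη hM)
  classical
  obtain ⟨e, he⟩ := hG q hq0 (insert 0 (htfin.toFinset.image T)) η hη
  have he0 : ‖e‖ ≤ M * ‖b‖ + 1 := by
    have h1 := he 0 (Finset.mem_insert_self _ _)
    have h2 := (hq 0 S.zero_mem).2
    rw [map_zero, zero_add] at h2
    rw [zero_add] at h1
    have := (abs_le.1 h1).2
    have := min_le_left 1 (κ * d / 3)
    linarith
  have key : ∀ s ∈ S, |‖T s + e‖ - q (T s, 1)| ≤ κ * ‖s + b‖ := by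
    intro s hs
    rcases le_or_gt ‖s‖ R with hsR | hsR
    · obtain ⟨s', hs't, hs'⟩ := Set.mem_iUnion₂.1 (hcover ⟨mem_closedBall_zero_iff.2 hsR, hs⟩)
      have h1 : ‖T s - T s'‖ ≤ η := by
        rw [← map_sub]
        refine (hT _ (sub_mem hs (htS hs't).2)).2.trans ?_
        rw [Metric.mem_ball, dist_eq_norm, lt_div_iff₀ hM] at hs'
        linarith
      have h2 := he (T s') (Finset.mem_insert_of_mem
        (Finset.mem_image_of_mem _ (htfin.mem_toFinset.2 hs't)))
      have h3 := Seminorm.abs_sub_le_norm hq0 (T s) (T s') 1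
      have h4 : |‖T s + e‖ - ‖T s' + e‖| ≤ ‖T s - T s'‖ := by
        simpa using abs_norm_sub_norm_le (T s + e) (T s' + e)
      have h5 : 3 * η ≤ κ * d := by
        have := min_le_right 1 (κ * d / 3)
        linarith
      have h6 := mul_le_mul_of_nonneg_left (hdS s hs) hκ.le
      rw [abs_le] at h2 h3 h4 ⊢
      constructor <;> linarith [h2.1, h2.2, h3.1, h3.2, h4.1, h4.2]
    · have h1 : |‖T s + e‖ - ‖T s‖| ≤ ‖e‖ := by
        simpa using abs_norm_sub_norm_le (T s + e) (T s)
      have h2 : |q (T s, 1) - ‖T s‖| ≤ q (0, 1) := by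
        simpa [hq0] using abs_sub_map_le_sub q (T s, 1) (T s, 0)
      have h3 : q (0, 1) ≤ M * ‖b‖ := by simpa using (hq 0 S.zero_mem).2
      have h4 : ‖s‖ ≤ ‖s + b‖ + ‖b‖ := by simpa using norm_sub_le (s + b) b
      have h5 : 2 * M * ‖b‖ + 1 ≤ κ * ‖s + b‖ := by
        have : (2 * M * ‖b‖ + 1) / κ ≤ ‖s + b‖ := by linarith
        rwa [div_le_iff₀' hκ] at this
      rw [abs_le] at h1 h2 ⊢
      constructor <;> linarith [h1.1, h1.2, h2.1, h2.2]
  refine ⟨e, fun s hs => ?_⟩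
  have h1 := abs_le.1 (key s hs)
  have h2 := hq s hs
  constructor <;> linarith [h1.1, h1.2, h2.1, h2.2]

theorem ApproxOneDimExtension.almostUnivDispFinDim {G : Type*} [NormedAddCommGroup G]
    [NormedSpace ℝ G] (hG : ApproxOneDimExtension G) : AlmostUnivDispFinDim G := by
  intro A B _ _ _ _ _ _ u j ε hε
  have extend (F : Finset B) : ∀ κ : ℝ, 0 < κ → κ < 1 → ∃ T : B →ₗ[ℝ] G,
      (∀ s ∈ LinearMap.range j.toLinearMap ⊔ Submodule.span ℝ (F : Set B),
        (1 - κ) * ‖s‖ ≤ ‖T s‖ ∧ ‖T s‖ ≤ (1 + κ) * ‖s‖) ∧ ∀ a, T (j a) = u a := by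
    classical
    induction F using Finset.induction_on with
    | empty =>
      intro κ hκ _
      obtain ⟨g, hg⟩ := LinearMap.exists_leftInverse_of_injective j.toLinearMap
        (LinearMap.ker_eq_bot.2 j.injective)
      have hgj (a : A) : g (j a) = a := LinearMap.congr_fun hg a
      refine ⟨u.toLinearMap ∘ₗ g, ?_, fun a => by simp [hgj]⟩
      simp only [Finset.coe_empty, Submodule.span_empty, sup_bot_eq]
      rintro _ ⟨a, rfl⟩
      simp only [LinearIsometry.coe_toLinearMap, LinearMap.comp_apply, hgj,
        LinearIsometry.norm_map]
      constructor <;> nlinarith [norm_nonneg a]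
    | insert b F _ ih =>
      intro κ hκ hκ1
      set S := LinearMap.range j.toLinearMap ⊔ Submodule.span ℝ (F : Set B) with hS
      have hjS (a : A) : j a ∈ S := Submodule.mem_sup_left ⟨a, rfl⟩
      have hins : LinearMap.range j.toLinearMap ⊔ Submodule.span ℝ ((insert b F : Finset B) : Set B)
          = S ⊔ Submodule.span ℝ {b} := by
        rw [Finset.coe_insert, Submodule.span_insert, hS, sup_assoc, sup_comm (Submodule.span ℝ {b})]
      rw [hins]
      by_cases hb : b ∈ S
      · rw [sup_eq_left.2 ((Submodule.span_singleton_le_iff_mem _ _).2 hb)]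
        exact ih κ hκ hκ1
      obtain ⟨T, hT, hTu⟩ := ih (κ / 2) (by linarith) (by linarith)
      obtain ⟨e, he⟩ := hG.exists_extend_one S T (by linarith) (by linarith) (by linarith) hT hb
        (half_pos hκ)
      obtain ⟨l, hlb, hl⟩ := Submodule.exists_le_ker_of_notMem hb
      have hlS {s : B} (hs : s ∈ S) : l s = 0 := hl hs
      let T' : B →ₗ[ℝ] G := T + ((l b)⁻¹ • l).smulRight (e - T b)
      have hT' (s : B) (hs : s ∈ S) (t : ℝ) : T' (s + t • b) = T s + t • e := by
        simp [T', hlS hs, mul_comm, hlb, smul_sub]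
      have hT'S (s : B) (hs : s ∈ S) : T' s = T s := by simpa using hT' s hs 0
      refine ⟨T', fun x hx => ?_, fun a => (hT'S _ (hjS a)).trans (hTu a)⟩
      obtain ⟨s, hs, y, hy, rfl⟩ := Submodule.mem_sup.1 hx
      obtain ⟨t, rfl⟩ := Submodule.mem_span_singleton.1 hy
      rw [hT' s hs]
      rcases eq_or_ne t 0 with rfl | ht
      · have := hT s hs
        simp only [zero_smul, add_zero]
        constructor <;> nlinarith [norm_nonneg s]
      · have h := he (t⁻¹ • s) (S.smul_mem _ hs)
        have h1 : s + t • b = t • (t⁻¹ • s + b) := by rw [smul_add, smul_inv_smul₀ ht]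
        have h2 : T s + t • e = t • (T (t⁻¹ • s) + e) := by
          rw [smul_add, map_smul, smul_inv_smul₀ ht]
        rw [h1, h2, norm_smul, norm_smul]
        have h3 := norm_nonneg t
        constructor
        · calc (1 - κ) * (‖t‖ * ‖t⁻¹ • s + b‖)
              = ‖t‖ * ((1 - κ / 2 - κ / 2) * ‖t⁻¹ • s + b‖) := by ring
            _ ≤ _ := mul_le_mul_of_nonneg_left h.1 h3
        · calc ‖t‖ * ‖T (t⁻¹ • s) + e‖
              ≤ ‖t‖ * ((1 + κ / 2 + κ / 2) * ‖t⁻¹ • s + b‖) := mul_le_mul_of_nonneg_left h.2 h3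
            _ = _ := by ring
  obtain ⟨F, hF⟩ := (Module.Finite.fg_top : (⊤ : Submodule ℝ B).FG)
  have h1ε : 0 < 1 + ε := by linarith
  obtain ⟨T, hT, hTu⟩ := extend F (ε / (1 + ε)) (by positivity) (by rw [div_lt_one h1ε]; linarith)
  rw [hF, sup_top_eq] at hT
  refine ⟨T, fun b => ?_, hTu⟩
  have h := hT b Submodule.mem_top
  have h1 : 1 - ε / (1 + ε) = (1 + ε)⁻¹ := by field_simp; ring
  have h2 : ε / (1 + ε) ≤ ε := div_le_self hε.le (by linarith)
  refine ⟨h1 ▸ h.1, h.2.trans (mul_le_mul_of_nonneg_right (by linarith) (norm_nonneg b))⟩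

/-- A countable family of points of `X × (ℕ →₀ ℝ)`, dense for every seminorm extending the norm
of `X`. -/
noncomputable def ratPoint (X : Type*) [NormedAddCommGroup X] [TopologicalSpace.SeparableSpace X]
    (d : ℕ × (ℕ →₀ ℚ)) : X × (ℕ →₀ ℝ) :=
  (TopologicalSpace.denseSeq X d.1, d.2.mapRange (fun r : ℚ => (r : ℝ)) Rat.cast_zero)

theorem exists_ratPoint_lt {X : Type*} [NormedAddCommGroup X] [NormedSpace ℝ X]
    [TopologicalSpace.SeparableSpace X] {p : Seminorm ℝ (X × (ℕ →₀ ℝ))}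
    (hp : ∀ x, p (x, 0) = ‖x‖) (v : X × (ℕ →₀ ℝ)) {ε : ℝ} (hε : 0 < ε) :
    ∃ d, p (v - ratPoint X d) < ε := by
  have rat (f : ℕ →₀ ℝ) : ∀ ε : ℝ, 0 < ε → ∃ g : ℕ →₀ ℚ,
      p (0, f - g.mapRange (fun r : ℚ => (r : ℝ)) Rat.cast_zero) < ε := by
    induction f using Finsupp.induction_linear with
    | zero => exact fun ε hε => ⟨0, by simpa [hp] using hε⟩
    | add f₁ f₂ h₁ h₂ =>
      intro ε hε
      obtain ⟨g₁, hg₁⟩ := h₁ (ε / 2) (half_pos hε)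
      obtain ⟨g₂, hg₂⟩ := h₂ (ε / 2) (half_pos hε)
      refine ⟨g₁ + g₂, ?_⟩
      rw [Finsupp.mapRange_add (fun a b => Rat.cast_add a b), add_sub_add_comm,
        ← zero_add (0 : X), ← Prod.mk_add_mk]
      exact (map_add_le_add p _ _).trans_lt (by linarith)
    | single n a =>
      intro ε hε
      have hpos : 0 < p (0, Finsupp.single n 1) + 1 := by positivity
      obtain ⟨r, hr₁, hr₂⟩ := exists_rat_btwn
        (lt_add_of_pos_right a (div_pos hε hpos))
      refine ⟨Finsupp.single n r, ?_⟩
      have h : ((0 : X), Finsupp.single n a -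
          (Finsupp.single n r).mapRange (fun r : ℚ => (r : ℝ)) Rat.cast_zero) =
          (a - r) • ((0 : X), Finsupp.single n (1 : ℝ)) := by
        simp [← Finsupp.single_sub]
      rw [h, map_smul_eq_mul, Real.norm_eq_abs, abs_of_neg (by linarith)]
      have h1 : (r - a) * (p (0, Finsupp.single n 1) + 1) < ε := by
        rw [← lt_div_iff₀ hpos]; linarith
      linarith
  obtain ⟨g, hg⟩ := rat v.2 (ε / 2) (half_pos hε)
  obtain ⟨m, hm⟩ := (TopologicalSpace.denseRange_denseSeq X).exists_dist_lt v.1 (half_pos hε)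
  refine ⟨(m, g), ?_⟩
  have h : v - ratPoint X (m, g) = (v.1 - TopologicalSpace.denseSeq X m, 0) +
      (0, v.2 - g.mapRange (fun r : ℚ => (r : ℝ)) Rat.cast_zero) := by
    simp [ratPoint, Prod.ext_iff]
  rw [dist_eq_norm, ← hp] at hm
  rw [h]
  exact (map_add_le_add p _ _).trans_lt (by linarith)

/-- A countable type has an enumeration taking every value infinitely often. -/
theorem exists_nat_frequently_eq (α : Type*) [Nonempty α] [Countable α] :
    ∃ f : ℕ → α, ∀ a N, ∃ n ≥ N, f n = a := by
  obtain ⟨g, hg⟩ := exists_surjective_nat α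
  refine ⟨fun n => g n.unpair.1, fun a N => ?_⟩
  obtain ⟨m, rfl⟩ := hg a
  exact ⟨Nat.pair m N, Nat.right_le_pair m N, by simp⟩

/-- The points of `X × (ℕ →₀ ℝ)` whose second component is supported in `{0, …, n - 1}`. -/
def initialSubmodule (X : Type*) [AddCommGroup X] [Module ℝ X] (n : ℕ) :
    Submodule ℝ (X × (ℕ →₀ ℝ)) where
  carrier := {v | ∀ i ≥ n, v.2 i = 0}
  zero_mem' := fun _ _ => rfl
  add_mem' := fun ha hb i hi => by simp [ha i hi, hb i hi]
  smul_mem' := fun c v hv i hi => by simp [hv i hi]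

theorem mem_initialSubmodule {X : Type*} [AddCommGroup X] [Module ℝ X] {n : ℕ}
    {v : X × (ℕ →₀ ℝ)} : v ∈ initialSubmodule X n ↔ ∀ i ≥ n, v.2 i = 0 :=
  Iff.rfl

theorem initialSubmodule_mono (X : Type*) [AddCommGroup X] [Module ℝ X] :
    Monotone (initialSubmodule X) :=
  fun _ _ hnm _ hv i hi => hv i (hnm.trans hi)

theorem exists_mem_initialSubmodule {X : Type*} [AddCommGroup X] [Module ℝ X]
    (v : X × (ℕ →₀ ℝ)) : ∃ n, v ∈ initialSubmodule X n := by
  refine ⟨v.2.support.sup id + 1, fun i hi => ?_⟩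
  by_contra h
  have : i ≤ v.2.support.sup id := Finset.le_sup (f := id) (Finsupp.mem_support_iff.2 h)
  omega

theorem add_single_mem_initialSubmodule {X : Type*} [AddCommGroup X] [Module ℝ X] {n : ℕ}
    {v : X × (ℕ →₀ ℝ)} (hv : v ∈ initialSubmodule X n) (t : ℝ) :
    v + (0, Finsupp.single n t) ∈ initialSubmodule X (n + 1) := by
  intro i hi
  have hin : n ≠ i := by omega
  simp [hv i (by omega), Finsupp.single_eq_of_ne' hin]

/-- There is a seminorm on `X × (ℕ →₀ ℝ)`, extending the norm of `X`, for which every finite list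
of approximate values at a new generator is realized by some generator, if it is compatible
with the values of the seminorm at the points supported before that generator. -/
theorem exists_generic_seminorm (X : Type*) [NormedAddCommGroup X] [NormedSpace ℝ X]
    [TopologicalSpace.SeparableSpace X] :
    ∃ p : Seminorm ℝ (X × (ℕ →₀ ℝ)), (∀ x, p (x, 0) = ‖x‖) ∧
      ∀ (F : Finset ((ℕ × (ℕ →₀ ℚ)) × ℚ)) (η : ℚ), ∃ n,
        (∀ d ∈ F, ratPoint X d.1 ∈ initialSubmodule X n) ∧
        ((∃ q : Seminorm ℝ (X × (ℕ →₀ ℝ)), (∀ v ∈ initialSubmodule X n, q v = p v) ∧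
          ∀ d ∈ F, |q (ratPoint X d.1 + (0, Finsupp.single n 1)) - d.2| ≤ η) →
        ∀ d ∈ F, |p (ratPoint X d.1 + (0, Finsupp.single n 1)) - d.2| ≤ η) := by
  obtain ⟨task, htask⟩ :=
    exists_nat_frequently_eq (Finset ((ℕ × (ℕ →₀ ℚ)) × ℚ) × ℚ)
  obtain ⟨p, hp0, hp⟩ := Seminorm.exists_of_filtration (initialSubmodule X)
    (initialSubmodule_mono X) exists_mem_initialSubmodule
    ((normSeminorm ℝ X).comp (LinearMap.fst ℝ X (ℕ →₀ ℝ)))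
    (fun n q => ∀ d ∈ (task n).1,
      |q (ratPoint X d.1 + (0, Finsupp.single n 1)) - d.2| ≤ (task n).2)
  refine ⟨p, fun x => hp0 _ fun _ _ => rfl, fun F η => ?_⟩
  choose N hN using exists_mem_initialSubmodule (X := X)
  obtain ⟨n, hn, hτ⟩ := htask (F, η) (F.sup fun d => N (ratPoint X d.1))
  have hF : ∀ d ∈ F, ratPoint X d.1 ∈ initialSubmodule X n := fun d hd =>
    initialSubmodule_mono X ((Finset.le_sup (f := fun d => N (ratPoint X d.1)) hd).trans hn) (hN _)
  refine ⟨n, hF, fun h => ?_⟩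
  specialize hp n
  simp only [hτ] at hp
  obtain ⟨q, hq, hqF⟩ := hp h
  intro d hd
  rw [← hq _ (add_single_mem_initialSubmodule (hF d hd) 1)]
  exact hqF d hd

/-- Every separable real Banach space embeds isometrically into a separable real Banach
space of almost universal disposition for finite-dimensional spaces. -/
theorem exists_separable_almostUnivDispFinDim (X : Type u)
    [NormedAddCommGroup X] [NormedSpace ℝ X] [CompleteSpace X]
    [TopologicalSpace.SeparableSpace X] :
    ∃ G : BanachSpaceR.{u}, TopologicalSpace.SeparableSpace G.carrier ∧
      AlmostUnivDispFinDim G.carrier ∧ Nonempty (X →ₗᵢ[ℝ] G.carrier) := by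
  obtain ⟨p, hpX, hp⟩ := exists_generic_seminorm X
  obtain ⟨G, ι, hι, hιp⟩ := Seminorm.exists_completion (V := X × (ℕ →₀ ℝ)) p
  have dense (g : G.carrier) {ε : ℝ} (hε : 0 < ε) : ∃ d, ‖g - ι (ratPoint X d)‖ < ε := by
    obtain ⟨v, hv⟩ := hι.exists_dist_lt g (half_pos hε)
    obtain ⟨d, hd⟩ := exists_ratPoint_lt hpX v (half_pos hε)
    refine ⟨d, ?_⟩
    rw [← hιp, map_sub] at hd
    rw [dist_eq_norm] at hv
    linarith [norm_sub_le_norm_sub_add_norm_sub g (ι v) (ι (ratPoint X d))]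
  refine ⟨G, ?_, ApproxOneDimExtension.almostUnivDispFinDim fun q hq F η hη => ?_,
    ⟨⟨ι ∘ₗ LinearMap.inl ℝ X _, fun x => (hιp _).trans (hpX x)⟩⟩⟩
  · refine ⟨Set.range fun d => ι (ratPoint X d), Set.countable_range _, fun g => ?_⟩
    refine Metric.mem_closure_range_iff.2 fun ε hε => ?_
    simpa only [dist_eq_norm] using dense g hε
  · choose d hd using fun g : G.carrier => dense g (show 0 < η / 4 by positivity)
    obtain ⟨δ, hδ, hδη⟩ := exists_rat_btwn (show 0 < η / 4 by positivity)
    choose r hr using fun g : G.carrier =>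
      exists_rat_btwn (lt_add_of_pos_right (q (ι (ratPoint X (d g)), 1)) hδ)
    classical
    obtain ⟨n, hF, hn⟩ := hp (F.image fun g => (d g, r g)) δ
    simp only [Finset.forall_mem_image] at hF hn
    let e : X × (ℕ →₀ ℝ) := (0, Finsupp.single n 1)
    let coord : X × (ℕ →₀ ℝ) →ₗ[ℝ] ℝ := Finsupp.lapply n ∘ₗ LinearMap.snd ℝ X _
    let q' : Seminorm ℝ (X × (ℕ →₀ ℝ)) :=
      q.comp ((ι ∘ₗ (LinearMap.id - coord.smulRight e)).prod coord)
    have hq' (v : X × (ℕ →₀ ℝ)) (hv : v ∈ initialSubmodule X n) (t : ℝ) :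
        q' (v + t • e) = q (ι v, t) := by
      have : coord (v + t • e) = t := by
        simp [coord, e, mem_initialSubmodule.1 hv n le_rfl]
      change q (ι (v + t • e - coord (v + t • e) • e), coord (v + t • e)) = _
      rw [this, add_sub_cancel_right]
    have h := hn ⟨q', fun v hv => by simpa [hq, hιp] using hq' v hv 0, fun g hg => by
      have h1 := hq' _ (hF hg) 1
      rw [one_smul] at h1
      rw [h1, abs_le]
      constructor <;> linarith [(hr g).1, (hr g).2]⟩
    refine ⟨ι e, fun g hg => ?_⟩
    have h1 := h hg
    rw [← hιp, map_add] at h1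
    have h2 : |‖g + ι e‖ - ‖ι (ratPoint X (d g)) + ι e‖| ≤ ‖g - ι (ratPoint X (d g))‖ := by
      simpa using abs_norm_sub_norm_le (g + ι e) (ι (ratPoint X (d g)) + ι e)
    have h3 := Seminorm.abs_sub_le_norm hq g (ι (ratPoint X (d g))) 1
    have h4 := hd g
    have h5 := hr g
    change |‖ι (ratPoint X (d g)) + ι e‖ - _| ≤ _ at h1
    rw [abs_le] at h1 h2 h3 ⊢
    constructor <;> linarith [h1.1, h1.2, h2.1, h2.2, h3.1, h3.2, h5.1, h5.2]
end

section
/- For every separable real Banach space X there exist a separable real Banach space G of almost universal disposition for finite-dimensional spaces and a linear isometric embedding j : X → G with the following universal property: for every Lindenstrauss space L, every bounded linear operator τ : X → L with ‖τ‖ ≤ 1, and every ε > 0, there exists a bounded linear operator T : G → L with T ∘ j = τ and ‖T‖ ≤ 1 + ε. -/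
universe u

open scoped ENNReal

/-- A real Banach space `L` is a Lindenstrauss space if every finite-dimensional subspace is,
up to `1 + ε`, contained in a finite-dimensional subspace `(1+ε)`-isomorphic to some `ℓ∞ⁿ`. -/
def IsLindenstrauss (L : Type*) [NormedAddCommGroup L] [NormedSpace ℝ L] : Prop :=
  ∀ ε : ℝ, 0 < ε → ∀ F : Submodule ℝ L, FiniteDimensional ℝ F →
    ∃ G : Submodule ℝ L, F ≤ G ∧ FiniteDimensional ℝ G ∧
      ∃ (n : ℕ) (S : G ≃L[ℝ] PiLp ⊤ (fun _ : Fin n => ℝ)),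
        ‖(S : G →L[ℝ] PiLp ⊤ (fun _ : Fin n => ℝ))‖ *
          ‖(S.symm : PiLp ⊤ (fun _ : Fin n => ℝ) →L[ℝ] G)‖ ≤ 1 + ε

/-- A linear map vanishing on the kernel of another one factors through it. -/
theorem LinearMap.exists_factor {C E M : Type*} [AddCommGroup C] [Module ℝ C] [AddCommGroup E]
    [Module ℝ E] [AddCommGroup M] [Module ℝ M] (A : C →ₗ[ℝ] E) (y : C →ₗ[ℝ] M)
    (h : ∀ c, A c = 0 → y c = 0) : ∃ g : E →ₗ[ℝ] M, ∀ c, g (A c) = y c := by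
  obtain ⟨s, hs⟩ := LinearMap.exists_rightInverse_of_surjective A.rangeRestrict A.range_rangeRestrict
  obtain ⟨g, hg⟩ := LinearMap.exists_extend (y ∘ₗ s)
  refine ⟨g, fun c => ?_⟩
  have h1 : g (A c) = y (s (A.rangeRestrict c)) := LinearMap.congr_fun hg (A.rangeRestrict c)
  have h2 : A (s (A.rangeRestrict c)) = A c :=
    congrArg Subtype.val (LinearMap.congr_fun hs (A.rangeRestrict c))
  rw [h1, ← sub_eq_zero, ← map_sub]
  exact h _ (by rw [map_sub, h2, sub_self])

/-- Functional extension: moments `y` dominated by `A` are attained with the same bound. -/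
theorem exists_linear_functional_comp_eq {C E : Type*} [AddCommGroup C] [Module ℝ C]
    [NormedAddCommGroup E] [NormedSpace ℝ E] (A : C →ₗ[ℝ] E) (y : C →ₗ[ℝ] ℝ) {K : ℝ} (hK : 0 ≤ K)
    (h : ∀ c, |y c| ≤ K * ‖A c‖) :
    ∃ f : E →ₗ[ℝ] ℝ, (∀ c, f (A c) = y c) ∧ ∀ e, |f e| ≤ K * ‖e‖ := by
  obtain ⟨g, hg⟩ := LinearMap.exists_factor A y fun c hc => by
    simpa [hc] using h c
  have hb : ∀ x : A.range, ‖(g ∘ₗ A.range.subtype) x‖ ≤ K * ‖x‖ := by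
    rintro ⟨_, c, rfl⟩
    simpa [hg] using h c
  obtain ⟨f, hf, hfn⟩ := exists_extension_norm_eq A.range
    ((g ∘ₗ A.range.subtype).mkContinuous K hb)
  refine ⟨f, fun c => ?_, fun e => ?_⟩
  · simpa [hg] using hf ⟨A c, c, rfl⟩
  · exact (f.le_opNorm e).trans (mul_le_mul_of_nonneg_right
      (hfn.trans_le (LinearMap.mkContinuous_norm_le _ hK _)) (norm_nonneg e))

/-- Finite-rank operators into a Lindenstrauss space extend with almost the same norm. -/
theorem IsLindenstrauss.exists_extension {L C E : Type*} [NormedAddCommGroup L] [NormedSpace ℝ L]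
    (hL : IsLindenstrauss L) [AddCommGroup C] [Module ℝ C] [FiniteDimensional ℝ C]
    [NormedAddCommGroup E] [NormedSpace ℝ E] (A : C →ₗ[ℝ] E) (y : C →ₗ[ℝ] L) {K K' : ℝ}
    (hK : 0 < K) (hKK' : K < K') (h : ∀ c, ‖y c‖ ≤ K * ‖A c‖) :
    ∃ R : E →ₗ[ℝ] L, (∀ c, R (A c) = y c) ∧ ∀ e, ‖R e‖ ≤ K' * ‖e‖ := by
  obtain ⟨G, hG, -, n, S, hS⟩ := hL (K' / K - 1) (by
    rw [sub_pos, lt_div_iff₀ hK]; simpa) y.range inferInstance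
  have hyG : ∀ c, y c ∈ G := fun c => hG ⟨c, rfl⟩
  let s : C →ₗ[ℝ] PiLp ⊤ (fun _ : Fin n => ℝ) := (S : G →ₗ[ℝ] _) ∘ₗ y.codRestrict G hyG
  have hs : ∀ c, ‖s c‖ ≤ ‖(S : G →L[ℝ] PiLp ⊤ (fun _ : Fin n => ℝ))‖ * K * ‖A c‖ := fun c => by
    rw [mul_assoc]
    exact ((S : G →L[ℝ] PiLp ⊤ (fun _ : Fin n => ℝ)).le_opNorm ⟨y c, hyG c⟩).trans
      (mul_le_mul_of_nonneg_left (h c) (norm_nonneg _))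
  have key : ∀ i : Fin n, ∃ f : E →ₗ[ℝ] ℝ, (∀ c, f (A c) = s c i) ∧
      ∀ e, |f e| ≤ ‖(S : G →L[ℝ] PiLp ⊤ (fun _ : Fin n => ℝ))‖ * K * ‖e‖ := fun i =>
    exists_linear_functional_comp_eq A
      (LinearMap.proj i ∘ₗ (WithLp.linearEquiv ⊤ ℝ (Fin n → ℝ)).toLinearMap ∘ₗ s)
      (by positivity) fun c => (PiLp.norm_apply_le (s c) i).trans (hs c)
  choose f hf hfb using key
  let R : E →ₗ[ℝ] L := G.subtype ∘ₗ (S.symm : _ →ₗ[ℝ] G) ∘ₗ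
    (WithLp.linearEquiv ⊤ ℝ (Fin n → ℝ)).symm.toLinearMap ∘ₗ LinearMap.pi f
  have hR : ∀ e, R e = S.symm (WithLp.toLp ⊤ fun i => f i e) := fun e => rfl
  refine ⟨R, fun c => ?_, fun e => ?_⟩
  · have : (WithLp.toLp ⊤ fun i => f i (A c)) = S ⟨y c, hyG c⟩ := by
      ext i
      exact hf i c
    rw [hR, this, S.symm_apply_apply]
  · have h1 : ‖(WithLp.toLp ⊤ fun i => f i e : PiLp ⊤ (fun _ : Fin n => ℝ))‖ ≤
        ‖(S : G →L[ℝ] PiLp ⊤ (fun _ : Fin n => ℝ))‖ * K * ‖e‖ := by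
      rw [PiLp.norm_eq_ciSup]
      exact Real.iSup_le (fun i => hfb i e) (by positivity)
    calc ‖R e‖ ≤ ‖(S.symm : PiLp ⊤ (fun _ : Fin n => ℝ) →L[ℝ] G)‖ *
          ‖(WithLp.toLp ⊤ fun i => f i e : PiLp ⊤ (fun _ : Fin n => ℝ))‖ :=
          (S.symm : PiLp ⊤ (fun _ : Fin n => ℝ) →L[ℝ] G).le_opNorm _
      _ ≤ ‖(S.symm : PiLp ⊤ (fun _ : Fin n => ℝ) →L[ℝ] G)‖ *
          (‖(S : G →L[ℝ] PiLp ⊤ (fun _ : Fin n => ℝ))‖ * K * ‖e‖) := by gcongr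
      _ = ‖(S : G →L[ℝ] PiLp ⊤ (fun _ : Fin n => ℝ))‖ *
          ‖(S.symm : PiLp ⊤ (fun _ : Fin n => ℝ) →L[ℝ] G)‖ * (K * ‖e‖) := by ring
      _ ≤ (1 + (K' / K - 1)) * (K * ‖e‖) := by gcongr
      _ = K' * ‖e‖ := by field_simp; ring

/-- Finite-dimensional spaces embed almost isometrically into some `ℓ∞^N`. -/
theorem exists_almost_isometry_pi {B : Type*} [NormedAddCommGroup B] [NormedSpace ℝ B]
    [FiniteDimensional ℝ B] {δ : ℝ} (hδ : 0 < δ) :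
    ∃ (N : ℕ) (h : B →ₗ[ℝ] (Fin N → ℝ)), ∀ b, (1 - δ) * ‖b‖ ≤ ‖h b‖ ∧ ‖h b‖ ≤ ‖b‖ := by
  obtain ⟨t, hts, htf, ht⟩ := (isCompact_sphere (0 : B) 1).finite_cover_balls hδ
  choose g hg1 hg2 using fun x : B => exists_dual_vector'' ℝ x
  have := htf.fintype
  let e := Fintype.equivFin t
  refine ⟨Fintype.card t, LinearMap.pi fun i => (g (e.symm i) : B →ₗ[ℝ] ℝ), fun b => ⟨?_, ?_⟩⟩
  · rcases eq_or_ne b 0 with rfl | hb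
    · simp
    have hb' : 0 < ‖b‖ := norm_pos_iff.2 hb
    have hu : ‖‖b‖⁻¹ • b‖ = 1 := by
      rw [norm_smul, norm_inv, norm_norm, inv_mul_cancel₀ hb'.ne']
    obtain ⟨x, hx, hxb⟩ := Set.mem_iUnion₂.1 (ht (mem_sphere_zero_iff_norm.2 hu))
    rw [Metric.mem_ball, dist_eq_norm] at hxb
    have h1 : 1 - g x (‖b‖⁻¹ • b) ≤ δ := by
      have h2 : g x x = 1 := by simpa [mem_sphere_zero_iff_norm.1 (hts hx)] using hg2 x
      rw [← h2, ← map_sub]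
      refine ((le_abs_self _).trans ((g x).le_of_opNorm_le (hg1 x) _)).trans ?_
      rw [one_mul, norm_sub_rev]
      exact hxb.le
    have h3 : (1 - δ) * ‖b‖ ≤ g x b := by
      have h4 : g x b = g x (‖b‖⁻¹ • b) * ‖b‖ := by
        rw [map_smul, smul_eq_mul]
        field_simp
      rw [h4]
      exact mul_le_mul_of_nonneg_right (by linarith) hb'.le
    refine h3.trans ((le_abs_self _).trans ?_)
    have h5 := norm_le_pi_norm (LinearMap.pi (fun i => (g (e.symm i) : B →ₗ[ℝ] ℝ)) b) (e ⟨x, hx⟩)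
    simpa using h5
  · refine (pi_norm_le_iff_of_nonneg (norm_nonneg b)).2 fun i => ?_
    exact ((g (e.symm i)).le_opNorm b).trans (mul_le_of_le_one_left (norm_nonneg b) (hg1 _))

/-- The pushout seminorm: the image in `V` of the amalgam of `(V, p)` and `E` along
`U : C → V` and `A : C → E`, where `β : V → E` reads off the coordinates of the copy of `E`. -/
noncomputable def pushoutSeminorm {V C E : Type*} [AddCommGroup V] [Module ℝ V] [AddCommGroup C]
    [Module ℝ C] [NormedAddCommGroup E] [NormedSpace ℝ E] (p : Seminorm ℝ V) (β : V →ₗ[ℝ] E)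
    (U : C →ₗ[ℝ] V) (A : C →ₗ[ℝ] E) : Seminorm ℝ V :=
  have bdd : ∀ v, BddBelow (Set.range fun c => p (v - U c) + ‖β v + A c‖) := fun v =>
    ⟨0, by rintro _ ⟨c, rfl⟩; positivity⟩
  Seminorm.ofSMulLE (fun v => ⨅ c, p (v - U c) + ‖β v + A c‖)
    (le_antisymm ((ciInf_le (bdd 0) 0).trans (by simp)) (Real.iInf_nonneg fun c => by positivity))
    (fun x y => by
      refine le_ciInf_add_ciInf fun c c' => (ciInf_le (bdd (x + y)) (c + c')).trans ?_
      have h1 : x + y - U (c + c') = (x - U c) + (y - U c') := by rw [map_add]; abel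
      have h2 : β (x + y) + A (c + c') = (β x + A c) + (β y + A c') := by
        rw [map_add, map_add]; abel
      rw [h1, h2]
      linarith [map_add_le_add p (x - U c) (y - U c'), norm_add_le (β x + A c) (β y + A c')])
    (fun r x => by
      rw [Real.mul_iInf_of_nonneg (norm_nonneg r)]
      refine le_ciInf fun c => (ciInf_le (bdd (r • x)) (r • c)).trans ?_
      rw [map_smul, map_smul, map_smul, ← smul_sub, ← smul_add, map_smul_eq_mul, norm_smul,
        mul_add])

section pushoutSeminorm

variable {V C E : Type*} [AddCommGroup V] [Module ℝ V] [AddCommGroup C]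
    [Module ℝ C] [NormedAddCommGroup E] [NormedSpace ℝ E] (p : Seminorm ℝ V) (β : V →ₗ[ℝ] E)
    (U : C →ₗ[ℝ] V) (A : C →ₗ[ℝ] E)

theorem pushoutSeminorm_le (v : V) (c : C) :
    pushoutSeminorm p β U A v ≤ p (v - U c) + ‖β v + A c‖ :=
  ciInf_le ⟨0, by rintro _ ⟨c, rfl⟩; positivity⟩ c

theorem le_pushoutSeminorm {v : V} {r : ℝ} (h : ∀ c, r ≤ p (v - U c) + ‖β v + A c‖) :
    r ≤ pushoutSeminorm p β U A v :=
  le_ciInf h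

theorem pushoutSeminorm_eq_of_map_eq_zero (h : ∀ c, p (U c) ≤ ‖A c‖) {v : V} (hv : β v = 0) :
    pushoutSeminorm p β U A v = p v := by
  refine le_antisymm ((pushoutSeminorm_le p β U A v 0).trans (by simp [hv]))
    (le_pushoutSeminorm p β U A fun c => ?_)
  rw [hv, zero_add]
  have := map_add_le_add p (v - U c) (U c)
  rw [sub_add_cancel] at this
  linarith [h c]

end pushoutSeminorm

/-- The ambient space of the construction: countably many blocks of new coordinates over `X`. -/
abbrev BlockSpace (X : Type*) := X × (ℕ × ℕ →₀ ℝ)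

namespace BlockSpace

variable {X : Type*} [NormedAddCommGroup X] [NormedSpace ℝ X]

/-- The subspace of vectors whose coordinates vanish in the blocks from the `n`-th on. -/
def level (X : Type*) [NormedAddCommGroup X] [NormedSpace ℝ X] (n : ℕ) :
    Submodule ℝ (BlockSpace X) where
  carrier := {v | ∀ k i, n ≤ k → v.2 (k, i) = 0}
  add_mem' hv hw k i hk := by simp [hv k i hk, hw k i hk]
  zero_mem' k i hk := rfl
  smul_mem' r v hv k i hk := by simp [hv k i hk]

theorem level_mono : Monotone (level X) := fun _ _ hmn _ hv k i hk => hv k i (hmn.trans hk)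

theorem exists_mem_level (v : BlockSpace X) : ∃ n, v ∈ level X n := by
  refine ⟨v.2.support.sup (fun z => z.1 + 1), fun k i hk => ?_⟩
  by_contra h
  have := Finset.le_sup (f := fun z : ℕ × ℕ => z.1 + 1) (Finsupp.mem_support_iff.2 h)
  simp only at this
  omega

/-- The first `N` coordinates in the `n`-th block. -/
noncomputable def coord (X : Type*) [NormedAddCommGroup X] [NormedSpace ℝ X] (n N : ℕ) :
    BlockSpace X →ₗ[ℝ] (Fin N → ℝ) :=
  LinearMap.pi fun i => Finsupp.lapply (n, (i : ℕ)) ∘ₗ LinearMap.snd ℝ _ _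

/-- The inclusion of `ℝ^N` in the `n`-th block. -/
noncomputable def incl (X : Type*) [NormedAddCommGroup X] [NormedSpace ℝ X] (n N : ℕ) :
    (Fin N → ℝ) →ₗ[ℝ] BlockSpace X :=
  LinearMap.inr ℝ _ _ ∘ₗ ∑ i : Fin N, Finsupp.lsingle (n, (i : ℕ)) ∘ₗ LinearMap.proj i

theorem coord_eq_zero {n : ℕ} (N : ℕ) {v : BlockSpace X} (hv : v ∈ level X n) :
    coord X n N v = 0 :=
  funext fun i => hv n i le_rfl

theorem incl_snd (n N : ℕ) (b : Fin N → ℝ) :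
    (incl X n N b).2 = ∑ i : Fin N, Finsupp.single (n, (i : ℕ)) (b i) := by
  simp [incl]

theorem coord_incl (n N : ℕ) (b : Fin N → ℝ) : coord X n N (incl X n N b) = b := by
  ext i
  change (incl X n N b).2 (n, (i : ℕ)) = b i
  rw [incl_snd, Finsupp.finsetSum_apply, Finset.sum_eq_single i]
  · simp
  · intro j _ hj
    simp [Fin.val_inj, hj]
  · simp

theorem coord_incl_of_ne {n k : ℕ} (hnk : k ≠ n) (M N : ℕ) (b : Fin N → ℝ) :
    coord X n M (incl X k N b) = 0 := by
  ext i
  change (incl X k N b).2 (n, (i : ℕ)) = 0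
  rw [incl_snd, Finsupp.finsetSum_apply]
  exact Finset.sum_eq_zero fun j _ => by simp [hnk]

theorem incl_mem_level (n N : ℕ) (b : Fin N → ℝ) : incl X n N b ∈ level X (n + 1) := by
  intro k i hk
  rw [incl_snd, Finsupp.finsetSum_apply]
  refine Finset.sum_eq_zero fun j _ => ?_
  rw [Finsupp.single_apply, if_neg]
  rintro h
  have := congrArg Prod.fst h
  simp only at this
  omega

/-- A sequence of maps stabilising along the levels has a limit map. -/
theorem exists_limit {Y : Type*} (f : ℕ → BlockSpace X → Y)
    (hf : ∀ n, ∀ v ∈ level X n, f (n + 1) v = f n v) :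
    ∃ g : BlockSpace X → Y, ∀ n, ∀ v ∈ level X n, g v = f n v := by
  have key : ∀ n v, v ∈ level X n → ∀ m, n ≤ m → f m v = f n v := by
    intro n v hv m hm
    induction m, hm using Nat.le_induction with
    | base => rfl
    | succ m hm ih => rw [hf m v (level_mono hm hv), ih]
  choose l hl using exists_mem_level (X := X)
  refine ⟨fun v => f (l v) v, fun n v hv => ?_⟩
  rcases le_total n (l v) with h | h
  · exact key n v hv _ h
  · exact (key _ v (hl v) _ h).symm

end BlockSpace

/-- The data of an amalgamation: `m` rational vectors in `ℓ∞^N` to be identified with the `m`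
vectors of a space having the given indices in a fixed sequence. -/
abbrev PushoutDatum := Σ N m : ℕ, (Fin m → Fin N → ℚ) × (Fin m → ℕ)

namespace PushoutDatum

/-- The operator `c ↦ ∑ cᵢ aᵢ` into `ℓ∞^N`. -/
noncomputable def cubeMap (d : PushoutDatum) : (Fin d.2.1 → ℝ) →ₗ[ℝ] (Fin d.1 → ℝ) :=
  Fintype.linearCombination ℝ fun i k => (d.2.2.1 i k : ℝ)

/-- The operator `c ↦ ∑ cᵢ uᵢ` into the space carrying the sequence `q`. -/
noncomputable def spaceMap {V : Type*} [AddCommGroup V] [Module ℝ V] (q : ℕ → V)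
    (d : PushoutDatum) : (Fin d.2.1 → ℝ) →ₗ[ℝ] V :=
  Fintype.linearCombination ℝ fun i => q (d.2.2.2 i)

end PushoutDatum

namespace BlockSpace

variable {X : Type*} [NormedAddCommGroup X] [NormedSpace ℝ X]

open PushoutDatum

/-- The datum `d` is admissible at stage `n` if its vectors live in the first `n` blocks and the
identification is contractive. -/
def Admissible (q : ℕ → BlockSpace X) (d : PushoutDatum) (n : ℕ)
    (p : Seminorm ℝ (BlockSpace X)) : Prop :=
  ∀ c, spaceMap q d c ∈ level X n ∧ p (spaceMap q d c) ≤ ‖cubeMap d c‖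

open Classical in
/-- The chain of pushouts, the `n`-th amalgamation adding the `n`-th block. -/
noncomputable def tower (q : ℕ → BlockSpace X) (d : ℕ → PushoutDatum) :
    ℕ → Seminorm ℝ (BlockSpace X)
  | 0 => (normSeminorm ℝ X).comp (LinearMap.fst ℝ X (ℕ × ℕ →₀ ℝ))
  | n + 1 => if Admissible q (d n) n (tower q d n) then
      pushoutSeminorm (tower q d n) (coord X n (d n).1) (spaceMap q (d n)) (cubeMap (d n))
    else tower q d n

section tower

variable (q : ℕ → BlockSpace X) (d : ℕ → PushoutDatum)

theorem tower_zero (v : BlockSpace X) : tower q d 0 v = ‖v.1‖ := rfl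

theorem tower_succ_of_admissible {n : ℕ} (h : Admissible q (d n) n (tower q d n)) :
    tower q d (n + 1) = pushoutSeminorm (tower q d n) (coord X n (d n).1) (spaceMap q (d n))
      (cubeMap (d n)) := if_pos h

theorem tower_succ_of_not_admissible {n : ℕ} (h : ¬ Admissible q (d n) n (tower q d n)) :
    tower q d (n + 1) = tower q d n := if_neg h

theorem tower_succ_apply (n : ℕ) {v : BlockSpace X} (hv : v ∈ level X n) :
    tower q d (n + 1) v = tower q d n v := by
  by_cases h : Admissible q (d n) n (tower q d n)
  · rw [tower_succ_of_admissible q d h]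
    exact pushoutSeminorm_eq_of_map_eq_zero _ _ _ _ (fun c => (h c).2) (coord_eq_zero _ hv)
  · rw [tower_succ_of_not_admissible q d h]

theorem tower_incl (n : ℕ) : ∀ k, n ≤ k → ∀ N b, tower q d n (incl X k N b) = 0 := by
  induction n with
  | zero =>
    intro k _ N b
    rw [tower_zero]
    simp [incl]
  | succ n ih =>
    intro k hk N b
    by_cases h : Admissible q (d n) n (tower q d n)
    · rw [tower_succ_of_admissible q d h]
      refine le_antisymm ((pushoutSeminorm_le _ _ _ _ _ 0).trans ?_) (apply_nonneg _ _)
      rw [map_zero, map_zero, sub_zero, add_zero, ih k (by omega),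
        coord_incl_of_ne (by omega : k ≠ n)]
      simp
    · rw [tower_succ_of_not_admissible q d h]
      exact ih k (by omega) N b

theorem tower_succ_incl_le {n : ℕ} (h : Admissible q (d n) n (tower q d n)) (b : Fin (d n).1 → ℝ) :
    tower q d (n + 1) (incl X n _ b) ≤ ‖b‖ := by
  rw [tower_succ_of_admissible q d h]
  refine (pushoutSeminorm_le _ _ _ _ _ 0).trans ?_
  rw [map_zero, map_zero, sub_zero, add_zero, tower_incl q d n n le_rfl, coord_incl, zero_add]

theorem le_tower_succ_incl {n : ℕ} (h : Admissible q (d n) n (tower q d n)) {κ : ℝ} (hκ0 : 0 ≤ κ)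
    (hκ1 : κ ≤ 1) (hκ : ∀ c, κ * ‖cubeMap (d n) c‖ ≤ tower q d n (spaceMap q (d n) c))
    (b : Fin (d n).1 → ℝ) : κ * ‖b‖ ≤ tower q d (n + 1) (incl X n _ b) := by
  rw [tower_succ_of_admissible q d h]
  refine le_pushoutSeminorm _ _ _ _ fun c => ?_
  rw [coord_incl]
  have h1 : tower q d n (spaceMap q (d n) c) ≤
      tower q d n (incl X n _ b - spaceMap q (d n) c) := by
    have := map_add_le_add (tower q d n) (spaceMap q (d n) c - incl X n _ b) (incl X n _ b)
    rwa [sub_add_cancel, tower_incl q d n n le_rfl, add_zero, map_sub_rev] at this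
  have h2 : ‖b‖ ≤ ‖b + cubeMap (d n) c‖ + ‖cubeMap (d n) c‖ := by
    simpa using norm_sub_le (b + cubeMap (d n) c) (cubeMap (d n) c)
  have h3 := mul_le_mul_of_nonneg_left h2 hκ0
  have h4 := mul_le_mul_of_nonneg_right hκ1 (norm_nonneg (b + cubeMap (d n) c))
  linarith [hκ c]

theorem tower_succ_incl_sub {n : ℕ} (h : Admissible q (d n) n (tower q d n))
    (c : Fin (d n).2.1 → ℝ) :
    tower q d (n + 1) (incl X n _ (cubeMap (d n) c) - spaceMap q (d n) c) = 0 := by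
  rw [tower_succ_of_admissible q d h]
  refine le_antisymm ((pushoutSeminorm_le _ _ _ _ _ (-c)).trans ?_) (apply_nonneg _ _)
  rw [map_neg, map_neg, map_sub (coord X n _), coord_incl, coord_eq_zero _ (h c).1]
  simp [tower_incl q d n n le_rfl]

theorem exists_tower_succ_extension {L : Type*} [NormedAddCommGroup L] [NormedSpace ℝ L]
    (hL : IsLindenstrauss L) (n : ℕ) {K K' : ℝ} (hK : 0 < K) (hKK' : K < K')
    (T : BlockSpace X →ₗ[ℝ] L) (hT : ∀ v, ‖T v‖ ≤ K * tower q d n v) :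
    ∃ T' : BlockSpace X →ₗ[ℝ] L, (∀ v, ‖T' v‖ ≤ K' * tower q d (n + 1) v) ∧
      ∀ v ∈ level X n, T' v = T v := by
  by_cases h : Admissible q (d n) n (tower q d n)
  · obtain ⟨R, hR, hRb⟩ := hL.exists_extension (cubeMap (d n)) (T ∘ₗ spaceMap q (d n)) hK hKK'
      fun c => (hT _).trans (mul_le_mul_of_nonneg_left (h c).2 hK.le)
    refine ⟨T + R ∘ₗ coord X n _, fun v => ?_, fun v hv => ?_⟩
    · rw [tower_succ_of_admissible q d h, ← div_le_iff₀' (hK.trans hKK')]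
      refine le_pushoutSeminorm _ _ _ _ fun c => ?_
      rw [div_le_iff₀' (hK.trans hKK')]
      have h1 : (T + R ∘ₗ coord X n _) v =
          T (v - spaceMap q (d n) c) + R (coord X n _ v + cubeMap (d n) c) := by
        rw [map_sub, map_add, hR]
        simp
      rw [h1, mul_add]
      exact (norm_add_le _ _).trans (add_le_add ((hT _).trans
        (mul_le_mul_of_nonneg_right hKK'.le (apply_nonneg _ _))) (hRb _))
    · simp [coord_eq_zero _ hv]
  · refine ⟨T, fun v => ?_, fun v _ => rfl⟩
    rw [tower_succ_of_not_admissible q d h]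
    exact (hT v).trans (mul_le_mul_of_nonneg_right hKK'.le (apply_nonneg _ _))

/-- The direct limit of the tower. -/
theorem exists_tower_limit : ∃ p : Seminorm ℝ (BlockSpace X),
    ∀ n, ∀ v ∈ level X n, p v = tower q d n v := by
  obtain ⟨g, hg⟩ := exists_limit (fun n v => tower q d n v) fun n v hv => tower_succ_apply q d n hv
  have hadd : ∀ v w, g (v + w) ≤ g v + g w := fun v w => by
    obtain ⟨n, hv⟩ := exists_mem_level v
    obtain ⟨m, hw⟩ := exists_mem_level w
    have hv' := level_mono (le_max_left n m) hv
    have hw' := level_mono (le_max_right n m) hw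
    rw [hg _ _ hv', hg _ _ hw', hg _ _ (add_mem hv' hw')]
    exact map_add_le_add _ _ _
  have hsmul : ∀ (r : ℝ) v, g (r • v) = ‖r‖ * g v := fun r v => by
    obtain ⟨n, hv⟩ := exists_mem_level v
    rw [hg _ _ hv, hg _ _ (Submodule.smul_mem _ r hv)]
    exact map_smul_eq_mul _ _ _
  exact ⟨@Seminorm.of ℝ (BlockSpace X) _ _ _ g hadd hsmul, hg⟩

/-- Contractions on `X` extend to the limit of the tower with norm at most `1 + ε`. -/
theorem exists_tower_limit_extension {p : Seminorm ℝ (BlockSpace X)}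
    (hp : ∀ n, ∀ v ∈ level X n, p v = tower q d n v) {L : Type*} [NormedAddCommGroup L]
    [NormedSpace ℝ L] (hL : IsLindenstrauss L) (τ : X →L[ℝ] L) (hτ : ‖τ‖ ≤ 1) {ε : ℝ}
    (hε : 0 < ε) :
    ∃ T : BlockSpace X →ₗ[ℝ] L, (∀ x, T (x, 0) = τ x) ∧ ∀ v, ‖T v‖ ≤ (1 + ε) * p v := by
  let K : ℕ → ℝ := fun n => 1 + ε * (1 - (1 / 2) ^ n)
  have hpow : ∀ n : ℕ, (0 : ℝ) < (1 / 2) ^ n ∧ (1 / 2 : ℝ) ^ n ≤ 1 := fun n =>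
    ⟨by positivity, pow_le_one₀ (by norm_num) (by norm_num)⟩
  have hK0 : ∀ n, 0 < K n := fun n => by
    have := mul_nonneg hε.le (sub_nonneg.2 (hpow n).2)
    simp only [K]
    linarith
  have hK1 : ∀ n, K n < K (n + 1) := fun n => by
    have := mul_pos hε (hpow n).1
    simp only [K, pow_succ]
    linarith
  have hK2 : ∀ n, K n ≤ 1 + ε := fun n => by
    have := mul_pos hε (hpow n).1
    simp only [K]
    linarith
  choose! S hS1 hS2 using fun n (T : BlockSpace X →ₗ[ℝ] L)
    (hT : ∀ v, ‖T v‖ ≤ K n * tower q d n v) =>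
    exists_tower_succ_extension q d hL n (hK0 n) (hK1 n) T hT
  let T : ℕ → (BlockSpace X →ₗ[ℝ] L) := fun n =>
    Nat.rec ((τ : X →ₗ[ℝ] L) ∘ₗ LinearMap.fst ℝ _ _) S n
  have hT : ∀ n v, ‖T n v‖ ≤ K n * tower q d n v := by
    intro n
    induction n with
    | zero =>
      intro v
      simpa [K, T, tower_zero] using τ.le_of_opNorm_le hτ v.1
    | succ n ih => exact hS1 n _ ih
  obtain ⟨g, hg⟩ := exists_limit (fun n v => T n v) fun n v hv => hS2 n _ (hT n) v hv
  refine ⟨{ toFun := g, map_add' := fun v w => ?_, map_smul' := fun r v => ?_ },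
    fun x => hg 0 (x, 0) fun _ _ _ => rfl, fun v => ?_⟩
  · obtain ⟨n, hv⟩ := exists_mem_level v
    obtain ⟨m, hw⟩ := exists_mem_level w
    have hv' := level_mono (le_max_left n m) hv
    have hw' := level_mono (le_max_right n m) hw
    rw [hg _ _ hv', hg _ _ hw', hg _ _ (add_mem hv' hw'), map_add]
  · obtain ⟨n, hv⟩ := exists_mem_level v
    rw [hg _ _ hv, hg _ _ (Submodule.smul_mem _ r hv), map_smul, RingHom.id_apply]
  · obtain ⟨n, hv⟩ := exists_mem_level v
    change ‖g v‖ ≤ _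
    rw [hg n v hv, hp n v hv]
    exact (hT n v).trans (mul_le_mul_of_nonneg_right (hK2 n) (apply_nonneg _ _))

/-- Every rational amalgamation problem which is admissible in the limit is solved there. -/
theorem exists_tower_limit_amalgam {p : Seminorm ℝ (BlockSpace X)}
    (hp : ∀ n, ∀ v ∈ level X n, p v = tower q d n v) (e : PushoutDatum)
    (hd : ∀ n₀, ∃ n ≥ n₀, d n = e) (he : ∀ c, p (spaceMap q e c) ≤ ‖cubeMap e c‖) :
    ∃ φ : (Fin e.1 → ℝ) →ₗ[ℝ] BlockSpace X, (∀ b, p (φ b) ≤ ‖b‖) ∧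
      (∀ c, p (φ (cubeMap e c) - spaceMap q e c) = 0) ∧
      ∀ κ : ℝ, 0 ≤ κ → κ ≤ 1 → (∀ c, κ * ‖cubeMap e c‖ ≤ p (spaceMap q e c)) →
        ∀ b, κ * ‖b‖ ≤ p (φ b) := by
  choose l hl using exists_mem_level (X := X)
  obtain ⟨n, hn, rfl⟩ := hd (Finset.univ.sup fun i => l (q (e.2.2.2 i)))
  have hU : ∀ c, spaceMap q (d n) c ∈ level X n := fun c => by
    rw [spaceMap, Fintype.linearCombination_apply]
    refine sum_mem fun i _ => Submodule.smul_mem _ _ (level_mono ?_ (hl _))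
    exact (Finset.le_sup (f := fun i => l (q ((d n).2.2.2 i))) (Finset.mem_univ i)).trans hn
  have hadm : Admissible q (d n) n (tower q d n) := fun c => ⟨hU c, by
    rw [← hp n _ (hU c)]
    exact he c⟩
  refine ⟨incl X n _, fun b => ?_, fun c => ?_, fun κ h0 h1 hκ b => ?_⟩
  · rw [hp _ _ (incl_mem_level n _ b)]
    exact tower_succ_incl_le q d hadm b
  · rw [hp _ _ (sub_mem (incl_mem_level n _ _) (level_mono n.le_succ (hU c)))]
    exact tower_succ_incl_sub q d hadm c
  · rw [hp _ _ (incl_mem_level n _ b)]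
    refine le_tower_succ_incl q d hadm h0 h1 (fun c => ?_) b
    rw [← hp n _ (hU c)]
    exact hκ c

end tower

/-- A sequence in the block space which is dense for every seminorm extending the norm of `X`. -/
theorem exists_dense_seq (X : Type*) [NormedAddCommGroup X] [NormedSpace ℝ X]
    [TopologicalSpace.SeparableSpace X] : ∃ q : ℕ → BlockSpace X,
      ∀ p : Seminorm ℝ (BlockSpace X), (∀ x, p (x, 0) = ‖x‖) →
        ∀ v, ∀ δ > 0, ∃ k, p (v - q k) < δ := by
  let e : ℕ ⊕ ((ℕ × ℕ) × ℚ) → BlockSpace X := Sum.elim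
    (fun k => (TopologicalSpace.denseSeq X k, 0)) (fun z => (0, Finsupp.single z.1 (z.2 : ℝ)))
  obtain ⟨f, hf⟩ := exists_surjective_nat (List (ℕ ⊕ ((ℕ × ℕ) × ℚ)))
  refine ⟨fun k => ((f k).map e).sum, fun p hp v => ?_⟩
  suffices h : ∀ δ > 0, ∃ l : List _, p (v - (l.map e).sum) < δ by
    intro δ hδ
    obtain ⟨l, hl⟩ := h δ hδ
    obtain ⟨k, rfl⟩ := hf l
    exact ⟨k, hl⟩
  have hadd : ∀ v w : BlockSpace X, (∀ δ > 0, ∃ l : List _, p (v - (l.map e).sum) < δ) →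
      (∀ δ > 0, ∃ l : List _, p (w - (l.map e).sum) < δ) →
      ∀ δ > 0, ∃ l : List _, p (v + w - (l.map e).sum) < δ := by
    intro v w hv hw δ hδ
    obtain ⟨l, hl⟩ := hv (δ / 2) (half_pos hδ)
    obtain ⟨l', hl'⟩ := hw (δ / 2) (half_pos hδ)
    refine ⟨l ++ l', ?_⟩
    rw [List.map_append, List.sum_append, add_sub_add_comm]
    linarith [map_add_le_add p (v - (l.map e).sum) (w - (l'.map e).sum)]
  obtain ⟨x, c⟩ := v
  rw [show ((x, c) : BlockSpace X) = (x, 0) + (0, c) by simp]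
  refine hadd _ _ (fun δ hδ => ?_) ?_
  · obtain ⟨k, hk⟩ := Metric.denseRange_iff.1 (TopologicalSpace.denseRange_denseSeq X) x δ hδ
    refine ⟨[Sum.inl k], ?_⟩
    simpa [e, hp, dist_eq_norm] using hk
  · induction c using Finsupp.induction_linear with
    | zero => exact fun δ hδ => ⟨[], by simpa [hp] using hδ⟩
    | add c c' hc hc' =>
      rw [show ((0, c + c') : BlockSpace X) = (0, c) + (0, c') by simp]
      exact hadd _ _ hc hc'
    | single z t =>
      intro δ hδ
      set M := p (0, Finsupp.single z 1) with hM
      have hM0 : 0 ≤ M := apply_nonneg _ _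
      obtain ⟨r, hr1, hr2⟩ := exists_rat_btwn (show t < t + δ / (M + 1) by
        linarith [div_pos hδ (by linarith : 0 < M + 1)])
      refine ⟨[Sum.inr (z, r)], ?_⟩
      have h1 : ((0, Finsupp.single z t) : BlockSpace X) - (([Sum.inr (z, r)]).map e).sum =
          (t - (r : ℝ)) • (0, Finsupp.single z 1) := by
        simp [e, ← Finsupp.single_sub]
      rw [h1, map_smul_eq_mul, ← hM, Real.norm_eq_abs, abs_sub_comm, abs_of_pos (by linarith)]
      calc ((r : ℝ) - t) * M ≤ δ / (M + 1) * M := by gcongr; linarith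
        _ < δ / (M + 1) * (M + 1) := by
          have := div_pos hδ (by linarith : 0 < M + 1)
          nlinarith
        _ = δ := by field_simp

end BlockSpace

/-- A linear combination of vectors of norm at most `η` is bounded by its sup-norm. -/
theorem norm_sum_smul_le {W : Type*} [SeminormedAddCommGroup W] [NormedSpace ℝ W] {m : ℕ}
    (r : Fin m → W) {η : ℝ} (hr : ∀ i, ‖r i‖ ≤ η) (c : Fin m → ℝ) :
    ‖∑ i, c i • r i‖ ≤ m * η * ‖c‖ := by
  refine (norm_sum_le _ _).trans ?_
  calc ∑ i, ‖c i • r i‖ ≤ ∑ _i : Fin m, ‖c‖ * η := Finset.sum_le_sum fun i _ => by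
        rw [norm_smul]
        exact mul_le_mul (norm_le_pi_norm c i) (hr i) (norm_nonneg _) (norm_nonneg _)
    _ = m * η * ‖c‖ := by simp; ring

/-- A normed space with a dense sequence in which all contractive rational amalgamation problems
are solved is of almost universal disposition for finite-dimensional spaces. -/
theorem almostUnivDispFinDim_of_amalgam {G : Type*} [NormedAddCommGroup G] [NormedSpace ℝ G]
    (q : ℕ → G) (hq : ∀ g, ∀ δ > 0, ∃ k, ‖g - q k‖ < δ)
    (hG : ∀ e : PushoutDatum, (∀ c, ‖e.spaceMap q c‖ ≤ ‖e.cubeMap c‖) →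
      ∃ φ : (Fin e.1 → ℝ) →ₗ[ℝ] G, (∀ b, ‖φ b‖ ≤ ‖b‖) ∧
        (∀ c, φ (e.cubeMap c) = e.spaceMap q c) ∧
        ∀ κ : ℝ, 0 ≤ κ → κ ≤ 1 → (∀ c, κ * ‖e.cubeMap c‖ ≤ ‖e.spaceMap q c‖) →
          ∀ b, κ * ‖b‖ ≤ ‖φ b‖) :
    AlmostUnivDispFinDim G := by
  intro A B _ _ _ _ _ _ u j ε hε
  obtain ⟨δ, hδ, hδ1, hδε⟩ : ∃ δ : ℝ, 0 < δ ∧ δ ≤ 1 / 20 ∧ 20 * δ ≤ ε :=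
    ⟨min ε 1 / 20, by positivity, by linarith [min_le_right ε 1], by linarith [min_le_left ε 1]⟩
  obtain ⟨P₀, hP₀⟩ := j.toLinearMap.exists_leftInverse_of_injective
    (LinearMap.ker_eq_bot.2 j.injective)
  let P : B →L[ℝ] A := LinearMap.toContinuousLinearMap P₀
  have hP : ∀ a, P (j a) = a := fun a => LinearMap.congr_fun hP₀ a
  obtain ⟨θ, hθ, hθδ, hθP⟩ : ∃ θ : ℝ, 0 < θ ∧ 2 * θ ≤ δ ∧ 2 * θ * ‖P‖ ≤ δ := by
    have h0 := norm_nonneg P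
    have h1 : 0 < ‖P‖ + 1 := by linarith
    refine ⟨δ / (2 * (‖P‖ + 1)), by positivity, ?_, ?_⟩
    · have : 2 * (δ / (2 * (‖P‖ + 1))) = δ / (‖P‖ + 1) := by field_simp
      rw [this]
      exact div_le_self hδ.le (by linarith)
    · have : 2 * (δ / (2 * (‖P‖ + 1))) * ‖P‖ = δ * (‖P‖ / (‖P‖ + 1)) := by field_simp
      rw [this]
      exact mul_le_of_le_one_right hδ.le ((div_le_one h1).2 (by linarith))
  obtain ⟨N, h, hh⟩ : ∃ (N : ℕ) (h : B →ₗ[ℝ] (Fin N → ℝ)),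
      ∀ b, (1 + δ) * ‖b‖ ≤ ‖h b‖ ∧ ‖h b‖ ≤ (1 + 2 * δ) * ‖b‖ := by
    obtain ⟨N, h, hh⟩ := exists_almost_isometry_pi (B := B)
      (show 0 < δ / (1 + 2 * δ) by positivity)
    refine ⟨N, (1 + 2 * δ) • h, fun b => ?_⟩
    rw [LinearMap.smul_apply, norm_smul, Real.norm_of_nonneg (by positivity)]
    refine ⟨?_, mul_le_mul_of_nonneg_left (hh b).2 (by positivity)⟩
    refine le_trans (le_of_eq ?_) (mul_le_mul_of_nonneg_left (hh b).1 (by positivity))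
    field_simp
    ring
  let β := Module.finBasis ℝ A
  let m := Module.finrank ℝ A
  obtain ⟨K, hK0, hK⟩ : ∃ K : ℝ, 0 ≤ K ∧ ∀ a, ‖β.equivFun a‖ ≤ K * ‖a‖ :=
    ⟨_, norm_nonneg _, (LinearMap.toContinuousLinearMap β.equivFun.toLinearMap).le_opNorm⟩
  obtain ⟨η, hη, hηθ⟩ : ∃ η : ℝ, 0 < η ∧ m * η * K ≤ θ := by
    have h1 : 0 ≤ m * K := by positivity
    refine ⟨θ / (m * K + 1), by positivity, ?_⟩
    have : m * (θ / (m * K + 1)) * K = θ * (m * K / (m * K + 1)) := by field_simp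
    rw [this]
    exact mul_le_of_le_one_right hθ.le ((div_le_one (by linarith)).2 (by linarith))
  choose x hx using fun i k => exists_rat_near (h (j (β i)) k) hη
  choose k hk using fun i => hq (u (β i)) η hη
  let e : PushoutDatum := ⟨N, m, x, k⟩
  have hcube : ∀ a, ‖h (j a) - e.cubeMap (β.equivFun a)‖ ≤ θ * ‖a‖ := fun a => by
    have h1 : h (j a) - e.cubeMap (β.equivFun a) =
        ∑ i, β.equivFun a i • (h (j (β i)) - fun l => (x i l : ℝ)) := by
      have h2 : h (j a) = ∑ i, β.equivFun a i • h (j (β i)) := by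
        conv_lhs => rw [← β.sum_equivFun a]
        simp only [map_sum, map_smul]
      rw [h2]
      simp only [PushoutDatum.cubeMap, Fintype.linearCombination_apply, smul_sub, e,
        Finset.sum_sub_distrib]
      rfl
    rw [h1]
    refine (norm_sum_smul_le _ (η := η) (fun i => ?_) _).trans ?_
    · exact (pi_norm_le_iff_of_nonneg hη.le).2 fun l => (hx i l).le
    · calc m * η * ‖β.equivFun a‖ ≤ m * η * (K * ‖a‖) := by gcongr; exact hK a
        _ = m * η * K * ‖a‖ := by ring
        _ ≤ θ * ‖a‖ := by gcongr
  have hspace : ∀ a, ‖u a - e.spaceMap q (β.equivFun a)‖ ≤ θ * ‖a‖ := fun a => by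
    have h1 : u a - e.spaceMap q (β.equivFun a) =
        ∑ i, β.equivFun a i • (u (β i) - q (k i)) := by
      have h2 : u a = ∑ i, β.equivFun a i • u (β i) := by
        conv_lhs => rw [← β.sum_equivFun a]
        simp only [map_sum, map_smul]
      rw [h2]
      simp only [PushoutDatum.spaceMap, Fintype.linearCombination_apply, smul_sub, e,
        Finset.sum_sub_distrib]
      rfl
    rw [h1]
    refine (norm_sum_smul_le _ (fun i => (hk i).le) _).trans ?_
    calc m * η * ‖β.equivFun a‖ ≤ m * η * (K * ‖a‖) := by gcongr; exact hK a
      _ = m * η * K * ‖a‖ := by ring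
      _ ≤ θ * ‖a‖ := by gcongr
  have bounds : ∀ a, ‖e.spaceMap q (β.equivFun a)‖ ≤ (1 + θ) * ‖a‖ ∧
      (1 - θ) * ‖a‖ ≤ ‖e.spaceMap q (β.equivFun a)‖ ∧
      (1 + δ - θ) * ‖a‖ ≤ ‖e.cubeMap (β.equivFun a)‖ ∧
      ‖e.cubeMap (β.equivFun a)‖ ≤ (1 + 2 * δ + θ) * ‖a‖ := fun a => by
    have h1 := abs_le.1 ((abs_norm_sub_norm_le _ _).trans (hspace a))
    have h2 := abs_le.1 ((abs_norm_sub_norm_le _ _).trans (hcube a))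
    have h3 := hh (j a)
    rw [u.norm_map] at h1
    rw [j.norm_map] at h3
    refine ⟨?_, ?_, ?_, ?_⟩ <;> linarith [h1.1, h1.2, h2.1, h2.2, h3.1, h3.2]
  obtain ⟨φ, hφ1, hφ2, hφ3⟩ := hG e fun c => by
    obtain ⟨a, rfl⟩ := β.equivFun.surjective c
    refine (bounds a).1.trans (le_trans ?_ (bounds a).2.2.1)
    gcongr
    linarith
  have hφ4 : ∀ b, (1 - 4 * δ) * ‖b‖ ≤ ‖φ b‖ := by
    refine hφ3 _ (by linarith) (by linarith) fun c => ?_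
    obtain ⟨a, rfl⟩ := β.equivFun.surjective c
    refine le_trans ?_ (bounds a).2.1
    calc (1 - 4 * δ) * ‖e.cubeMap (β.equivFun a)‖
        ≤ (1 - 4 * δ) * ((1 + 2 * δ + θ) * ‖a‖) :=
          mul_le_mul_of_nonneg_left (bounds a).2.2.2 (by linarith)
      _ = ((1 - 4 * δ) * (1 + 2 * δ + θ)) * ‖a‖ := by ring
      _ ≤ (1 - θ) * ‖a‖ := mul_le_mul_of_nonneg_right (by nlinarith) (norm_nonneg a)
  have herr : ∀ a, ‖u a - φ (h (j a))‖ ≤ 2 * θ * ‖a‖ := fun a => by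
    have h1 : u a - φ (h (j a)) = (u a - e.spaceMap q (β.equivFun a)) -
        φ (h (j a) - e.cubeMap (β.equivFun a)) := by
      rw [map_sub, hφ2]
      abel
    rw [h1]
    linarith [norm_sub_le (u a - e.spaceMap q (β.equivFun a))
      (φ (h (j a) - e.cubeMap (β.equivFun a))), hspace a, hcube a,
      hφ1 (h (j a) - e.cubeMap (β.equivFun a))]
  let D : B →ₗ[ℝ] G := (u.toLinearMap - φ ∘ₗ h ∘ₗ j.toLinearMap) ∘ₗ P.toLinearMap
  have hD : ∀ b, D b = u (P b) - φ (h (j (P b))) := fun b => rfl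
  have hDb : ∀ b, ‖D b‖ ≤ δ * ‖b‖ := fun b => by
    rw [hD]
    calc _ ≤ 2 * θ * ‖P b‖ := herr _
      _ ≤ 2 * θ * (‖P‖ * ‖b‖) := by gcongr; exact P.le_opNorm b
      _ = 2 * θ * ‖P‖ * ‖b‖ := by ring
      _ ≤ δ * ‖b‖ := by gcongr
  refine ⟨φ ∘ₗ h + D, fun b => ?_, fun a => ?_⟩
  · have h0 := norm_nonneg b
    have h1 : (φ ∘ₗ h + D) b = φ (h b) + D b := rfl
    have h2 := norm_add_le (φ (h b)) (D b)
    have h3 : ‖φ (h b)‖ ≤ ‖φ (h b) + D b‖ + ‖D b‖ := by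
      simpa using norm_sub_le (φ (h b) + D b) (D b)
    have h4 : (1 - 4 * δ) * ((1 + δ) * ‖b‖) ≤ (1 - 4 * δ) * ‖h b‖ :=
      mul_le_mul_of_nonneg_left (hh b).1 (by linarith)
    rw [h1]
    constructor
    · have h5 : (1 + ε)⁻¹ ≤ 1 - 5 * δ := by
        rw [inv_le_iff_one_le_mul₀ (by linarith)]
        nlinarith
      have h6 : 1 - 4 * δ ≤ (1 - 4 * δ) * (1 + δ) := by nlinarith
      have h7 := mul_le_mul_of_nonneg_right h5 h0
      have h8 := mul_le_mul_of_nonneg_right h6 h0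
      linarith [hDb b, hφ4 (h b)]
    · have h5 : (1 + 3 * δ) * ‖b‖ ≤ (1 + ε) * ‖b‖ :=
        mul_le_mul_of_nonneg_right (by linarith) h0
      linarith [hDb b, hφ1 (h b), (hh b).2]
  · change φ (h (j a)) + D (j a) = u a
    rw [hD, hP]
    abel

/-- The Banach space generated by a seminorm, with its extension property for bounded operators. -/
theorem Seminorm.exists_banachSpace_completion {V : Type u} [AddCommGroup V] [Module ℝ V]
    (p : Seminorm ℝ V) : ∃ (G : BanachSpaceR.{u}) (i : V →ₗ[ℝ] G.carrier),
      (∀ v, ‖i v‖ = p v) ∧ DenseRange i ∧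
      ∀ (L : Type*) [NormedAddCommGroup L] [NormedSpace ℝ L] [CompleteSpace L] (T : V →ₗ[ℝ] L)
        (K : ℝ), 0 ≤ K → (∀ v, ‖T v‖ ≤ K * p v) →
        ∃ T' : G.carrier →L[ℝ] L, (∀ v, T' (i v) = T v) ∧ ‖T'‖ ≤ K := by
  let _ : SeminormedAddCommGroup V := p.toAddGroupSeminorm.toSeminormedAddCommGroup
  let _ : NormedSpace ℝ V := ⟨fun r v => (map_smul_eq_mul p r v).le⟩
  refine ⟨⟨UniformSpace.Completion V⟩, (UniformSpace.Completion.toComplL (𝕜 := ℝ)).toLinearMap,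
    fun v => UniformSpace.Completion.norm_coe v, UniformSpace.Completion.denseRange_coe, ?_⟩
  intro L _ _ _ T K hK hT
  let S : V →L[ℝ] L := T.mkContinuous K hT
  have hS : ∀ v : V, S.extend (UniformSpace.Completion.toComplL (𝕜 := ℝ) (E := V)) v = S v :=
    S.extend_eq UniformSpace.Completion.denseRange_coe
      (UniformSpace.Completion.isUniformInducing_coe V)
  refine ⟨S.extend (UniformSpace.Completion.toComplL (𝕜 := ℝ)), hS, ?_⟩
  refine ContinuousLinearMap.opNorm_le_bound _ hK fun g => ?_
  induction g using UniformSpace.Completion.induction_on with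
  | hp => exact isClosed_le (by fun_prop) (by fun_prop)
  | ih v =>
    rw [hS, UniformSpace.Completion.norm_coe]
    exact hT v

/-- Every separable Banach space `X` embeds isometrically into a separable Banach space `G`
of almost universal disposition for finite-dimensional spaces in such a way that contractive
operators from `X` into Lindenstrauss spaces extend to `G` with norm at most `1 + ε`. -/
theorem exists_almostUnivDispFinDim_with_Lindenstrauss_extension (X : Type u)
    [NormedAddCommGroup X] [NormedSpace ℝ X] [CompleteSpace X]
    [TopologicalSpace.SeparableSpace X] :
    ∃ (G : BanachSpaceR.{u}) (j : X →ₗᵢ[ℝ] G.carrier),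
      TopologicalSpace.SeparableSpace G.carrier ∧
      AlmostUnivDispFinDim G.carrier ∧
      ∀ (L : Type) [NormedAddCommGroup L] [NormedSpace ℝ L] [CompleteSpace L],
        IsLindenstrauss L →
        ∀ τ : X →L[ℝ] L, ‖τ‖ ≤ 1 → ∀ ε : ℝ, 0 < ε →
          ∃ T : G.carrier →L[ℝ] L, (∀ x : X, T (j x) = τ x) ∧ ‖T‖ ≤ 1 + ε := by
  obtain ⟨q, hq⟩ := BlockSpace.exists_dense_seq X
  obtain ⟨f, hf⟩ := exists_surjective_nat PushoutDatum
  let d : ℕ → PushoutDatum := fun n => f n.unpair.1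
  have hd : ∀ e n₀, ∃ n ≥ n₀, d n = e := fun e n₀ => by
    obtain ⟨k, rfl⟩ := hf e
    exact ⟨Nat.pair k n₀, Nat.right_le_pair _ _, by simp [d]⟩
  obtain ⟨p, hp⟩ := BlockSpace.exists_tower_limit q d
  have hpX : ∀ x, p (x, 0) = ‖x‖ := fun x => hp 0 (x, 0) fun _ _ _ => rfl
  obtain ⟨G, i, hi, hiq, hiK⟩ := Seminorm.exists_banachSpace_completion (V := BlockSpace X) p
  have hdense : ∀ g, ∀ δ > 0, ∃ k, ‖g - i (q k)‖ < δ := fun g δ hδ => by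
    obtain ⟨v, hv⟩ := Metric.denseRange_iff.1 hiq g (δ / 2) (half_pos hδ)
    obtain ⟨k, hk⟩ := hq p hpX v (δ / 2) (half_pos hδ)
    refine ⟨k, ?_⟩
    rw [← hi, map_sub] at hk
    rw [dist_eq_norm] at hv
    linarith [norm_sub_le_norm_sub_add_norm_sub g (i v) (i (q k))]
  refine ⟨G, ⟨i ∘ₗ LinearMap.inl ℝ X (ℕ × ℕ →₀ ℝ), fun x => (hi _).trans (hpX x)⟩, ?_, ?_, ?_⟩
  · refine ⟨Set.range fun k => i (q k), Set.countable_range _, ?_⟩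
    exact Metric.denseRange_iff.2 fun g δ hδ => by simpa [dist_eq_norm] using hdense g δ hδ
  · refine almostUnivDispFinDim_of_amalgam (fun k => i (q k)) hdense fun e he => ?_
    have hU : ∀ c, e.spaceMap (fun k => i (q k)) c = i (e.spaceMap q c) := fun c => by
      simp [PushoutDatum.spaceMap, Fintype.linearCombination_apply]
    obtain ⟨φ, h1, h2, h3⟩ := BlockSpace.exists_tower_limit_amalgam q d hp e (hd e)
      fun c => by rw [← hi, ← hU]; exact he c
    refine ⟨i ∘ₗ φ, fun b => (hi _).trans_le (h1 b), fun c => ?_, fun κ h0 h1 hκ b => ?_⟩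
    · rw [hU, ← sub_eq_zero, LinearMap.comp_apply, ← map_sub, ← norm_eq_zero, hi, h2]
    · exact (h3 κ h0 h1 (fun c => by rw [← hi, ← hU]; exact hκ c) b).trans_eq (hi _).symm
  · intro L _ _ _ hL τ hτ ε hε
    obtain ⟨T, hT, hTb⟩ := BlockSpace.exists_tower_limit_extension q d hp hL τ hτ hε
    obtain ⟨T', hT', hTb'⟩ := hiK L T (1 + ε) (by linarith) hTb
    exact ⟨T', fun x => (hT' _).trans (hT x), hTb'⟩
end
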